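/- Let p ∈ (1, ∞) and r ∈ (2, ∞). Then there exists a constant C_{p,r} > 0 independent of the dimension d ∈ ℕ such that for every f ∈ ℓ^p(ℤ^d) one has ‖ V_r(𝓜_{2^n} f : n ∈ ℕ₀) ‖_{ℓ^p(ℤ^d)} ≤ C_{p,r} ‖f‖_{ℓ^p(ℤ^d)}. -/

import Mathlib

open MeasureTheory ENNReal

set_option linter.unusedSectionVars false

/-- The ℓ^p(ℤ^d) "norm" of a nonnegative (ℝ≥0∞-valued) function, `p ∈ (0,∞]`. -/
noncomputable def lpZ (d : ℕ) (p : ℝ≥0∞) (g : (Fin d → ℤ) → ℝ≥0∞) : ℝ≥0∞ :=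
  if p = ∞ then ⨆ x, g x else (∑' x, g x ^ p.toReal) ^ (1 / p.toReal)

/-- `x ↦ ‖f x‖₊` as an ℝ≥0∞-valued function. -/
noncomputable def nnC {d : ℕ} (f : (Fin d → ℤ) → ℂ) : (Fin d → ℤ) → ℝ≥0∞ :=
  fun x => (‖f x‖₊ : ℝ≥0∞)

/-- The discrete Hardy–Littlewood averaging operator over the cube `Q_t = [-t,t]^d`. -/
noncomputable def cubeAvg (d : ℕ) (t : ℝ) (f : (Fin d → ℤ) → ℂ) (x : Fin d → ℤ) : ℂ :=
  (((2 * ⌊t⌋ + 1) ^ d : ℤ) : ℂ)⁻¹ *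
    ∑ y ∈ Finset.Icc (fun _ => -⌊t⌋ : Fin d → ℤ) (fun _ => ⌊t⌋), f (x - y)

/-- The `r`-variation seminorm of a sequence `n ↦ a n`, `n ∈ ℕ₀`: the supremum over all
finite increasing sequences `n_0 < … < n_J` in `ℕ₀` of `(Σ_j |a(n_{j+1}) - a(n_j)|^r)^{1/r}`. -/
noncomputable def varSeqSem (r : ℝ) (a : ℕ → ℂ) : ℝ≥0∞ :=
  ⨆ (J : ℕ) (u : Fin (J + 1) → ℕ) (_ : StrictMono u),
    (∑ j : Fin J, (‖a (u j.succ) - a (u j.castSucc)‖₊ : ℝ≥0∞) ^ r) ^ (1 / r)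

namespace DF
noncomputable section

variable {X : Type*} [Fintype X]

/-- The Lp norm on a finite set. -/
def nm (p : ℝ) (f : X → ℝ) : ℝ := (∑ x, |f x| ^ p) ^ (1 / p)

lemma sum_abs_nonneg (p : ℝ) (f : X → ℝ) : 0 ≤ ∑ x, |f x| ^ p :=
  Finset.sum_nonneg fun _ _ => Real.rpow_nonneg (abs_nonneg _) _

lemma nm_nonneg (p : ℝ) (f : X → ℝ) : 0 ≤ nm p f := Real.rpow_nonneg (sum_abs_nonneg p f) _

lemma nm_rpow {p : ℝ} (hp : 0 < p) (f : X → ℝ) : nm p f ^ p = ∑ x, |f x| ^ p := by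
  unfold nm
  rw [← Real.rpow_mul (sum_abs_nonneg p f), one_div_mul_cancel hp.ne', Real.rpow_one]

lemma nm_le_iff {p : ℝ} (hp : 0 < p) (f : X → ℝ) {C : ℝ} (hC : 0 ≤ C) :
    nm p f ≤ C ↔ ∑ x, |f x| ^ p ≤ C ^ p := by
  rw [← nm_rpow hp]
  exact (Real.rpow_le_rpow_iff (nm_nonneg _ _) hC hp).symm

lemma nm_mono {p : ℝ} (hp : 0 < p) {f g : X → ℝ} (h : ∀ x, |f x| ≤ |g x|) : nm p f ≤ nm p g := by
  unfold nm
  apply Real.rpow_le_rpow (sum_abs_nonneg p f) _ (by positivity)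
  exact Finset.sum_le_sum fun x _ => Real.rpow_le_rpow (abs_nonneg _) (h x) hp.le

lemma nm_mono' {p : ℝ} (hp : 0 < p) {f g : X → ℝ} (h : ∀ x, |f x| ≤ g x) : nm p f ≤ nm p g :=
  nm_mono hp fun x => (h x).trans (le_abs_self _)

lemma nm_abs (p : ℝ) (f : X → ℝ) : nm p (fun x => |f x|) = nm p f := by
  simp [nm]

lemma nm_neg (p : ℝ) (f : X → ℝ) : nm p (-f) = nm p f := by
  simp [nm]

lemma nm_zero {p : ℝ} (hp : 0 < p) : nm p (0 : X → ℝ) = 0 := by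
  simp [nm, Real.zero_rpow hp.ne', Real.zero_rpow (inv_ne_zero hp.ne')]

lemma nm_add_le {p : ℝ} (hp : 1 ≤ p) (f g : X → ℝ) : nm p (f + g) ≤ nm p f + nm p g :=
  Real.Lp_add_le Finset.univ f g hp

lemma nm_sub_le {p : ℝ} (hp : 1 ≤ p) (f g : X → ℝ) : nm p (f - g) ≤ nm p f + nm p g := by
  rw [sub_eq_add_neg, ← nm_neg p g]
  exact nm_add_le hp f (-g)

lemma nm_smul {p : ℝ} (hp : 0 < p) (c : ℝ) (f : X → ℝ) : nm p (c • f) = |c| * nm p f := by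
  unfold nm
  simp only [Pi.smul_apply, smul_eq_mul, abs_mul, Real.mul_rpow (abs_nonneg _) (abs_nonneg _)]
  rw [← Finset.mul_sum, Real.mul_rpow (by positivity) (sum_abs_nonneg p f),
    ← Real.rpow_mul (abs_nonneg _), mul_one_div_cancel hp.ne', Real.rpow_one]

lemma nm_sum_le {ι : Type*} {p : ℝ} (hp : 1 ≤ p) (s : Finset ι) (f : ι → X → ℝ) :
    nm p (∑ i ∈ s, f i) ≤ ∑ i ∈ s, nm p (f i) := by
  classical
  induction s using Finset.induction_on with
  | empty => simp [nm_zero (lt_of_lt_of_le one_pos hp)]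
  | insert a s ha ih =>
    rw [Finset.sum_insert ha, Finset.sum_insert ha]
    exact (nm_add_le hp _ _).trans (by gcongr)

lemma nm_equiv (p : ℝ) (e : X ≃ X) (f : X → ℝ) : nm p (fun x => f (e x)) = nm p f := by
  unfold nm
  rw [Equiv.sum_comp e (fun x => |f x| ^ p)]

lemma holder {p q : ℝ} (h : p.HolderConjugate q) (f g : X → ℝ) :
    ∑ x, f x * g x ≤ nm p f * nm q g :=
  Real.inner_le_Lp_mul_Lq Finset.univ f g h

lemma holder_abs {p q : ℝ} (h : p.HolderConjugate q) (f g : X → ℝ) :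
    |∑ x, f x * g x| ≤ nm p f * nm q g := by
  rw [abs_le]
  constructor
  · have := holder h (-f) g
    rw [nm_neg] at this
    simp only [Pi.neg_apply, neg_mul, Finset.sum_neg_distrib] at this
    linarith
  · exact holder h f g

/-- The dual function. -/
def dualf (p : ℝ) (f : X → ℝ) : X → ℝ := fun x => SignType.sign (f x) * |f x| ^ (p - 1)

lemma abs_dualf {p : ℝ} (hp : 1 < p) (f : X → ℝ) (x : X) : |dualf p f x| = |f x| ^ (p - 1) := by
  unfold dualf
  rw [abs_mul, abs_of_nonneg (Real.rpow_nonneg (abs_nonneg _) _)]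
  by_cases h : f x = 0
  · simp [h, Real.zero_rpow (by linarith : p - 1 ≠ 0)]
  · rcases lt_or_gt_of_ne h with h | h <;> simp [h]

lemma nm_dualf {p q : ℝ} (h : p.HolderConjugate q) (f : X → ℝ) :
    nm q (dualf p f) = nm p f ^ (p - 1) := by
  have h1 : 1 < p := h.lt
  have hq : 0 < q := h.symm.pos
  unfold nm
  simp only [abs_dualf h1, ← Real.rpow_mul (abs_nonneg _)]
  rw [h.sub_one_mul_conj, ← Real.rpow_mul (sum_abs_nonneg p f)]
  congr 1
  have := h.div_conj_eq_sub_one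
  have hp0 := h.pos.ne'
  field_simp
  field_simp at this
  linarith

lemma sum_dualf {p : ℝ} (hp : 1 < p) (f : X → ℝ) : ∑ x, f x * dualf p f x = nm p f ^ p := by
  rw [nm_rpow (by linarith)]
  refine Finset.sum_congr rfl fun x _ => ?_
  unfold dualf
  rw [← mul_assoc, mul_comm (f x)]
  have : (SignType.sign (f x) : ℝ) * f x = |f x| := by
    rw [mul_comm]; exact self_mul_sign (f x)
  rw [this]
  by_cases h : f x = 0
  · simp [h, Real.zero_rpow (by linarith : p ≠ 0)]
  · have h0 : 0 < |f x| := abs_pos.mpr h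
    conv_rhs => rw [show p = 1 + (p - 1) by ring, Real.rpow_add h0, Real.rpow_one]

lemma le_of_rpow_le {p a C : ℝ} (ha : 0 ≤ a) (hC : 0 ≤ C) (h : a ^ p ≤ C * a ^ (p - 1)) :
    a ≤ C := by
  rcases ha.eq_or_lt with rfl | h0
  · exact hC
  · rw [show p = 1 + (p - 1) by ring, Real.rpow_add h0, Real.rpow_one,
      show 1 + (p - 1) - 1 = p - 1 by ring] at h
    exact le_of_mul_le_mul_right h (Real.rpow_pos_of_pos h0 _)

lemma nm_le_of_dual {p q : ℝ} (h : p.HolderConjugate q) (f : X → ℝ) {C : ℝ} (hC : 0 ≤ C)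
    (H : ∀ g : X → ℝ, ∑ x, f x * g x ≤ C * nm q g) : nm p f ≤ C := by
  have := H (dualf p f)
  rw [sum_dualf h.lt, nm_dualf h] at this
  exact le_of_rpow_le (nm_nonneg _ _) hC this

lemma nm_le_of_dual_nonneg {p q : ℝ} (h : p.HolderConjugate q) (f : X → ℝ) (hf : ∀ x, 0 ≤ f x)
    {C : ℝ} (hC : 0 ≤ C)
    (H : ∀ g : X → ℝ, (∀ x, 0 ≤ g x) → ∑ x, f x * g x ≤ C * nm q g) : nm p f ≤ C := by
  have := H (dualf p f) (fun x => by
    unfold dualf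
    refine mul_nonneg ?_ (Real.rpow_nonneg (abs_nonneg _) _)
    rcases (hf x).eq_or_lt with h | h
    · simp [← h]
    · simp [h])
  rw [sum_dualf h.lt, nm_dualf h] at this
  exact le_of_rpow_le (nm_nonneg _ _) hC this

/-- An operator and its transpose. -/
lemma nm_dual_op {p q : ℝ} (h : p.HolderConjugate q) (T S : (X → ℝ) → (X → ℝ))
    (hTS : ∀ f g, ∑ x, T f x * g x = ∑ x, f x * S g x) {C : ℝ} (hC : 0 ≤ C)
    (H : ∀ g, nm q (S g) ≤ C * nm q g) (f : X → ℝ) : nm p (T f) ≤ C * nm p f := by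
  refine nm_le_of_dual h _ (mul_nonneg hC (nm_nonneg _ _)) fun g => ?_
  rw [hTS]
  refine (holder h _ _).trans ?_
  have := mul_le_mul_of_nonneg_left (H g) (nm_nonneg p f)
  linarith

lemma nm_sq {p : ℝ} (hp : 0 < p) (f : X → ℝ) : nm p (fun x => f x ^ 2) = nm (2 * p) f ^ 2 := by
  unfold nm
  have : ∀ x, |f x ^ 2| ^ p = |f x| ^ (2 * p) := fun x => by
    rw [abs_pow, Real.rpow_mul (abs_nonneg _)]; norm_num
  simp only [this]
  rw [← Real.rpow_natCast, ← Real.rpow_mul (sum_abs_nonneg _ f)]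
  congr 1
  field_simp
  norm_num

lemma nm_mul_le {p : ℝ} (hp : 0 < p) (f g : X → ℝ) :
    nm p (fun x => f x * g x) ≤ nm (2 * p) f * nm (2 * p) g := by
  have h2 : (2 : ℝ).HolderConjugate 2 := by
    rw [Real.holderConjugate_iff]; norm_num
  have := holder h2 (fun x => |f x| ^ p) (fun x => |g x| ^ p)
  have e : ∀ u : X → ℝ, nm 2 (fun x => |u x| ^ p) = nm (2 * p) u ^ p := fun u => by
    unfold nm
    have : ∀ x, |(|u x| ^ p)| ^ (2:ℝ) = |u x| ^ (2 * p) := fun x => by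
      rw [abs_of_nonneg (Real.rpow_nonneg (abs_nonneg _) _), ← Real.rpow_mul (abs_nonneg _)]
      ring_nf
    simp only [this]
    rw [← Real.rpow_mul (sum_abs_nonneg _ u)]
    congr 1
    field_simp
  rw [e, e] at this
  rw [nm_le_iff hp _ (mul_nonneg (nm_nonneg _ _) (nm_nonneg _ _)),
    Real.mul_rpow (nm_nonneg _ _) (nm_nonneg _ _)]
  refine le_trans (le_of_eq ?_) this
  refine Finset.sum_congr rfl fun x _ => ?_
  rw [abs_mul, Real.mul_rpow (abs_nonneg _) (abs_nonneg _)]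

/-- Geometric mean Holder. -/
lemma nm_geom_le {p θ : ℝ} (hp : 0 < p) (h0 : 0 < θ) (h1 : θ < 1) (f g : X → ℝ) :
    nm p (fun x => |f x| ^ (1 - θ) * |g x| ^ θ) ≤ nm p f ^ (1 - θ) * nm p g ^ θ := by
  have hc : (1 / (1 - θ)).HolderConjugate (1 / θ) := by
    rw [Real.holderConjugate_iff]
    refine ⟨?_, by simp⟩
    rw [lt_div_iff₀ (by linarith)]; linarith
  have := holder hc (fun x => |f x| ^ (p * (1 - θ))) (fun x => |g x| ^ (p * θ))
  have e : ∀ (u : X → ℝ) (t : ℝ), 0 < t →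
      nm (1 / t) (fun x => |u x| ^ (p * t)) = nm p u ^ (p * t) := fun u t ht => by
    unfold nm
    have : ∀ x, |(|u x| ^ (p * t))| ^ (1 / t) = |u x| ^ p := fun x => by
      rw [abs_of_nonneg (Real.rpow_nonneg (abs_nonneg _) _), ← Real.rpow_mul (abs_nonneg _)]
      congr 1
      field_simp
    simp only [this]
    rw [← Real.rpow_mul (sum_abs_nonneg _ u)]
    congr 1
    field_simp
  rw [e _ _ (by linarith), e _ _ h0] at this
  have n1 := nm_nonneg p f
  have n2 := nm_nonneg p g
  rw [nm_le_iff hp _ (by positivity), Real.mul_rpow (by positivity) (by positivity),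
    ← Real.rpow_mul n1, ← Real.rpow_mul n2, mul_comm _ p, mul_comm _ p]
  refine le_trans (le_of_eq ?_) this
  refine Finset.sum_congr rfl fun x _ => ?_
  rw [abs_of_nonneg (by positivity), Real.mul_rpow (by positivity) (by positivity),
    ← Real.rpow_mul (abs_nonneg _), ← Real.rpow_mul (abs_nonneg _), mul_comm _ p, mul_comm _ p]

end
end DF

namespace DF
noncomputable section

variable {X : Type*} [Fintype X]

/-- Complexification of a real operator. -/
def cx (T : (X → ℝ) →ₗ[ℝ] (X → ℝ)) (h : X → ℂ) (y : X) : ℂ :=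
  ⟨T (fun x => (h x).re) y, T (fun x => (h x).im) y⟩

lemma lin_expand [DecidableEq X] (T : (X → ℝ) →ₗ[ℝ] (X → ℝ)) (f : X → ℝ) (y : X) :
    T f y = ∑ x, f x * T (Pi.single x 1) y := by
  conv_lhs => rw [show f = ∑ x, f x • (Pi.single x (1:ℝ) : X → ℝ) by
    ext y; simp [Finset.sum_apply, Pi.single_apply]]
  simp [map_sum, Finset.sum_apply]

lemma cx_expand [DecidableEq X] (T : (X → ℝ) →ₗ[ℝ] (X → ℝ)) (h : X → ℂ) (y : X) :
    cx T h y = ∑ x, h x * (T (Pi.single x 1) y : ℂ) := by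
  apply Complex.ext
  · simp [cx, lin_expand T (fun x => (h x).re) y]
  · simp [cx, lin_expand T (fun x => (h x).im) y]

lemma nm_cx {p A : ℝ} (hp : 1 < p) (hA : 0 ≤ A) (T : (X → ℝ) →ₗ[ℝ] (X → ℝ))
    (H : ∀ f, nm p (T f) ≤ A * nm p f) (h : X → ℂ) :
    nm p (fun y => ‖cx T h y‖) ≤ 2 * A * nm p (fun x => ‖h x‖) := by
  have hp0 : 0 < p := by linarith
  have h1 : nm p (fun y => ‖cx T h y‖) ≤ nm p ((fun y => |T (fun x => (h x).re) y|) +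
      fun y => |T (fun x => (h x).im) y|) := by
    apply nm_mono' hp0
    intro y
    rw [abs_of_nonneg (norm_nonneg _)]
    exact Complex.norm_le_abs_re_add_abs_im _
  refine h1.trans ((nm_add_le hp.le _ _).trans ?_)
  rw [nm_abs, nm_abs]
  have h2 := H (fun x => (h x).re)
  have h3 := H (fun x => (h x).im)
  have h4 : nm p (fun x => (h x).re) ≤ nm p (fun x => ‖h x‖) :=
    nm_mono' hp0 fun x => Complex.abs_re_le_norm _
  have h5 : nm p (fun x => (h x).im) ≤ nm p (fun x => ‖h x‖) :=
    nm_mono' hp0 fun x => Complex.abs_im_le_norm _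
  have := mul_le_mul_of_nonneg_left h4 hA
  have := mul_le_mul_of_nonneg_left h5 hA
  linarith

/-- analytic family through a function -/
def fam (f : X → ℝ) (w : ℂ) (x : X) : ℂ :=
  ((SignType.sign (f x) : ℝ) : ℂ) * Complex.exp ((Real.log |f x| : ℂ) * w)

lemma fam_one (f : X → ℝ) (x : X) : fam f 1 x = f x := by
  unfold fam
  by_cases h : f x = 0
  · simp [h]
  · rw [mul_one, ← Complex.ofReal_exp, Real.exp_log (abs_pos.mpr h), ← Complex.ofReal_mul,
      sign_mul_abs]

lemma norm_fam (f : X → ℝ) (w : ℂ) (hw : w.re ≠ 0) (x : X) : ‖fam f w x‖ = |f x| ^ w.re := by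
  unfold fam
  by_cases h : f x = 0
  · simp [h, Real.zero_rpow hw]
  · rw [norm_mul, Complex.norm_exp, Real.rpow_def_of_pos (abs_pos.mpr h)]
    have : ‖((SignType.sign (f x) : ℝ) : ℂ)‖ = 1 := by
      rcases lt_or_gt_of_ne h with h | h <;> simp [h]
    rw [this, one_mul]
    simp

lemma norm_fam_le (f : X → ℝ) (w : ℂ) (K : ℝ) (h0 : 0 ≤ w.re) (hw : w.re ≤ K) (x : X) :
    ‖fam f w x‖ ≤ Real.exp (abs (Real.log |f x|) * K) := by
  unfold fam
  rw [norm_mul, Complex.norm_exp]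
  have : ‖((SignType.sign (f x) : ℝ) : ℂ)‖ ≤ 1 := by
    rcases lt_trichotomy (f x) 0 with h | h | h <;> simp [h]
  refine (mul_le_of_le_one_left (Real.exp_pos _).le this).trans ?_
  apply Real.exp_le_exp.mpr
  simp only [Complex.mul_re, Complex.ofReal_re, Complex.ofReal_im, zero_mul, sub_zero]
  calc Real.log |f x| * w.re ≤ abs (Real.log |f x|) * w.re := by gcongr; exact le_abs_self _
    _ ≤ _ := by gcongr

lemma nm_fam {p s : ℝ} (hs : 0 < s) (hp : 0 < p) (f : X → ℝ) (w : ℂ) (hw : w.re = p / s) :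
    nm s (fun x => ‖fam f w x‖) = nm p f ^ (p / s) := by
  have hw0 : w.re ≠ 0 := by rw [hw]; positivity
  unfold nm
  simp only [norm_fam f w hw0]
  have : ∀ x, |(|f x| ^ w.re)| ^ s = |f x| ^ p := fun x => by
    rw [abs_of_nonneg (Real.rpow_nonneg (abs_nonneg _) _), ← Real.rpow_mul (abs_nonneg _), hw]
    congr 1
    field_simp
  simp only [this]
  rw [← Real.rpow_mul (sum_abs_nonneg _ f)]
  congr 1
  field_simp

theorem riesz_thorin {p0 p1 p θ A B : ℝ} (h0 : 1 < p0) (h1 : 1 < p1) (hp : 1 < p)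
    (hθ0 : 0 < θ) (hθ1 : θ ≤ 1) (hA : 0 < A) (hB : 0 < B)
    (hpe : 1 / p = (1 - θ) / p0 + θ / p1)
    (T : (X → ℝ) →ₗ[ℝ] (X → ℝ))
    (H0 : ∀ f, nm p0 (T f) ≤ A * nm p0 f) (H1 : ∀ f, nm p1 (T f) ≤ B * nm p1 f) (f : X → ℝ) :
    nm p (T f) ≤ 2 * (A ^ (1 - θ) * B ^ θ) * nm p f := by
  classical
  obtain ⟨q0, hq0⟩ : ∃ q, p0.HolderConjugate q := ⟨_, Real.HolderConjugate.conjExponent h0⟩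
  obtain ⟨q1, hq1⟩ : ∃ q, p1.HolderConjugate q := ⟨_, Real.HolderConjugate.conjExponent h1⟩
  obtain ⟨q, hq⟩ : ∃ q, p.HolderConjugate q := ⟨_, Real.HolderConjugate.conjExponent hp⟩
  have p0pos : 0 < p0 := by linarith
  have p1pos : 0 < p1 := by linarith
  have ppos : 0 < p := by linarith
  have q0pos := hq0.symm.pos
  have q1pos := hq1.symm.pos
  have qpos := hq.symm.pos
  have hqe : 1 / q = (1 - θ) / q0 + θ / q1 := by
    have e0 := hq0.inv_add_inv_eq_one
    have e1 := hq1.inv_add_inv_eq_one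
    have e := hq.inv_add_inv_eq_one
    simp only [div_eq_mul_inv, one_mul] at hpe ⊢
    have : q⁻¹ = 1 - p⁻¹ := by linarith
    rw [this, hpe, show q0⁻¹ = 1 - p0⁻¹ by linarith, show q1⁻¹ = 1 - p1⁻¹ by linarith]
    ring
  refine nm_le_of_dual hq _ (by have := nm_nonneg p f; positivity) fun g => ?_
  set w : ℂ → ℂ := fun z => (p : ℂ) * ((1 - z) / p0 + z / p1) with hw
  set v : ℂ → ℂ := fun z => (q : ℂ) * ((1 - z) / q0 + z / q1) with hv
  have wre : ∀ z, (w z).re = p * ((1 - z.re) / p0 + z.re / p1) := fun z => by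
    simp [hw, Complex.div_ofReal_re]
  have vre : ∀ z, (v z).re = q * ((1 - z.re) / q0 + z.re / q1) := fun z => by
    simp [hv, Complex.div_ofReal_re]
  set F : ℂ → ℂ := fun z => ∑ y, cx T (fam f (w z)) y * fam g (v z) y with hF
  have hFd : Differentiable ℂ F := by
    simp only [hF, cx_expand, fam, hw, hv]
    fun_prop
  have bd : ∀ z (s t S : ℝ), 1 < s → 0 ≤ S → s.HolderConjugate t → (w z).re = p / s →
      (v z).re = q / t → (∀ f, nm s (T f) ≤ S * nm s f) →
      ‖F z‖ ≤ (2 * S) * nm p f ^ (p / s) * nm q g ^ (q / t) := by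
    intro z s t S hs hS hst e1 e2 HS
    calc ‖F z‖ ≤ ∑ y, ‖cx T (fam f (w z)) y‖ * ‖fam g (v z) y‖ := by
          refine (norm_sum_le _ _).trans (le_of_eq ?_)
          simp
      _ ≤ nm s (fun y => ‖cx T (fam f (w z)) y‖) * nm t (fun y => ‖fam g (v z) y‖) :=
          holder hst _ _
      _ ≤ (2 * S * nm s (fun y => ‖fam f (w z) y‖)) * nm t (fun y => ‖fam g (v z) y‖) := by
          gcongr
          · exact nm_nonneg _ _
          · exact nm_cx hs hS T HS _
      _ = _ := by
          rw [nm_fam (by linarith) ppos f _ e1, nm_fam hst.symm.pos qpos g _ e2]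
  have key := Complex.HadamardThreeLines.norm_le_interp_of_mem_verticalClosedStrip₀₁' F
    (z := (θ : ℂ)) (a := (2 * A) * nm p f ^ (p / p0) * nm q g ^ (q / q0))
    (b := (2 * B) * nm p f ^ (p / p1) * nm q g ^ (q / q1))
    (by simp [Complex.HadamardThreeLines.verticalClosedStrip, hθ0.le, hθ1])
    hFd.diffContOnCl ?_ ?_ ?_
  · have eθ : F θ = ((∑ x, T f x * g x : ℝ) : ℂ) := by
      have e1 : w θ = 1 := by
        simp only [hw]
        have : p * ((1 - θ) / p0 + θ / p1) = 1 := by rw [← hpe]; field_simp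
        exact_mod_cast this
      have e2 : v θ = 1 := by
        simp only [hv]
        have : q * ((1 - θ) / q0 + θ / q1) = 1 := by rw [← hqe]; field_simp
        exact_mod_cast this
      simp only [hF, e1, e2, fam_one]
      push_cast
      refine Finset.sum_congr rfl fun y _ => ?_
      congr 1
      rw [cx_expand, lin_expand T f y]
      push_cast
      simp only [fam_one]
    rw [eθ, Complex.norm_real, Complex.ofReal_re] at key
    refine (le_abs_self _).trans (key.trans (le_of_eq ?_))
    have n1 := nm_nonneg p f
    have n2 := nm_nonneg q g
    have m1 : (nm p f ^ (p / p0)) ^ (1 - θ) * (nm p f ^ (p / p1)) ^ θ = nm p f := by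
      rw [← Real.rpow_mul n1, ← Real.rpow_mul n1]
      rcases n1.eq_or_lt with h | h
      · rw [← h]
        rw [Real.zero_rpow (x := p / p1 * θ) (by positivity), mul_zero]
      · rw [← Real.rpow_add h]
        have : p / p0 * (1 - θ) + p / p1 * θ = 1 := by
          rw [show p / p0 * (1 - θ) + p / p1 * θ = p * ((1 - θ) / p0 + θ / p1) by ring, ← hpe]
          field_simp
        rw [this, Real.rpow_one]
    have m2 : (nm q g ^ (q / q0)) ^ (1 - θ) * (nm q g ^ (q / q1)) ^ θ = nm q g := by
      rw [← Real.rpow_mul n2, ← Real.rpow_mul n2]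
      rcases n2.eq_or_lt with h | h
      · rw [← h]
        rw [Real.zero_rpow (x := q / q1 * θ) (by positivity), mul_zero]
      · rw [← Real.rpow_add h]
        have : q / q0 * (1 - θ) + q / q1 * θ = 1 := by
          rw [show q / q0 * (1 - θ) + q / q1 * θ = q * ((1 - θ) / q0 + θ / q1) by ring, ← hqe]
          field_simp
        rw [this, Real.rpow_one]
    have m3 : (2:ℝ) ^ (1 - θ) * 2 ^ θ = 2 := by
      rw [← Real.rpow_add two_pos]; norm_num
    rw [Real.mul_rpow (by positivity) (by positivity), Real.mul_rpow (by positivity) (by positivity),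
      Real.mul_rpow (by positivity) (by positivity), Real.mul_rpow (by positivity) (by positivity),
      Real.mul_rpow (by positivity) (by positivity), Real.mul_rpow (by positivity) (by positivity)]
    calc _ = ((2:ℝ) ^ (1 - θ) * 2 ^ θ) * (A ^ (1 - θ) * B ^ θ) *
        ((nm p f ^ (p / p0)) ^ (1 - θ) * (nm p f ^ (p / p1)) ^ θ) *
        ((nm q g ^ (q / q0)) ^ (1 - θ) * (nm q g ^ (q / q1)) ^ θ) := by ring
      _ = _ := by rw [m1, m2, m3]
  · refine ⟨∑ y, (∑ x, Real.exp (abs (Real.log |f x|) * (p / p0 + p / p1)) * |T (Pi.single x 1) y|) *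
      Real.exp (abs (Real.log |g y|) * (q / q0 + q / q1)), ?_⟩
    rintro _ ⟨z, hz, rfl⟩
    simp only [Complex.HadamardThreeLines.verticalClosedStrip, Set.mem_preimage, Set.mem_Icc] at hz
    have rb : ∀ a b c : ℝ, 0 < a → 0 < b → 0 < c →
        0 ≤ a * ((1 - z.re) / b + z.re / c) ∧ a * ((1 - z.re) / b + z.re / c) ≤ a / b + a / c := by
      intro a b c ha hb hc
      have z1 : 0 ≤ 1 - z.re := by linarith [hz.2]
      have z0 := hz.1
      refine ⟨by positivity, ?_⟩
      rw [show a / b + a / c = a * (1 / b + 1 / c) by ring]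
      gcongr
      · linarith
      · exact hz.2
    simp only [hF, Function.comp]
    refine (norm_sum_le _ _).trans (Finset.sum_le_sum fun y _ => ?_)
    rw [norm_mul, cx_expand]
    gcongr
    · refine (norm_sum_le _ _).trans (Finset.sum_le_sum fun x _ => ?_)
      rw [norm_mul, Complex.norm_real, Real.norm_eq_abs]
      gcongr
      apply norm_fam_le
      · rw [wre]; exact (rb _ _ _ ppos p0pos p1pos).1
      · rw [wre]; exact (rb _ _ _ ppos p0pos p1pos).2
    · apply norm_fam_le
      · rw [vre]; exact (rb _ _ _ qpos q0pos q1pos).1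
      · rw [vre]; exact (rb _ _ _ qpos q0pos q1pos).2
  · intro z hz
    have hz : z.re = 0 := hz
    exact bd z p0 q0 A h0 hA.le hq0 (by rw [wre, hz]; ring) (by rw [vre, hz]; ring) H0
  · intro z hz
    have hz : z.re = 1 := hz
    exact bd z p1 q1 B h1 hB.le hq1 (by rw [wre, hz]; ring) (by rw [vre, hz]; ring) H1

end
end DF

namespace DF
noncomputable section

variable {X : Type*} [Fintype X]

/-- Expectation of a function of a Rademacher sum. -/
def rad : ℕ → (ℕ → ℝ) → (ℝ → ℝ) → ℝ → ℝ
  | 0, _, φ, x => φ x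
  | N + 1, a, φ, x => (rad N a φ (x + a N) + rad N a φ (x - a N)) / 2

lemma rad_mono (N : ℕ) (a : ℕ → ℝ) {φ ψ : ℝ → ℝ} (h : ∀ y, φ y ≤ ψ y) (x : ℝ) :
    rad N a φ x ≤ rad N a ψ x := by
  induction N generalizing x with
  | zero => exact h x
  | succ N ih => simp only [rad]; linarith [ih (x + a N), ih (x - a N)]

lemma rad_lin (N : ℕ) (a : ℕ → ℝ) (φ ψ : ℝ → ℝ) (c e k : ℝ) (x : ℝ) :
    rad N a (fun y => c * φ y + e * ψ y + k) x = c * rad N a φ x + e * rad N a ψ x + k := by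
  induction N generalizing x with
  | zero => rfl
  | succ N ih => simp only [rad, ih]; ring

lemma rad_two (N : ℕ) (a : ℕ → ℝ) (x : ℝ) :
    rad N a (fun y => y ^ 2) x = x ^ 2 + ∑ n ∈ Finset.range N, a n ^ 2 := by
  induction N generalizing x with
  | zero => simp [rad]
  | succ N ih => simp only [rad, ih, Finset.sum_range_succ]; ring

lemma rad_four (N : ℕ) (a : ℕ → ℝ) (x : ℝ) :
    rad N a (fun y => y ^ 4) x ≤ x ^ 4 + 6 * x ^ 2 * (∑ n ∈ Finset.range N, a n ^ 2) +
      3 * (∑ n ∈ Finset.range N, a n ^ 2) ^ 2 := by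
  induction N generalizing x with
  | zero => simp [rad]
  | succ N ih =>
    simp only [rad, Finset.sum_range_succ]
    set S := ∑ n ∈ Finset.range N, a n ^ 2
    have h1 := ih (x + a N)
    have h2 := ih (x - a N)
    nlinarith [sq_nonneg (a N ^ 2), sq_nonneg (a N)]

lemma khin_scalar {p : ℝ} (hp : 0 < p) : ∃ K : ℝ, 0 < K ∧ ∀ (N : ℕ) (a : ℕ → ℝ),
    (Real.sqrt (∑ n ∈ Finset.range N, a n ^ 2)) ^ p ≤ K * rad N a (fun y => |y| ^ p) 0 := by
  -- pointwise inequality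
  have main : ∃ K : ℝ, 0 < K ∧ ∀ (σ y : ℝ), 0 < σ →
      y ^ 2 ≤ K * σ ^ (2 - p) * |y| ^ p + (1 / (12 * σ ^ 2)) * y ^ 4 + σ ^ 2 / 4 := by
    rcases le_total p 2 with h2 | h2
    · refine ⟨16, by norm_num, fun σ y hσ => ?_⟩
      by_cases hy : 12 * σ ^ 2 ≤ y ^ 2
      · have e1 : y ^ 2 ≤ (1 / (12 * σ ^ 2)) * y ^ 4 := by
          rw [one_div_mul_eq_div, le_div_iff₀ (by positivity)]
          nlinarith [sq_nonneg y]
        have : 0 ≤ 16 * σ ^ (2 - p) * |y| ^ p := by positivity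
        nlinarith [sq_nonneg σ]
      · push Not at hy
        rcases eq_or_ne y 0 with rfl | hy0
        · have : 0 ≤ 16 * σ ^ (2 - p) * |(0:ℝ)| ^ p := by positivity
          have := sq_nonneg σ
          norm_num at *
          linarith
        have hy0 : 0 < |y| := abs_pos.mpr hy0
        have e1 : y ^ 2 = |y| ^ (2 - p) * |y| ^ p := by
          rw [← Real.rpow_add hy0, ← sq_abs, ← Real.rpow_natCast]; norm_num
        have e2 : |y| ^ (2 - p) ≤ 16 * σ ^ (2 - p) := by
          have : |y| ≤ 4 * σ := by
            apply abs_le_of_sq_le_sq _ (by positivity)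
            nlinarith [sq_nonneg σ]
          calc |y| ^ (2 - p) ≤ (4 * σ) ^ (2 - p) :=
                Real.rpow_le_rpow (abs_nonneg _) this (by linarith)
            _ = 4 ^ (2 - p) * σ ^ (2 - p) := Real.mul_rpow (by norm_num) hσ.le
            _ ≤ 16 * σ ^ (2 - p) := by
                gcongr
                calc (4:ℝ) ^ (2 - p) ≤ 4 ^ (2:ℝ) :=
                      Real.rpow_le_rpow_of_exponent_le (by norm_num) (by linarith)
                  _ = 16 := by norm_num
        have e3 : y ^ 2 ≤ 16 * σ ^ (2 - p) * |y| ^ p := by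
          rw [e1]; gcongr
        have : 0 ≤ (1 / (12 * σ ^ 2)) * y ^ 4 := by positivity
        nlinarith [sq_nonneg σ]
    · refine ⟨2 ^ (p - 2), by positivity, fun σ y hσ => ?_⟩
      have q4 : 0 ≤ (1 / (12 * σ ^ 2)) * y ^ 4 := by positivity
      have q2 : 0 ≤ 2 ^ (p - 2) * σ ^ (2 - p) * |y| ^ p := by positivity
      by_cases hy : |y| ≤ σ / 2
      · have : y ^ 2 ≤ (σ / 2) ^ 2 := by rw [← sq_abs]; gcongr
        nlinarith
      · push Not at hy
        have hy0 : 0 < |y| := by linarith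
        have e1 : |y| ^ p = y ^ 2 * |y| ^ (p - 2) := by
          rw [← sq_abs, ← Real.rpow_natCast, ← Real.rpow_add hy0]; norm_num
        have e2 : (σ / 2) ^ (p - 2) ≤ |y| ^ (p - 2) :=
          Real.rpow_le_rpow (by positivity) hy.le (by linarith)
        have e3 : 2 ^ (p - 2) * σ ^ (2 - p) * (σ / 2) ^ (p - 2) = 1 := by
          rw [Real.div_rpow hσ.le (by norm_num)]
          have : σ ^ (2 - p) * σ ^ (p - 2) = 1 := by
            rw [← Real.rpow_add hσ]; norm_num
          have h0 : (2:ℝ) ^ (p - 2) ≠ 0 := by positivity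
          field_simp
          linarith
        have : y ^ 2 * 1 ≤ y ^ 2 * (2 ^ (p - 2) * σ ^ (2 - p) * |y| ^ (p - 2)) := by
          rw [← e3]; gcongr
        rw [e1]
        nlinarith
  obtain ⟨K, hK, H⟩ := main
  refine ⟨2 * K, by positivity, fun N a => ?_⟩
  set S := ∑ n ∈ Finset.range N, a n ^ 2 with hS
  have hS0 : 0 ≤ S := Finset.sum_nonneg fun _ _ => sq_nonneg _
  have hrn : 0 ≤ rad N a (fun y => |y| ^ p) 0 := by
    have := rad_mono N a (φ := fun y => 0 * y + 0 * y + 0) (ψ := fun y => |y| ^ p)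
      (fun y => by simpa using Real.rpow_nonneg (abs_nonneg y) p) 0
    rw [rad_lin N a (fun y => y) (fun y => y)] at this
    simpa using this
  rcases hS0.eq_or_lt with h | hpos
  · rw [← h, Real.sqrt_zero, Real.zero_rpow hp.ne']; positivity
  set σ := Real.sqrt S with hσ
  have σpos : 0 < σ := Real.sqrt_pos.mpr hpos
  have σsq : σ ^ 2 = S := Real.sq_sqrt hS0
  have h1 := rad_mono N a (H σ · σpos) 0
  rw [rad_lin N a (fun y => |y| ^ p) (fun y => y ^ 4), rad_two] at h1
  have h4 := rad_four N a 0
  rw [← hS] at h1 h4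
  have h5 : 1 / (12 * σ ^ 2) * rad N a (fun y => y ^ 4) 0 ≤ S / 4 := by
    rw [σsq, one_div_mul_eq_div, div_le_iff₀ (by positivity)]
    nlinarith
  rw [σsq] at h1 h5
  have h6 : S ≤ 2 * K * σ ^ (2 - p) * rad N a (fun y => |y| ^ p) 0 := by nlinarith
  have h7 : σ ^ p * σ ^ (2 - p) = S := by
    rw [← Real.rpow_add σpos, ← σsq, ← Real.rpow_natCast]; norm_num
  have h8 : 0 < σ ^ (2 - p) := by positivity
  rw [← h7] at h6
  refine le_of_mul_le_mul_right ?_ h8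
  linarith

lemma rad_sum_le {p B : ℝ} (h : ℕ → X → ℝ) (N : ℕ) (g : X → ℝ)
    (H : ∀ ε : ℕ → ℝ, (∀ n, ε n = 1 ∨ ε n = -1) →
      ∑ x, |g x + ∑ n ∈ Finset.range N, ε n * h n x| ^ p ≤ B) :
    ∑ x, rad N (fun n => h n x) (fun y => |y| ^ p) (g x) ≤ B := by
  induction N generalizing g with
  | zero => simpa [rad] using H (fun _ => 1) (fun _ => Or.inl rfl)
  | succ N ih =>
    have key : ∀ s : ℝ, (s = 1 ∨ s = -1) →
        ∑ x, rad N (fun n => h n x) (fun y => |y| ^ p) (g x + s * h N x) ≤ B := by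
      intro s hs
      refine ih (fun x => g x + s * h N x) fun ε hε => ?_
      have := H (Function.update ε N s) (fun n => by
        by_cases e : n = N
        · subst e; simpa using hs
        · simpa [e] using hε n)
      refine le_trans (le_of_eq ?_) this
      refine Finset.sum_congr rfl fun x _ => ?_
      rw [Finset.sum_range_succ]
      have : ∑ n ∈ Finset.range N, Function.update ε N s n * h n x =
          ∑ n ∈ Finset.range N, ε n * h n x := by
        refine Finset.sum_congr rfl fun n hn => ?_
        rw [Function.update_of_ne (Finset.mem_range.mp hn).ne]
      rw [this, Function.update_self]
      ring_nf
    have h1 := key 1 (Or.inl rfl)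
    have h2 := key (-1) (Or.inr rfl)
    simp only [rad, ← Finset.sum_div, Finset.sum_add_distrib]
    have e1 : ∀ x, g x + 1 * h N x = g x + h N x := fun x => by ring
    have e2 : ∀ x, g x + -1 * h N x = g x - h N x := fun x => by ring
    simp only [e1, e2] at h1 h2
    linarith

/-- Square function. -/
def sqf (N : ℕ) (h : ℕ → X → ℝ) (x : X) : ℝ := Real.sqrt (∑ n ∈ Finset.range N, h n x ^ 2)

lemma sqf_nonneg (N : ℕ) (h : ℕ → X → ℝ) (x : X) : 0 ≤ sqf N h x := Real.sqrt_nonneg _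

theorem khinchine {p : ℝ} (hp : 0 < p) : ∃ K : ℝ, 0 < K ∧ ∀ (X : Type) [Fintype X] (N : ℕ)
    (h : ℕ → X → ℝ) (C : ℝ), 0 ≤ C →
    (∀ ε : ℕ → ℝ, (∀ n, ε n = 1 ∨ ε n = -1) →
      nm p (∑ n ∈ Finset.range N, ε n • h n) ≤ C) → nm p (sqf N h) ≤ K * C := by
  obtain ⟨K, hK, H⟩ := khin_scalar hp
  refine ⟨K ^ (1 / p), by positivity, fun X _ N h C hC hh => ?_⟩
  rw [nm_le_iff hp _ (by positivity), Real.mul_rpow (by positivity) hC, ← Real.rpow_mul hK.le,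
    one_div_mul_cancel hp.ne', Real.rpow_one]
  have h1 := rad_sum_le (p := p) (B := C ^ p) h N (fun _ => 0) (fun ε hε => by
    have := (nm_le_iff hp _ hC).mp (hh ε hε)
    simpa [Finset.sum_apply] using this)
  calc ∑ x, |sqf N h x| ^ p ≤ ∑ x, K * rad N (fun n => h n x) (fun y => |y| ^ p) 0 := by
        refine Finset.sum_le_sum fun x _ => ?_
        rw [abs_of_nonneg (sqf_nonneg _ _ _)]
        exact H N _
    _ ≤ _ := by rw [← Finset.mul_sum]; gcongr

end
end DF

namespace DF
noncomputable section

/-- A finite filtration given by a refining sequence of equivalence relations. -/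
structure Filt (X : Type) where
  r : ℕ → X → X → Prop
  eqv : ∀ t, Equivalence (r t)
  mono : ∀ t x y, r (t + 1) x y → r t x y

variable {X : Type} [Fintype X]

namespace Filt

/-- measurability with respect to the filtration -/
def Meas (F : Filt X) {Y : Type*} (t : ℕ) (g : X → Y) : Prop := ∀ x y, F.r t x y → g x = g y

open Classical in
/-- class size -/
def c (F : Filt X) (t : ℕ) (x : X) : ℝ := ∑ y, if F.r t x y then 1 else 0

open Classical in
/-- conditional expectation -/
def E (F : Filt X) (t : ℕ) : (X → ℝ) →ₗ[ℝ] (X → ℝ) where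
  toFun f x := (∑ y, if F.r t x y then f y else 0) / F.c t x
  map_add' f g := by
    ext x
    simp only [Pi.add_apply, ← add_div, ← Finset.sum_add_distrib]
    congr 1
    refine Finset.sum_congr rfl fun y _ => ?_
    split_ifs <;> simp
  map_smul' a f := by
    ext x
    simp only [Pi.smul_apply, smul_eq_mul, RingHom.id_apply, ← mul_div_assoc, Finset.mul_sum]
    congr 1
    refine Finset.sum_congr rfl fun y _ => ?_
    split_ifs <;> simp

variable (F : Filt X)

open Classical in
lemma E_apply (t : ℕ) (f : X → ℝ) (x : X) :
    F.E t f x = (∑ y, if F.r t x y then f y else 0) / F.c t x := rfl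

lemma c_pos (t : ℕ) (x : X) : 0 < F.c t x := by
  classical
  unfold c
  apply Finset.sum_pos' (fun y _ => by split_ifs <;> norm_num)
  exact ⟨x, Finset.mem_univ _, by simp [(F.eqv t).refl x]⟩

lemma r_congr {t : ℕ} {x y : X} (h : F.r t x y) (z : X) : F.r t x z ↔ F.r t y z :=
  ⟨fun h' => (F.eqv t).trans ((F.eqv t).symm h) h', fun h' => (F.eqv t).trans h h'⟩

lemma c_meas (t : ℕ) : F.Meas t (F.c t) := by
  classical
  intro x y h
  have : F.r t x = F.r t y := funext fun z => propext (F.r_congr h z)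
  unfold c
  refine Finset.sum_congr rfl fun z _ => ?_
  simp only [F.r_congr h z]

lemma E_meas (t : ℕ) (f : X → ℝ) : F.Meas t (F.E t f) := by
  classical
  intro x y h
  have : F.r t x = F.r t y := funext fun z => propext (F.r_congr h z)
  rw [E_apply, E_apply, F.c_meas t x y h]
  congr 1
  refine Finset.sum_congr rfl fun z _ => ?_
  simp only [F.r_congr h z]

lemma meas_succ {Y : Type*} {t : ℕ} {g : X → Y} (h : F.Meas t g) : F.Meas (t + 1) g :=
  fun x y hxy => h x y (F.mono t x y hxy)

lemma meas_mono {Y : Type*} {s t : ℕ} (hst : s ≤ t) {g : X → Y} (h : F.Meas s g) : F.Meas t g := by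
  induction t, hst using Nat.le_induction with
  | base => exact h
  | succ t _ ih => exact F.meas_succ ih

lemma E_mul {t : ℕ} {g : X → ℝ} (hg : F.Meas t g) (f : X → ℝ) : F.E t (g * f) = g * F.E t f := by
  classical
  ext x
  simp only [E_apply, Pi.mul_apply, ← mul_div_assoc, Finset.mul_sum]
  congr 1
  refine Finset.sum_congr rfl fun y _ => ?_
  split_ifs with h
  · rw [hg x y h]
  · simp

lemma E_one (t : ℕ) : F.E t 1 = 1 := by
  classical
  ext x
  simp only [E_apply, Pi.one_apply]
  exact div_self (F.c_pos t x).ne'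

lemma E_of_meas {t : ℕ} {g : X → ℝ} (hg : F.Meas t g) : F.E t g = g := by
  have := F.E_mul hg 1
  rwa [mul_one, E_one, mul_one] at this

lemma E_sym (t : ℕ) (f g : X → ℝ) : ∑ x, F.E t f x * g x = ∑ x, f x * F.E t g x := by
  classical
  simp only [E_apply, div_mul_eq_mul_div, Finset.sum_mul, Finset.sum_div, Finset.mul_sum,
    mul_div_assoc']
  rw [Finset.sum_comm]
  refine Finset.sum_congr rfl fun y _ => Finset.sum_congr rfl fun x _ => ?_
  by_cases h : F.r t x y
  · have h' := (F.eqv t).symm h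
    simp [h, h', F.c_meas t x y h]
  · have h' : ¬ F.r t y x := fun h' => h ((F.eqv t).symm h')
    simp [h, h']

lemma E_nonneg (t : ℕ) {f : X → ℝ} (hf : ∀ x, 0 ≤ f x) (x : X) : 0 ≤ F.E t f x := by
  classical
  rw [E_apply]
  refine div_nonneg (Finset.sum_nonneg fun y _ => ?_) (F.c_pos t x).le
  split_ifs
  · exact hf y
  · exact le_rfl

lemma E_mono (t : ℕ) {f g : X → ℝ} (h : ∀ x, f x ≤ g x) (x : X) : F.E t f x ≤ F.E t g x := by
  have := F.E_nonneg t (f := g - f) (fun x => by simpa using h x) x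
  rw [map_sub] at this
  simpa using this

lemma abs_E_le (t : ℕ) (f : X → ℝ) (x : X) : |F.E t f x| ≤ F.E t (fun x => |f x|) x := by
  rw [abs_le]
  constructor
  · have := F.E_mono t (f := -f) (g := fun x => |f x|) (fun x => by simpa using neg_le_abs (f x)) x
    rw [map_neg] at this
    simp only [Pi.neg_apply] at this
    linarith
  · exact F.E_mono t (fun x => le_abs_self _) x

lemma E_tower1 {s t : ℕ} (h : s ≤ t) (f : X → ℝ) : F.E t (F.E s f) = F.E s f :=
  F.E_of_meas (F.meas_mono h (F.E_meas s f))

lemma E_tower2 {s t : ℕ} (h : s ≤ t) (f : X → ℝ) : F.E s (F.E t f) = F.E s f := by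
  classical
  ext x
  have key : ∀ g : X → ℝ, ∑ y, F.E s (F.E t f) y * g y = ∑ y, F.E s f y * g y := by
    intro g
    rw [E_sym, E_sym, E_tower1 F h, ← E_sym]
  simpa [Pi.single_apply] using key (Pi.single x 1)

lemma sum_E (t : ℕ) (f : X → ℝ) : ∑ x, F.E t f x = ∑ x, f x := by
  have := F.E_sym t f 1
  simpa [E_one] using this

end Filt

/-- running maximum -/
def rmax (a : ℕ → ℝ) : ℕ → ℝ
  | 0 => |a 0|
  | t + 1 => max (rmax a t) |a (t + 1)|

lemma rmax_nonneg (a : ℕ → ℝ) (t : ℕ) : 0 ≤ rmax a t := by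
  induction t with
  | zero => exact abs_nonneg _
  | succ t ih => exact le_max_of_le_left ih

lemma rmax_mono (a : ℕ → ℝ) {s t : ℕ} (h : s ≤ t) : rmax a s ≤ rmax a t := by
  induction t, h using Nat.le_induction with
  | base => exact le_rfl
  | succ t _ ih => exact le_max_of_le_left ih

lemma abs_le_rmax_self (a : ℕ → ℝ) (t : ℕ) : |a t| ≤ rmax a t := by
  cases t with
  | zero => exact le_rfl
  | succ t => exact le_max_right _ _

lemma abs_le_rmax (a : ℕ → ℝ) {s t : ℕ} (h : s ≤ t) : |a s| ≤ rmax a t :=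
  (abs_le_rmax_self a s).trans (rmax_mono a h)

lemma rmax_le (a : ℕ → ℝ) (t : ℕ) {B : ℝ} (h : ∀ s ≤ t, |a s| ≤ B) : rmax a t ≤ B := by
  induction t with
  | zero => exact h 0 le_rfl
  | succ t ih => exact max_le (ih fun s hs => h s (by omega)) (h _ le_rfl)

lemma exists_rmax (a : ℕ → ℝ) (t : ℕ) : ∃ s ≤ t, rmax a t = |a s| := by
  induction t with
  | zero => exact ⟨0, le_rfl, rfl⟩
  | succ t ih =>
    obtain ⟨s, hs, h⟩ := ih
    rcases max_choice (rmax a t) |a (t + 1)| with h' | h'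
    · exact ⟨s, by omega, by rw [rmax, h', h]⟩
    · exact ⟨t + 1, le_rfl, by rw [rmax, h']⟩

lemma young_aux {p q a b : ℝ} (h : p.HolderConjugate q) (ha : 0 ≤ a) (hb : 0 ≤ b) :
    (1 / q) * (b ^ p - a ^ p) ≤ b * (b ^ (p - 1) - a ^ (p - 1)) := by
  have h1 : 1 < p := h.lt
  have hy := Real.young_inequality_of_nonneg hb (Real.rpow_nonneg ha (p - 1)) h
  rw [← Real.rpow_mul ha, h.sub_one_mul_conj] at hy
  have hb' : b * b ^ (p - 1) = b ^ p := by
    rcases hb.eq_or_lt with h0 | h0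
    · rw [← h0, zero_mul, Real.zero_rpow (by linarith)]
    · conv_rhs => rw [show p = 1 + (p - 1) by ring, Real.rpow_add h0, Real.rpow_one]
  have e := h.inv_add_inv_eq_one
  rw [mul_sub b, hb']
  have : 1 / q = 1 - p⁻¹ := by rw [one_div]; linarith
  rw [this]
  have hq : a ^ p / q = a ^ p * (1 - p⁻¹) := by rw [← this]; ring
  rw [hq] at hy
  rw [div_eq_mul_inv] at hy
  linarith

theorem doob_aux {p q : ℝ} (h : p.HolderConjugate q) (F : Filt X) (f : X → ℝ) (hf : ∀ x, 0 ≤ f x)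
    (N : ℕ) : (1 / q) * ∑ x, rmax (fun t => F.E t f x) N ^ p ≤
      ∑ x, f x * rmax (fun t => F.E t f x) N ^ (p - 1) := by
  have h1 : 1 < p := h.lt
  have hE : ∀ t x, |F.E t f x| = F.E t f x := fun t x => abs_of_nonneg (F.E_nonneg t hf x)
  have hm : ∀ t, F.Meas t (fun x => rmax (fun t => F.E t f x) t) := by
    intro t
    induction t with
    | zero => intro x y hxy; simp only [rmax, F.E_meas 0 f x y hxy]
    | succ t ih =>
      intro x y hxy
      have := ih x y (F.mono t x y hxy)
      simp only [rmax, F.E_meas (t + 1) f x y hxy] at this ⊢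
      rw [this]
  have swap : ∀ (t : ℕ) (g : X → ℝ), F.Meas t g → ∑ x, F.E t f x * g x = ∑ x, f x * g x := by
    intro t g hg
    rw [F.E_sym, F.E_of_meas hg]
  induction N with
  | zero =>
    rw [← swap 0 _ (fun x y hxy => by have := hm 0 x y hxy; dsimp only at this ⊢; rw [this]), Finset.mul_sum]
    refine Finset.sum_le_sum fun x _ => ?_
    have := young_aux h le_rfl (rmax_nonneg (fun t => F.E t f x) 0)
    rw [Real.zero_rpow (by linarith), Real.zero_rpow (by linarith), sub_zero, sub_zero] at this
    simpa only [rmax, hE] using this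
  | succ N ih =>
    set M := fun t x => rmax (fun t => F.E t f x) t with hM
    have step : ∀ x, (1 / q) * (M (N + 1) x ^ p - M N x ^ p) ≤
        F.E (N + 1) f x * (M (N + 1) x ^ (p - 1) - M N x ^ (p - 1)) := by
      intro x
      have := young_aux h (rmax_nonneg (fun t => F.E t f x) N) (rmax_nonneg (fun t => F.E t f x) (N + 1))
      refine this.trans (le_of_eq ?_)
      simp only [hM, rmax, hE]
      rcases le_total (rmax (fun t => F.E t f x) N) (F.E (N + 1) f x) with h' | h'
      · rw [max_eq_right h']
      · rw [max_eq_left h']; simp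
    have s1 := Finset.sum_le_sum fun x (_ : x ∈ Finset.univ) => step x
    rw [swap (N + 1) (fun x => M (N + 1) x ^ (p - 1) - M N x ^ (p - 1)) (fun x y hxy => by
      have a1 := hm (N + 1) x y hxy
      have a2 := hm N x y (F.mono N x y hxy)
      simp only [hM] at a1 a2 ⊢
      rw [a1, a2])] at s1
    simp only [mul_sub, Finset.sum_sub_distrib, ← Finset.mul_sum] at s1
    change (1 / q) * ∑ x, M N x ^ p ≤ ∑ x, f x * M N x ^ (p - 1) at ih
    change (1 / q) * ∑ x, M (N + 1) x ^ p ≤ ∑ x, f x * M (N + 1) x ^ (p - 1)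
    linarith

theorem doob {p q : ℝ} (h : p.HolderConjugate q) (F : Filt X) (f : X → ℝ) (N : ℕ) :
    nm p (fun x => rmax (fun t => F.E t f x) N) ≤ q * nm p f := by
  have h1 : 1 < p := h.lt
  have hq : 0 < q := h.symm.pos
  set g : X → ℝ := fun x => |f x| with hg
  have hle : nm p (fun x => rmax (fun t => F.E t f x) N) ≤ nm p (fun x => rmax (fun t => F.E t g x) N) := by
    apply nm_mono' (by linarith)
    intro x
    rw [abs_of_nonneg (rmax_nonneg _ _)]
    refine rmax_le _ _ fun s hs => ?_
    exact (F.abs_E_le s f x).trans ((le_abs_self _).trans (abs_le_rmax (fun t => F.E t g x) hs))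
  refine hle.trans ?_
  rw [← nm_abs p f]
  set M : X → ℝ := fun x => rmax (fun t => F.E t g x) N with hM
  have hM0 : ∀ x, 0 ≤ M x := fun x => rmax_nonneg _ _
  have h2 := doob_aux h F g (fun x => abs_nonneg _) N
  have h3 := holder h g (dualf p M)
  rw [nm_dualf h] at h3
  have h4 : ∑ x, g x * M x ^ (p - 1) ≤ ∑ x, g x * dualf p M x := by
    refine le_of_eq (Finset.sum_congr rfl fun x _ => ?_)
    have : dualf p M x = M x ^ (p - 1) := by
      have e := abs_dualf h1 M x
      rw [abs_of_nonneg (hM0 x)] at e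
      rw [← e, abs_of_nonneg]
      unfold dualf
      refine mul_nonneg ?_ (Real.rpow_nonneg (abs_nonneg _) _)
      rcases (hM0 x).eq_or_lt with h | h
      · simp [← h]
      · simp [h]
    rw [this]
  have h5 : nm p M ^ p = ∑ x, M x ^ p := by
    rw [nm_rpow (by linarith)]
    exact Finset.sum_congr rfl fun x _ => by rw [abs_of_nonneg (hM0 x)]
  apply le_of_rpow_le (p := p) (nm_nonneg _ _) (mul_nonneg hq.le (nm_nonneg _ _))
  rw [h5]
  have h6 : (1 / q) * ∑ x, M x ^ p ≤ nm p g * nm p M ^ (p - 1) := by linarith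
  rw [one_div_mul_eq_div, div_le_iff₀ hq] at h6
  linarith

lemma nm_E_le {p q : ℝ} (h : p.HolderConjugate q) (F : Filt X) (f : X → ℝ) (N : ℕ) :
    nm p (F.E N f) ≤ q * nm p f :=
  (nm_mono' h.pos fun x => abs_le_rmax_self (fun t => F.E t f x) N).trans (doob h F f N)

namespace Filt
variable (F : Filt X)

/-- martingale differences -/
def md : ℕ → (X → ℝ) →ₗ[ℝ] (X → ℝ)
  | 0 => F.E 0
  | t + 1 => F.E (t + 1) - F.E t

/-- predictable -/
def Pred (v : ℕ → X → ℝ) : Prop := F.Meas 0 (v 0) ∧ ∀ t, F.Meas t (v (t + 1))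

lemma md_meas (t : ℕ) (f : X → ℝ) : F.Meas t (F.md t f) := by
  cases t with
  | zero => exact F.E_meas 0 f
  | succ t =>
    intro x y hxy
    simp only [md, LinearMap.sub_apply, Pi.sub_apply]
    rw [F.E_meas (t + 1) f x y hxy, F.E_meas t f x y (F.mono t x y hxy)]

lemma sum_md (N : ℕ) (f : X → ℝ) : ∑ t ∈ Finset.range (N + 1), F.md t f = F.E N f := by
  induction N with
  | zero => simp [md]
  | succ N ih => rw [Finset.sum_range_succ, ih]; simp [md]

lemma pred_meas {v : ℕ → X → ℝ} (hv : F.Pred v) (t : ℕ) : F.Meas t (v t) := by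
  cases t with
  | zero => exact hv.1
  | succ t => exact F.meas_succ (hv.2 t)

lemma E_md {v : ℕ → X → ℝ} (hv : F.Pred v) (s t : ℕ) (f : X → ℝ) :
    F.E s (v t * F.md t f) = if t ≤ s then v t * F.md t f else 0 := by
  split_ifs with h
  · apply F.E_of_meas
    apply F.meas_mono h
    intro x y hxy
    simp only [Pi.mul_apply]
    rw [F.pred_meas hv t x y hxy, F.md_meas t f x y hxy]
  · push Not at h
    obtain ⟨t, rfl⟩ : ∃ t', t = t' + 1 := ⟨t - 1, by omega⟩
    rw [← F.E_tower2 (show s ≤ t by omega), F.E_mul (hv.2 t)]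
    simp only [md, LinearMap.sub_apply, map_sub]
    rw [F.E_tower2 (Nat.le_succ t), F.E_tower1 le_rfl, sub_self, mul_zero, map_zero]

/-- martingale transform -/
def tr (v : ℕ → X → ℝ) (N : ℕ) : (X → ℝ) →ₗ[ℝ] (X → ℝ) :=
  ∑ t ∈ Finset.range (N + 1), (LinearMap.mulLeft ℝ (v t)) ∘ₗ F.md t

lemma tr_apply (v : ℕ → X → ℝ) (N : ℕ) (f : X → ℝ) :
    F.tr v N f = ∑ t ∈ Finset.range (N + 1), v t * F.md t f := by
  simp [tr, LinearMap.sum_apply]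

lemma E_tr {v : ℕ → X → ℝ} (hv : F.Pred v) {s N : ℕ} (h : s ≤ N) (f : X → ℝ) :
    F.E s (F.tr v N f) = F.tr v s f := by
  simp only [tr_apply, map_sum, F.E_md hv]
  rw [← Finset.sum_filter]
  congr 1
  ext t
  simp; omega

lemma md_tr {v : ℕ → X → ℝ} (hv : F.Pred v) {s N : ℕ} (h : s ≤ N) (f : X → ℝ) :
    F.md s (F.tr v N f) = v s * F.md s f := by
  cases s with
  | zero => simp only [md, F.E_tr hv h]; simp [tr_apply, md]
  | succ s =>
    simp only [md, LinearMap.sub_apply]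
    rw [F.E_tr hv h, F.E_tr hv (by omega), tr_apply, tr_apply, Finset.sum_range_succ]
    simp [md]

lemma tr_meas {v : ℕ → X → ℝ} (hv : F.Pred v) (N : ℕ) (f : X → ℝ) : F.Meas N (F.tr v N f) := by
  rw [← F.E_tr hv le_rfl]; exact F.E_meas _ _

/-- martingale square function -/
def S (N : ℕ) (f : X → ℝ) : X → ℝ := sqf (N + 1) (fun t => F.md t f)

lemma S_nonneg (N : ℕ) (f : X → ℝ) (x : X) : 0 ≤ F.S N f x := sqf_nonneg _ _ _

lemma sq_S (N : ℕ) (f : X → ℝ) (x : X) : F.S N f x ^ 2 = ∑ t ∈ Finset.range (N + 1), F.md t f x ^ 2 :=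
  Real.sq_sqrt (Finset.sum_nonneg fun _ _ => sq_nonneg _)

/-- the weights for the doubling argument -/
def vv (f : X → ℝ) : ℕ → X → ℝ
  | 0 => 0
  | t + 1 => F.E t f

lemma vv_pred (f : X → ℝ) : F.Pred (F.vv f) := ⟨fun _ _ _ => rfl, fun t => F.E_meas t f⟩

lemma sq_E (N : ℕ) (f : X → ℝ) (x : X) :
    F.E N f x ^ 2 = F.S N f x ^ 2 + 2 * F.tr (F.vv f) N f x := by
  rw [sq_S, tr_apply]
  induction N with
  | zero => simp [md, vv]
  | succ N ih =>
    rw [Finset.sum_range_succ, Finset.sum_range_succ (fun t => F.vv f t * F.md t f)]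
    simp only [Pi.add_apply, mul_add]
    have e : F.md (N + 1) f x = F.E (N + 1) f x - F.E N f x := by simp [md]
    have e2 : F.vv f (N + 1) x = F.E N f x := rfl
    simp only [Pi.mul_apply, e2, e]
    linear_combination ih

lemma tr_sym {v : ℕ → X → ℝ} (hv : F.Pred v) (N : ℕ) (f g : X → ℝ) :
    ∑ x, F.tr v N f x * g x = ∑ x, f x * F.tr v N g x := by
  simp only [tr_apply, Finset.sum_apply, Finset.sum_mul, Finset.mul_sum]
  rw [Finset.sum_comm, Finset.sum_comm (s := Finset.univ)]
  refine Finset.sum_congr rfl fun t _ => ?_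
  have key : ∀ s, F.Meas s (v t) → ∑ x, v t x * F.E s f x * g x = ∑ x, f x * (v t x * F.E s g x) := by
    intro s hs
    have e1 := F.E_sym s f (v t * g)
    rw [F.E_mul hs] at e1
    simp only [Pi.mul_apply] at e1
    rw [← e1]
    exact Finset.sum_congr rfl fun x _ => by ring
  cases t with
  | zero => simpa [md] using key 0 hv.1
  | succ t =>
    have k1 := key (t + 1) (F.meas_succ (hv.2 t))
    have k2 := key t (hv.2 t)
    simp only [md, Pi.mul_apply, LinearMap.sub_apply, Pi.sub_apply, mul_sub, sub_mul,
      Finset.sum_sub_distrib, k1, k2]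

end Filt

/-- Burkholder equivalence at exponent p. -/
def Burk (p C : ℝ) : Prop := ∀ (X : Type) [Fintype X] (F : Filt X) (N : ℕ) (f : X → ℝ),
  F.Meas N f → nm p (F.S N f) ≤ C * nm p f ∧ nm p f ≤ C * nm p (F.S N f)

lemma nm_two (f : X → ℝ) : nm 2 f = Real.sqrt (∑ x, f x ^ 2) := by
  rw [nm, Real.sqrt_eq_rpow]; simp

lemma burk_two : Burk 2 1 := by
  intro X _ F N f hf
  have : nm 2 (F.S N f) = nm 2 f := by
    rw [nm_two, nm_two]
    congr 1
    have h1 : ∀ x, f x ^ 2 = F.S N f x ^ 2 + 2 * F.tr (F.vv f) N f x := by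
      intro x; rw [← F.sq_E, F.E_of_meas hf]
    simp only [h1, Finset.sum_add_distrib, ← Finset.mul_sum]
    have h0 : ∑ x, F.tr (F.vv f) N f x = 0 := by
      rw [← F.sum_E 0, F.E_tr (F.vv_pred f) (Nat.zero_le N)]
      simp [F.tr_apply, Filt.vv]
    rw [h0]; simp
  rw [this]
  simp

lemma burk_double {p C : ℝ} (hp : 1 < p) (hC : 0 ≤ C) (H : Burk p C) :
    ∃ C', 0 ≤ C' ∧ Burk (2 * p) C' := by
  obtain ⟨q, hq⟩ : ∃ q, (2 * p).HolderConjugate q :=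
    ⟨_, Real.HolderConjugate.conjExponent (by linarith)⟩
  have q0 := hq.symm.pos
  refine ⟨1 + 2 * (C * q), by positivity, ?_⟩
  intro X _ F N f hf
  set h := F.tr (F.vv f) N f with hh
  have e : ∀ x, f x ^ 2 = F.S N f x ^ 2 + 2 * h x := by
    intro x; rw [← F.sq_E, F.E_of_meas hf]
  have p0 : 0 < p := by linarith
  have b1 := (H X F N h (F.tr_meas (F.vv_pred f) N f)).2
  have b2 : nm p (F.S N h) ≤ nm p (fun x => rmax (fun t => F.E t f x) N * F.S N f x) := by
    apply nm_mono' p0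
    intro x
    have hr := rmax_nonneg (fun t => F.E t f x) N
    rw [abs_of_nonneg (F.S_nonneg _ _ _)]
    apply Real.sqrt_le_iff.mpr ⟨mul_nonneg hr (F.S_nonneg _ _ _), ?_⟩
    rw [mul_pow, F.sq_S, Finset.mul_sum]
    refine Finset.sum_le_sum fun t ht => ?_
    dsimp only
    rw [hh, F.md_tr (F.vv_pred f) (by simpa [Nat.lt_succ_iff] using ht), Pi.mul_apply, mul_pow]
    refine mul_le_mul_of_nonneg_right ?_ (sq_nonneg _)
    rw [← sq_abs]
    gcongr
    cases t with
    | zero => simpa [Filt.vv] using hr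
    | succ t =>
      simp only [Finset.mem_range] at ht
      exact abs_le_rmax (fun t => F.E t f x) (by omega)
  have b3 := nm_mul_le p0 (fun x => rmax (fun t => F.E t f x) N) (F.S N f)
  have b4 := doob hq F f N
  set A := nm (2 * p) f
  set B := nm (2 * p) (F.S N f)
  have hA : 0 ≤ A := nm_nonneg _ _
  have hB : 0 ≤ B := nm_nonneg _ _
  have b5 : nm p h ≤ C * (q * A * B) := by
    refine b1.trans ?_
    gcongr
    exact b2.trans (b3.trans (by gcongr))
  have c1 : B ^ 2 ≤ A ^ 2 + 2 * (C * (q * A * B)) := by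
    rw [← nm_sq p0, ← nm_sq p0]
    have : (fun x => F.S N f x ^ 2) = (fun x => f x ^ 2) - (2 : ℝ) • h := by
      ext x; simp [e x]
    rw [this]
    refine (nm_sub_le hp.le _ _).trans ?_
    rw [nm_smul p0]
    norm_num
    exact b5
  have c2 : A ^ 2 ≤ B ^ 2 + 2 * (C * (q * A * B)) := by
    rw [← nm_sq p0, ← nm_sq p0]
    have : (fun x => f x ^ 2) = (fun x => F.S N f x ^ 2) + (2 : ℝ) • h := by
      ext x; simp [e x]
    rw [this]
    refine (nm_add_le hp.le _ _).trans ?_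
    rw [nm_smul p0]
    norm_num
    exact b5
  have fin : ∀ a b : ℝ, 0 ≤ a → 0 ≤ b → b ^ 2 ≤ a ^ 2 + 2 * (C * (q * a * b)) →
      b ≤ (1 + 2 * (C * q)) * a := by
    intro a b ha hb hab
    have hCq : 0 ≤ C * q := by positivity
    rcases le_total b a with h | h
    · nlinarith [mul_nonneg hCq ha]
    · rcases hb.eq_or_lt with h0 | h0
      · rw [← h0]; positivity
      · refine le_of_mul_le_mul_right ?_ h0
        nlinarith
  exact ⟨fin A B hA hB c1, fin B A hB hA (by rw [show q * B * A = q * A * B by ring]; exact c2)⟩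

lemma burk_pow (k : ℕ) : ∃ C, 0 ≤ C ∧ Burk (2 ^ (k + 1)) C := by
  induction k with
  | zero => exact ⟨1, by norm_num, by simpa using burk_two⟩
  | succ k ih =>
    obtain ⟨C, hC, h⟩ := ih
    have := burk_double (one_lt_pow₀ (by norm_num) (by omega)) hC h
    rwa [← pow_succ'] at this

lemma tr_bound_of_burk {p C : ℝ} (hp : 1 < p) (hC : 0 ≤ C) (H : Burk p C) :
    ∃ C', 0 < C' ∧ ∀ (X : Type) [Fintype X] (F : Filt X) (N : ℕ) (v : ℕ → X → ℝ), F.Pred v →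
      (∀ t x, |v t x| ≤ 1) → ∀ f, nm p (F.tr v N f) ≤ C' * nm p f := by
  obtain ⟨q, hq⟩ : ∃ q, p.HolderConjugate q := ⟨_, Real.HolderConjugate.conjExponent hp⟩
  have q0 := hq.symm.pos
  refine ⟨C * C * q + 1, by positivity, ?_⟩
  intro X _ F N v hv hv1 f
  have p0 : 0 < p := by linarith
  have a1 := (H X F N _ (F.tr_meas hv N f)).2
  have a2 : nm p (F.S N (F.tr v N f)) ≤ nm p (F.S N (F.E N f)) := by
    apply nm_mono' p0
    intro x
    rw [abs_of_nonneg (F.S_nonneg _ _ _)]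
    apply Real.sqrt_le_sqrt
    refine Finset.sum_le_sum fun t ht => ?_
    have ht : t ≤ N := by simpa [Nat.lt_succ_iff] using ht
    have e : F.md t (F.E N f) = F.md t f := by
      cases t with
      | zero => exact F.E_tower2 ht f
      | succ t => simp only [Filt.md, LinearMap.sub_apply, F.E_tower2 ht, F.E_tower2 (show t ≤ N by omega)]
    dsimp only
    rw [F.md_tr hv ht, e, Pi.mul_apply, mul_pow]
    have : v t x ^ 2 ≤ 1 := by rw [← sq_abs]; exact pow_le_one₀ (abs_nonneg _) (hv1 t x)
    exact mul_le_of_le_one_left (sq_nonneg _) this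
  have a3 := (H X F N _ (F.E_meas N f)).1
  have a4 := nm_E_le hq F f N
  have := nm_nonneg p f
  calc nm p (F.tr v N f) ≤ C * (C * (q * nm p f)) := by
        refine a1.trans ?_
        gcongr
        refine a2.trans (a3.trans ?_)
        gcongr
    _ ≤ _ := by nlinarith

theorem tr_bound {p : ℝ} (hp : 1 < p) :
    ∃ C, 0 < C ∧ ∀ (X : Type) [Fintype X] (F : Filt X) (N : ℕ) (v : ℕ → X → ℝ), F.Pred v →
      (∀ t x, |v t x| ≤ 1) → ∀ f, nm p (F.tr v N f) ≤ C * nm p f := by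
  have main : ∀ p : ℝ, 2 ≤ p → ∃ C, 0 < C ∧ ∀ (X : Type) [Fintype X] (F : Filt X) (N : ℕ)
      (v : ℕ → X → ℝ), F.Pred v →
      (∀ t x, |v t x| ≤ 1) → ∀ f, nm p (F.tr v N f) ≤ C * nm p f := by
    intro p hp
    rcases hp.eq_or_lt with rfl | h2
    · exact tr_bound_of_burk (by norm_num) zero_le_one burk_two
    obtain ⟨k, hk⟩ := pow_unbounded_of_one_lt p (show (1:ℝ) < 2 by norm_num)
    set P : ℝ := 2 ^ (k + 1) with hP
    have hPp : p < P := by rw [hP, pow_succ]; linarith [show (0:ℝ) < 2 ^ k by positivity]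
    obtain ⟨C0, h0, H0⟩ := burk_pow k
    obtain ⟨C1, hC1, H1⟩ := tr_bound_of_burk (by linarith) h0 H0
    obtain ⟨C2, hC2, H2⟩ := tr_bound_of_burk (by norm_num) zero_le_one burk_two
    set θ : ℝ := (1 / 2 - 1 / p) / (1 / 2 - 1 / P) with hθ
    have i1 : 1 / p < 1 / 2 := by gcongr
    have i2 : 1 / P < 1 / p := by gcongr
    have θ0 : 0 < θ := div_pos (by linarith) (by linarith)
    have θ1 : θ ≤ 1 := by rw [hθ, div_le_one (by linarith)]; linarith
    refine ⟨2 * (C2 ^ (1 - θ) * C1 ^ θ), by positivity, ?_⟩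
    intro X _ F N v hv hv1 f
    refine riesz_thorin (p0 := 2) (p1 := P) (by norm_num) (by linarith) (by linarith) θ0 θ1 hC2 hC1
      ?_ (F.tr v N) (H2 X F N v hv hv1) (H1 X F N v hv hv1) f
    have : θ * (1 / 2 - 1 / P) = 1 / 2 - 1 / p := by
      rw [hθ, div_mul_cancel₀]; linarith
    linear_combination this
  rcases le_total 2 p with h | h
  · exact main p h
  · obtain ⟨q, hq⟩ : ∃ q, p.HolderConjugate q := ⟨_, Real.HolderConjugate.conjExponent hp⟩
    have hq2 : 2 ≤ q := by
      have e := hq.inv_add_inv_eq_one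
      have q0 := hq.symm.pos
      have : (2:ℝ)⁻¹ ≤ p⁻¹ := by gcongr
      have : q⁻¹ ≤ 2⁻¹ := by norm_num at *; linarith
      exact (inv_le_inv₀ q0 (by norm_num)).mp this
    obtain ⟨C, hC, H⟩ := main q hq2
    refine ⟨C, hC, ?_⟩
    intro X _ F N v hv hv1 f
    exact nm_dual_op hq (F.tr v N) (F.tr v N) (F.tr_sym hv N) hC.le (H X F N v hv hv1) f

end
end DF

namespace DF
noncomputable section

/-- anchor times -/
def anc (a : ℕ → ℝ) (l : ℝ) : ℕ → ℕ
  | 0 => 0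
  | t + 1 => if l * rmax a (t + 1) ≤ |a (t + 1) - a (anc a l t)| then t + 1 else anc a l t

lemma anc_le (a : ℕ → ℝ) (l : ℝ) (t : ℕ) : anc a l t ≤ t := by
  induction t with
  | zero => exact le_rfl
  | succ t ih => rw [anc]; split_ifs <;> omega

lemma anc_succ (a : ℕ → ℝ) (l : ℝ) (t : ℕ) : anc a l (t + 1) = t + 1 ∨ anc a l (t + 1) = anc a l t := by
  rw [anc]; split_ifs <;> simp

lemma anc_close (a : ℕ → ℝ) {l : ℝ} (hl : 0 ≤ l) (t : ℕ) : |a t - a (anc a l t)| ≤ l * rmax a t := by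
  have hr := mul_nonneg hl (rmax_nonneg a t)
  cases t with
  | zero => simpa [anc] using hr
  | succ t =>
    rw [anc]
    split_ifs with h
    · simpa using hr
    · push Not at h; exact h.le

lemma anc_const (a : ℕ → ℝ) (l : ℝ) (t : ℕ) : ∀ s, anc a l t ≤ s → s ≤ t → anc a l s = anc a l t := by
  induction t with
  | zero => intro s _ h; rw [Nat.le_zero.mp h]
  | succ t ih =>
    intro s h1 h2
    rcases Nat.eq_or_lt_of_le h2 with h | h
    · rw [h]
    · rcases anc_succ a l t with h' | h'
      · omega
      · rw [h'] at h1 ⊢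
        exact ih s h1 (by omega)

lemma exists_jump (a : ℕ → ℝ) {l : ℝ} (hl : 0 ≤ l) (hl2 : l ≤ 1 / 2) {s t : ℕ} (hst : s < t)
    (h : 2 * l * rmax a t < |a t - a s|) :
    ∃ τ, s ≤ τ ∧ τ < t ∧ l * rmax a t / 2 ≤ |a (anc a l (τ + 1)) - a (anc a l τ)| := by
  have hA := anc_le a l t
  by_cases hs : anc a l t ≤ s
  · exfalso
    have e := anc_const a l t s hs hst.le
    have h1 := anc_close a hl t
    have h2 := anc_close a hl s
    rw [e] at h2
    have h3 := mul_le_mul_of_nonneg_left (rmax_mono a hst.le) hl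
    have := abs_sub_le (a t) (a (anc a l t)) (a s)
    rw [abs_sub_comm (a (anc a l t))] at this
    linarith
  · push Not at hs
    obtain ⟨m, hm⟩ : ∃ m, anc a l t = m + 1 := ⟨anc a l t - 1, by omega⟩
    refine ⟨m, by omega, by omega, ?_⟩
    have e : anc a l (m + 1) = m + 1 := by
      rw [anc_const a l t (m + 1) (by omega) (by omega), hm]
    have hj : l * rmax a (m + 1) ≤ |a (m + 1) - a (anc a l m)| := by
      by_contra hc
      rw [anc, if_neg hc] at e
      have := anc_le a l m
      omega
    rw [e]
    refine le_trans ?_ hj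
    have : rmax a t / 2 ≤ rmax a (m + 1) := by
      obtain ⟨q, hq, hq'⟩ := exists_rmax a t
      rcases le_total q (m + 1) with h5 | h5
      · have := abs_le_rmax a h5
        have := rmax_nonneg a t
        linarith
      · have h6 := anc_const a l t q (by omega) hq
        have h7 := anc_close a hl q
        rw [h6, hm] at h7
        have h8 := rmax_mono a hq
        have h9 := rmax_nonneg a q
        have h10 : l * rmax a q ≤ 1 / 2 * rmax a t := mul_le_mul hl2 h8 h9 (by norm_num)
        have h11 := abs_sub_abs_le_abs_sub (a q) (a (m + 1))
        have h12 := abs_le_rmax_self a (m + 1)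
        linarith
    calc l * rmax a t / 2 = l * (rmax a t / 2) := by ring
      _ ≤ _ := by gcongr

/-- quadratic sums at scale l -/
def Qs (a : ℕ → ℝ) (l : ℝ) (N : ℕ) : ℝ :=
  ∑ t ∈ Finset.range N, (a (anc a l (t + 1)) - a (anc a l t)) ^ 2

lemma Qs_nonneg (a : ℕ → ℝ) (l : ℝ) (N : ℕ) : 0 ≤ Qs a l N := Finset.sum_nonneg fun _ _ => sq_nonneg _

lemma pair_bound (a : ℕ → ℝ) {r : ℝ} (hr : 2 < r) {N K s t : ℕ} (hst : s < t) (htN : t ≤ N)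
    (hK : 2 * (1 / 2) ^ K * rmax a t < |a t - a s|) :
    |a t - a s| ^ r ≤ 64 * 4 ^ (r - 2) * rmax a N ^ (r - 2) * ∑ k ∈ Finset.range (K + 1),
      ((1 / 2 : ℝ) ^ (r - 2)) ^ k * ∑ τ ∈ Finset.Ico s t,
        (a (anc a ((1 / 2) ^ k) (τ + 1)) - a (anc a ((1 / 2) ^ k) τ)) ^ 2 := by
  classical
  have hex : ∃ k : ℕ, 2 * (1 / 2 : ℝ) ^ k * rmax a t < |a t - a s| := ⟨K, hK⟩
  set k := Nat.find hex with hk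
  have hk1 := Nat.find_spec hex
  rw [← hk] at hk1
  have hkK : k ≤ K := Nat.find_min' hex hK
  have hM := rmax_nonneg a t
  have hMN := rmax_mono a htN
  have hk0 : k ≠ 0 := by
    intro h0
    rw [h0] at hk1
    have h1 := abs_le_rmax_self a t
    have h2 := abs_le_rmax a hst.le
    have h3 := abs_sub (a t) (a s)
    norm_num at hk1
    linarith
  obtain ⟨m, hm⟩ : ∃ m, k = m + 1 := ⟨k - 1, by omega⟩
  have hk2 : |a t - a s| ≤ 2 * (1 / 2 : ℝ) ^ m * rmax a t := by
    have := Nat.find_min hex (m := m) (by omega)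
    push Not at this
    exact this
  have hm2 : (1 / 2 : ℝ) ^ m = 2 * (1 / 2) ^ k := by rw [hm, pow_succ]; ring
  set l : ℝ := (1 / 2) ^ k with hl
  have l0 : 0 < l := by positivity
  have l2 : l ≤ 1 / 2 := by
    rw [hl, hm, pow_succ]
    have : (1 / 2 : ℝ) ^ m ≤ 1 := pow_le_one₀ (by norm_num) (by norm_num)
    linarith
  obtain ⟨τ, h1, h2, h3⟩ := exists_jump a l0.le l2 hst hk1
  set D := |a t - a s| with hD
  have hD0 : 0 < D := lt_of_le_of_lt (by positivity) hk1
  have hDle : D ≤ 4 * l * rmax a t := by rw [hm2] at hk2; linarith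
  have hsq : D ^ 2 ≤ 64 * ∑ τ ∈ Finset.Ico s t, (a (anc a l (τ + 1)) - a (anc a l τ)) ^ 2 := by
    have e1 : (a (anc a l (τ + 1)) - a (anc a l τ)) ^ 2 ≤
        ∑ τ ∈ Finset.Ico s t, (a (anc a l (τ + 1)) - a (anc a l τ)) ^ 2 :=
      Finset.single_le_sum (f := fun τ => (a (anc a l (τ + 1)) - a (anc a l τ)) ^ 2)
        (fun _ _ => sq_nonneg _) (Finset.mem_Ico.mpr ⟨h1, h2⟩)
    rw [← sq_abs] at e1
    have : D ≤ 8 * |a (anc a l (τ + 1)) - a (anc a l τ)| := by linarith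
    have : D ^ 2 ≤ (8 * |a (anc a l (τ + 1)) - a (anc a l τ)|) ^ 2 := by gcongr
    nlinarith
  have hpow : D ^ r = D ^ (r - 2) * D ^ 2 := by
    rw [← Real.rpow_natCast D 2, ← Real.rpow_add hD0]; norm_num
  have hp2 : D ^ (r - 2) ≤ 4 ^ (r - 2) * rmax a N ^ (r - 2) * ((1 / 2 : ℝ) ^ (r - 2)) ^ k := by
    have : D ≤ 4 * rmax a N * l := by nlinarith
    refine (Real.rpow_le_rpow hD0.le this (by linarith)).trans (le_of_eq ?_)
    rw [Real.mul_rpow (mul_nonneg (by norm_num) (hM.trans hMN)) l0.le, Real.mul_rpow (by norm_num) (hM.trans hMN), hl,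
      ← Real.rpow_natCast, ← Real.rpow_natCast, ← Real.rpow_mul (by norm_num),
      ← Real.rpow_mul (by norm_num), mul_comm (k : ℝ)]
  have hS : 0 ≤ ∑ τ ∈ Finset.Ico s t, (a (anc a l (τ + 1)) - a (anc a l τ)) ^ 2 :=
    Finset.sum_nonneg fun _ _ => sq_nonneg _
  have hsum : ((1 / 2 : ℝ) ^ (r - 2)) ^ k *
      ∑ τ ∈ Finset.Ico s t, (a (anc a l (τ + 1)) - a (anc a l τ)) ^ 2 ≤
      ∑ k ∈ Finset.range (K + 1), ((1 / 2 : ℝ) ^ (r - 2)) ^ k * ∑ τ ∈ Finset.Ico s t,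
        (a (anc a ((1 / 2) ^ k) (τ + 1)) - a (anc a ((1 / 2) ^ k) τ)) ^ 2 :=
    Finset.single_le_sum (f := fun k => ((1 / 2 : ℝ) ^ (r - 2)) ^ k * ∑ τ ∈ Finset.Ico s t,
        (a (anc a ((1 / 2) ^ k) (τ + 1)) - a (anc a ((1 / 2) ^ k) τ)) ^ 2)
      (fun _ _ => mul_nonneg (by positivity) (Finset.sum_nonneg fun _ _ => sq_nonneg _))
      (Finset.mem_range.mpr (by omega))
  rw [hpow]
  have hX : 0 ≤ 4 ^ (r - 2) * rmax a N ^ (r - 2) := by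
    have := hM.trans hMN
    positivity
  calc D ^ (r - 2) * D ^ 2 ≤ (4 ^ (r - 2) * rmax a N ^ (r - 2) * ((1 / 2 : ℝ) ^ (r - 2)) ^ k) *
        (64 * ∑ τ ∈ Finset.Ico s t, (a (anc a l (τ + 1)) - a (anc a l τ)) ^ 2) := by
        refine mul_le_mul hp2 hsq (sq_nonneg _) (by positivity)
    _ = 64 * (4 ^ (r - 2) * rmax a N ^ (r - 2)) * (((1 / 2 : ℝ) ^ (r - 2)) ^ k *
        ∑ τ ∈ Finset.Ico s t, (a (anc a l (τ + 1)) - a (anc a l τ)) ^ 2) := by ring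
    _ ≤ 64 * (4 ^ (r - 2) * rmax a N ^ (r - 2)) * _ := mul_le_mul_of_nonneg_left hsum (by positivity)
    _ = _ := by ring

/-- variation sum along a chain -/
def vsum (r : ℝ) (a : ℕ → ℝ) (u : ℕ → ℕ) (J : ℕ) : ℝ :=
  ∑ j ∈ Finset.range J, |a (u (j + 1)) - a (u j)| ^ r

lemma sum_chain (g : ℕ → ℝ) (hg : ∀ t, 0 ≤ g t) (u : ℕ → ℕ) (hu : Monotone u) {N : ℕ} (hN : ∀ j, u j ≤ N)
    (J : ℕ) : ∑ j ∈ Finset.range J, ∑ τ ∈ Finset.Ico (u j) (u (j + 1)), g τ ≤ ∑ τ ∈ Finset.range N, g τ := by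
  have : ∑ j ∈ Finset.range J, ∑ τ ∈ Finset.Ico (u j) (u (j + 1)), g τ =
      ∑ τ ∈ Finset.Ico (u 0) (u J), g τ := by
    induction J with
    | zero => simp
    | succ J ih =>
      rw [Finset.sum_range_succ, ih, Finset.sum_Ico_consecutive _ (hu (Nat.zero_le _)) (hu (Nat.le_succ _))]
  rw [this]
  refine Finset.sum_le_sum_of_subset_of_nonneg ?_ fun _ _ _ => hg _
  intro τ hτ
  simp only [Finset.mem_Ico, Finset.mem_range] at hτ ⊢
  exact lt_of_lt_of_le hτ.2 (hN J)

lemma vsum_bound (a : ℕ → ℝ) {r : ℝ} (hr : 2 < r) {N K : ℕ}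
    (hK : ∀ s t, s < t → t ≤ N → a t ≠ a s → 2 * (1 / 2) ^ K * rmax a t < |a t - a s|)
    (u : ℕ → ℕ) (hu : Monotone u) (hN : ∀ j, u j ≤ N) (J : ℕ) :
    vsum r a u J ≤ 64 * 4 ^ (r - 2) * rmax a N ^ (r - 2) * ∑ k ∈ Finset.range (K + 1),
      ((1 / 2 : ℝ) ^ (r - 2)) ^ k * Qs a ((1 / 2) ^ k) N := by
  have hM := rmax_nonneg a N
  have step : ∀ j, |a (u (j + 1)) - a (u j)| ^ r ≤
      64 * 4 ^ (r - 2) * rmax a N ^ (r - 2) * ∑ k ∈ Finset.range (K + 1),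
      ((1 / 2 : ℝ) ^ (r - 2)) ^ k * ∑ τ ∈ Finset.Ico (u j) (u (j + 1)),
        (a (anc a ((1 / 2) ^ k) (τ + 1)) - a (anc a ((1 / 2) ^ k) τ)) ^ 2 := by
    intro j
    by_cases hne : a (u (j + 1)) = a (u j)
    · rw [hne, sub_self, abs_zero, Real.zero_rpow (by linarith)]
      have : 0 ≤ ∑ k ∈ Finset.range (K + 1),
        ((1 / 2 : ℝ) ^ (r - 2)) ^ k * ∑ τ ∈ Finset.Ico (u j) (u (j + 1)),
          (a (anc a ((1 / 2) ^ k) (τ + 1)) - a (anc a ((1 / 2) ^ k) τ)) ^ 2 :=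
        Finset.sum_nonneg fun _ _ => mul_nonneg (by positivity) (Finset.sum_nonneg fun _ _ => sq_nonneg _)
      positivity
    · have hlt : u j < u (j + 1) := lt_of_le_of_ne (hu (Nat.le_succ j)) (fun h => hne (by rw [h]))
      exact pair_bound a hr hlt (hN _) (hK _ _ hlt (hN _) hne)
  refine (Finset.sum_le_sum fun j _ => step j).trans ?_
  rw [← Finset.mul_sum, Finset.sum_comm]
  refine mul_le_mul_of_nonneg_left ?_ (by positivity)
  refine Finset.sum_le_sum fun k _ => ?_
  rw [← Finset.mul_sum]
  refine mul_le_mul_of_nonneg_left ?_ (by positivity)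
  exact sum_chain _ (fun _ => sq_nonneg _) u hu hN J

/-- block sums -/
def blk (a : ℕ → ℝ) (l : ℝ) (T : ℕ) (b : ℕ) : ℝ :=
  ∑ t ∈ Finset.range T, if anc a l t = b then a (t + 1) - a t else 0

lemma blk_succ (a : ℕ → ℝ) (l : ℝ) (T b : ℕ) :
    blk a l (T + 1) b = blk a l T b + if anc a l T = b then a (T + 1) - a T else 0 := by
  rw [blk, Finset.sum_range_succ]; rfl

lemma blk_inv (a : ℕ → ℝ) (l : ℝ) (T : ℕ) : blk a l T (anc a l T) = a T - a (anc a l T) := by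
  induction T with
  | zero => simp [blk, anc]
  | succ T ih =>
    rcases anc_succ a l T with h | h
    · rw [h, sub_self]
      refine Finset.sum_eq_zero fun t ht => ?_
      have := anc_le a l t
      rw [Finset.mem_range] at ht
      rw [if_neg (by omega)]
    · rw [h, blk_succ, ih]; simp

lemma blk_sq (a : ℕ → ℝ) (l : ℝ) (N T : ℕ) (h : T ≤ N) :
    ∑ b ∈ Finset.range (N + 1), blk a l T b ^ 2 = Qs a l T + (a T - a (anc a l T)) ^ 2 := by
  induction T with
  | zero => simp [blk, Qs, anc]
  | succ T ih =>
    have hA : anc a l T ∈ Finset.range (N + 1) := by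
      have := anc_le a l T
      rw [Finset.mem_range]; omega
    have ih := ih (by omega)
    rw [← Finset.add_sum_erase _ _ hA, blk_inv] at ih
    rw [← Finset.add_sum_erase _ _ hA, blk_succ, blk_inv]
    have e : ∑ b ∈ (Finset.range (N + 1)).erase (anc a l T), blk a l (T + 1) b ^ 2 =
        ∑ b ∈ (Finset.range (N + 1)).erase (anc a l T), blk a l T b ^ 2 := by
      refine Finset.sum_congr rfl fun b hb => ?_
      rw [blk_succ, if_neg (Finset.ne_of_mem_erase hb).symm, add_zero]
    rw [e, if_pos rfl]
    have e2 : Qs a l (T + 1) = Qs a l T + (a (anc a l (T + 1)) - a (anc a l T)) ^ 2 := by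
      rw [Qs, Finset.sum_range_succ]; rfl
    rw [e2]
    rcases anc_succ a l T with h | h
    · rw [h]; linear_combination ih
    · rw [h]; linear_combination ih

variable {X : Type} [Fintype X]

lemma anc_meas (F : Filt X) (f : X → ℝ) (l : ℝ) (t : ℕ) :
    F.Meas t (fun x => anc (fun t => F.E t f x) l t) := by
  have hE : ∀ t s x y, s ≤ t → F.r t x y → F.E s f x = F.E s f y := fun t s x y hs h =>
    F.meas_mono hs (F.E_meas s f) x y h
  have hm : ∀ t, F.Meas t (fun x => rmax (fun t => F.E t f x) t) := by
    intro t
    induction t with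
    | zero => intro x y hxy; simp only [rmax, F.E_meas 0 f x y hxy]
    | succ t ih =>
      intro x y hxy
      have := ih x y (F.mono t x y hxy)
      simp only [rmax, F.E_meas (t + 1) f x y hxy] at this ⊢
      rw [this]
  induction t with
  | zero => intro x y _; rfl
  | succ t ih =>
    intro x y hxy
    have i1 := ih x y (F.mono t x y hxy)
    have i2 := hm (t + 1) x y hxy
    have i3 := hE (t + 1) (t + 1) x y le_rfl hxy
    have i4 := hE (t + 1) (anc (fun t => F.E t f y) l t) x y ((anc_le _ _ _).trans (Nat.le_succ _)) hxy
    dsimp only at i1 i2 ⊢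
    rw [anc, anc]
    simp only [i1, i2, i3, i4]

theorem Qs_bound {p : ℝ} (hp : 1 < p) : ∃ C, 0 < C ∧ ∀ (X : Type) [Fintype X] (F : Filt X) (N : ℕ) (l : ℝ)
    (f : X → ℝ), nm p (fun x => Real.sqrt (Qs (fun t => F.E t f x) l N)) ≤ C * nm p f := by
  obtain ⟨C, hC, H⟩ := tr_bound hp
  have p0 : 0 < p := by linarith
  obtain ⟨K, hK, HK⟩ := khinchine p0
  refine ⟨K * C, by positivity, ?_⟩
  intro X _ F N l f
  have := HK X (N + 1) (fun b x => blk (fun t => F.E t f x) l N b) (C * nm p f)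
    (mul_nonneg hC.le (nm_nonneg _ _)) (by
      intro ε hε
      set v : ℕ → X → ℝ := fun t x => match t with
        | 0 => 0
        | t + 1 => ε (anc (fun t => F.E t f x) l t) with hv
      have hp : F.Pred v := ⟨fun _ _ _ => rfl, fun t x y hxy => by
        simp only [hv]
        exact congrArg ε (anc_meas F f l t x y hxy)⟩
      have hb : ∀ t x, |v t x| ≤ 1 := by
        intro t x
        cases t with
        | zero => simp [hv]
        | succ t => rcases hε (anc (fun t => F.E t f x) l t) with h | h <;> simp [hv, h]
      have e : ∑ n ∈ Finset.range (N + 1), ε n • (fun x => blk (fun t => F.E t f x) l N n) = F.tr v N f := by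
        ext x
        rw [F.tr_apply, Finset.sum_range_succ' (fun t => v t * F.md t f)]
        simp only [Finset.sum_apply, Pi.smul_apply, smul_eq_mul, Pi.add_apply, Pi.mul_apply, blk, Finset.mul_sum]
        rw [Finset.sum_comm]
        simp only [hv, zero_mul, add_zero]
        refine Finset.sum_congr rfl fun t ht => ?_
        have ha : anc (fun t => F.E t f x) l t ∈ Finset.range (N + 1) := by
          have := anc_le (fun t => F.E t f x) l t
          rw [Finset.mem_range] at ht ⊢
          omega
        simp only [mul_ite, mul_zero]
        rw [Finset.sum_ite_eq, if_pos ha]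
        simp [Filt.md]
      rw [e]
      exact H X F N v hp hb f)
  rw [mul_assoc]
  refine le_trans (nm_mono' p0 fun x => ?_) this
  rw [abs_of_nonneg (Real.sqrt_nonneg _)]
  refine Real.sqrt_le_sqrt ?_
  rw [blk_sq _ _ _ _ le_rfl]
  linarith [sq_nonneg (F.E N f x - F.E (anc (fun t => F.E t f x) l N) f x)]

theorem lepingle {p r : ℝ} (hp : 1 < p) (hr : 2 < r) : ∃ C, 0 < C ∧ ∀ (X : Type) [Fintype X] (F : Filt X)
    (N : ℕ) (f : X → ℝ), ∃ W : X → ℝ, (∀ x, 0 ≤ W x) ∧ nm p W ≤ C * nm p f ∧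
      ∀ x (u : ℕ → ℕ), Monotone u → (∀ j, u j ≤ N) → ∀ J, vsum r (fun t => F.E t f x) u J ^ (1 / r) ≤ W x := by
  have p0 : 0 < p := by linarith
  have r0 : 0 < r := by linarith
  obtain ⟨C, hC, H⟩ := Qs_bound hp
  obtain ⟨q, hq⟩ : ∃ q, p.HolderConjugate q := ⟨_, Real.HolderConjugate.conjExponent hp⟩
  have q0 := hq.symm.pos
  set c : ℝ := (1 / 2 : ℝ) ^ ((r - 2) / 2) with hc
  have c0 : 0 < c := by positivity
  have c1 : c < 1 := Real.rpow_lt_one (by norm_num) (by norm_num) (by linarith)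
  have hcc : (1 / 2 : ℝ) ^ (r - 2) = c ^ 2 := by
    rw [hc, ← Real.rpow_natCast, ← Real.rpow_mul (by norm_num)]
    congr 1; push_cast; ring
  set D : ℝ := 64 * 4 ^ (r - 2) with hD
  have D0 : 0 < D := by positivity
  set θ : ℝ := 2 / r with hθ
  have θ0 : 0 < θ := by positivity
  have θ1 : θ < 1 := by rw [hθ, div_lt_one r0]; exact hr
  have hB : 0 < C * (1 - c)⁻¹ := mul_pos hC (inv_pos.mpr (by linarith))
  refine ⟨D ^ (1 / r) * (q ^ (1 - θ) * (C * (1 - c)⁻¹) ^ θ), by positivity, ?_⟩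
  intro X _ F N f
  -- choose K
  have hexK : ∃ K : ℕ, ∀ x s t, s < t → t ≤ N → F.E t f x ≠ F.E s f x →
      2 * (1 / 2) ^ K * rmax (fun t => F.E t f x) t < |F.E t f x - F.E s f x| := by
    have h1 : ∀ z : X × ℕ × ℕ, ∃ K : ℕ, F.E z.2.2 f z.1 ≠ F.E z.2.1 f z.1 →
      2 * (1 / 2) ^ K * rmax (fun t => F.E t f z.1) z.2.2 < |F.E z.2.2 f z.1 - F.E z.2.1 f z.1| := by
      rintro ⟨x, s, t⟩
      by_cases hne : F.E t f x = F.E s f x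
      · exact ⟨0, fun h => absurd hne h⟩
      · have hpos : 0 < |F.E t f x - F.E s f x| := abs_pos.mpr (sub_ne_zero.mpr hne)
        have hR := rmax_nonneg (fun t => F.E t f x) t
        obtain ⟨K, hK⟩ := exists_pow_lt_of_lt_one
          (show 0 < |F.E t f x - F.E s f x| / (2 * (rmax (fun t => F.E t f x) t + 1)) by positivity)
          (show (1 / 2 : ℝ) < 1 by norm_num)
        refine ⟨K, fun _ => ?_⟩
        rw [lt_div_iff₀ (by positivity)] at hK
        have : (0:ℝ) < (1 / 2) ^ K := by positivity
        dsimp only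
        nlinarith
    choose κ hκ using h1
    refine ⟨∑ z ∈ (Finset.univ : Finset X) ×ˢ (Finset.range (N + 1) ×ˢ Finset.range (N + 1)), κ z, ?_⟩
    intro x s t hst ht hne
    refine lt_of_le_of_lt ?_ (hκ ⟨x, s, t⟩ hne)
    have hmem : (x, s, t) ∈ (Finset.univ : Finset X) ×ˢ (Finset.range (N + 1) ×ˢ Finset.range (N + 1)) := by
      simp; omega
    have hle := Finset.single_le_sum (f := κ) (fun _ _ => Nat.zero_le _) hmem
    have hR := rmax_nonneg (fun t => F.E t f x) t
    refine mul_le_mul_of_nonneg_right (mul_le_mul_of_nonneg_left ?_ (by norm_num)) hR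
    exact pow_le_pow_of_le_one (by norm_num) (by norm_num) hle
  obtain ⟨K, hK⟩ := hexK
  set M : X → ℝ := fun x => rmax (fun t => F.E t f x) N with hM
  set B : X → ℝ := fun x => ∑ k ∈ Finset.range (K + 1), c ^ k *
    Real.sqrt (Qs (fun t => F.E t f x) ((1 / 2) ^ k) N) with hBd
  have M0 : ∀ x, 0 ≤ M x := fun x => rmax_nonneg _ _
  have B0 : ∀ x, 0 ≤ B x := fun x => Finset.sum_nonneg fun _ _ => by positivity
  have nB : nm p B ≤ C * (1 - c)⁻¹ * nm p f := by
    have e : B = ∑ k ∈ Finset.range (K + 1), c ^ k •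
        (fun x => Real.sqrt (Qs (fun t => F.E t f x) ((1 / 2) ^ k) N)) := by
      ext x; simp [hBd]
    rw [e]
    refine (nm_sum_le hp.le _ _).trans ?_
    have s1 : ∀ k ∈ Finset.range (K + 1), nm p (c ^ k •
        (fun x => Real.sqrt (Qs (fun t => F.E t f x) ((1 / 2) ^ k) N))) ≤ c ^ k * (C * nm p f) := by
      intro k _
      rw [nm_smul p0, abs_of_nonneg (by positivity)]
      exact mul_le_mul_of_nonneg_left (H X F N _ f) (by positivity)
    refine (Finset.sum_le_sum s1).trans ?_
    rw [← Finset.sum_mul]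
    have s2 : ∑ k ∈ Finset.range (K + 1), c ^ k ≤ (1 - c)⁻¹ := by
      rw [← tsum_geometric_of_lt_one c0.le c1]
      exact (summable_geometric_of_lt_one c0.le c1).sum_le_tsum _ (fun _ _ => by positivity)
    have := nm_nonneg p f
    calc _ ≤ (1 - c)⁻¹ * (C * nm p f) := by gcongr
      _ = _ := by ring
  have nM : nm p M ≤ q * nm p f := doob hq F f N
  refine ⟨fun x => D ^ (1 / r) * (|M x| ^ (1 - θ) * |B x| ^ θ), fun x => by positivity, ?_, ?_⟩
  · have e : (fun x => D ^ (1 / r) * (|M x| ^ (1 - θ) * |B x| ^ θ)) =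
        D ^ (1 / r) • (fun x => |M x| ^ (1 - θ) * |B x| ^ θ) := by ext x; simp
    rw [e, nm_smul p0, abs_of_nonneg (by positivity), mul_assoc]
    refine mul_le_mul_of_nonneg_left ?_ (by positivity)
    have g := nm_geom_le p0 θ0 θ1 M B
    refine g.trans ?_
    have hf := nm_nonneg p f
    calc nm p M ^ (1 - θ) * nm p B ^ θ ≤ (q * nm p f) ^ (1 - θ) * (C * (1 - c)⁻¹ * nm p f) ^ θ := by
          refine mul_le_mul (Real.rpow_le_rpow (nm_nonneg _ _) nM (by linarith))
            (Real.rpow_le_rpow (nm_nonneg _ _) nB θ0.le) (Real.rpow_nonneg (nm_nonneg _ _) _) (by positivity)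
      _ = q ^ (1 - θ) * (C * (1 - c)⁻¹) ^ θ * (nm p f ^ (1 - θ) * nm p f ^ θ) := by
          rw [Real.mul_rpow q0.le hf, Real.mul_rpow hB.le hf]; ring
      _ = _ := by
          rw [← Real.rpow_add' hf (by norm_num)]; norm_num
  · intro x u hu hN J
    have h1 := vsum_bound (fun t => F.E t f x) hr (N := N) (K := K) (hK x) u hu hN J
    have h2 : ∑ k ∈ Finset.range (K + 1), ((1 / 2 : ℝ) ^ (r - 2)) ^ k *
        Qs (fun t => F.E t f x) ((1 / 2) ^ k) N ≤ B x ^ 2 := by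
      have : ∀ k ∈ Finset.range (K + 1), ((1 / 2 : ℝ) ^ (r - 2)) ^ k *
        Qs (fun t => F.E t f x) ((1 / 2) ^ k) N =
          (c ^ k * Real.sqrt (Qs (fun t => F.E t f x) ((1 / 2) ^ k) N)) ^ 2 := by
        intro k _
        rw [mul_pow, Real.sq_sqrt (Qs_nonneg _ _ _), hcc]; ring
      rw [Finset.sum_congr rfl this]
      exact Finset.sum_sq_le_sq_sum_of_nonneg (fun k _ => by positivity)
    have h3 : vsum r (fun t => F.E t f x) u J ≤ D * (M x ^ (r - 2) * B x ^ 2) := by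
      refine h1.trans ?_
      rw [← mul_assoc]
      refine mul_le_mul_of_nonneg_left h2 ?_
      have := M0 x
      positivity
    have hv : 0 ≤ vsum r (fun t => F.E t f x) u J := Finset.sum_nonneg fun _ _ => by positivity
    refine (Real.rpow_le_rpow hv h3 (by positivity)).trans (le_of_eq ?_)
    have hMx := M0 x
    have hBx := B0 x
    dsimp only
    rw [Real.mul_rpow D0.le (by positivity), Real.mul_rpow (x := M x ^ (r - 2)) (by positivity) (by positivity),
      ← Real.rpow_mul hMx, ← Real.rpow_natCast (B x) 2, ← Real.rpow_mul hBx, abs_of_nonneg hMx,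
      abs_of_nonneg hBx]
    have e1 : (r - 2) * (1 / r) = 1 - θ := by rw [hθ]; field_simp
    have e2 : ((2 : ℕ) : ℝ) * (1 / r) = θ := by rw [hθ]; push_cast; ring
    rw [e1, e2]

end
end DF

namespace DF
noncomputable section

/-- Dirichlet sums -/
def Dn (N : ℕ) (z : ℂ) : ℂ := ∑ k ∈ Finset.range N, z ^ k

/-- symmetric sums -/
def sR (N : ℕ) (z : ℂ) : ℝ := 1 + 2 * ∑ k ∈ Finset.range N, (z ^ (k + 1)).re

/-- Fejer factor -/
def qq (n : ℕ) (z : ℂ) : ℝ := ‖Dn (2 ^ n) z‖ ^ 2 / 4 ^ n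

/-- cube factor -/
def mm (n : ℕ) (z : ℂ) : ℝ := sR (2 ^ n) z / (2 * 2 ^ n + 1)

lemma Dn_mul (N : ℕ) (z : ℂ) : (1 - z) * Dn N z = 1 - z ^ N := by
  rw [Dn, mul_neg_geom_sum]

lemma Dn_double (N : ℕ) (z : ℂ) : Dn (N + N) z = Dn N z * (1 + z ^ N) := by
  simp only [Dn]
  rw [Finset.sum_range_add, mul_add, mul_one]
  congr 1
  rw [Finset.sum_mul]
  exact Finset.sum_congr rfl fun k _ => by rw [pow_add, mul_comm]

lemma qq_zero (z : ℂ) : qq 0 z = 1 := by simp [qq, Dn]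

lemma qq_nonneg (n : ℕ) (z : ℂ) : 0 ≤ qq n z := by unfold qq; positivity

lemma norm_one_add_sq {w : ℂ} (hw : ‖w‖ = 1) : ‖1 + w‖ ^ 2 = 4 - ‖1 - w‖ ^ 2 := by
  have := parallelogram_law_with_norm ℝ (1 : ℂ) w
  rw [norm_one, hw] at this
  nlinarith

lemma norm_one_sub_sq {w : ℂ} (hw : ‖w‖ = 1) : ‖1 - w‖ ^ 2 = 2 * (1 - w.re) := by
  have h : w.re ^ 2 + w.im ^ 2 = 1 := by
    have := Complex.sq_norm w
    rw [hw, Complex.normSq_apply] at this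
    nlinarith
  rw [Complex.sq_norm, Complex.normSq_apply]
  simp
  nlinarith

lemma norm_one_sub_pow {z : ℂ} (hz : ‖z‖ = 1) (k : ℕ) : ‖1 - z ^ k‖ ≤ k * ‖1 - z‖ := by
  rw [← Dn_mul, norm_mul, mul_comm]
  gcongr
  refine (norm_sum_le _ _).trans ?_
  simp [hz]

variable {z : ℂ} (hz : ‖z‖ = 1)
include hz

lemma qq_succ (n : ℕ) : qq (n + 1) z = qq n z * (1 - qq n z * (4 ^ n * ‖1 - z‖ ^ 2) / 4) := by
  have h1 : ‖1 - z ^ 2 ^ n‖ ^ 2 = ‖1 - z‖ ^ 2 * ‖Dn (2 ^ n) z‖ ^ 2 := by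
    rw [← Dn_mul, norm_mul, mul_pow]
  have h2 := norm_one_add_sq (w := z ^ 2 ^ n) (by simp [hz])
  unfold qq
  rw [pow_succ 2 n, mul_two, Dn_double, norm_mul, mul_pow, h2, h1]
  field_simp
  ring

lemma qq_le_succ (n : ℕ) : qq (n + 1) z ≤ qq n z := by
  rw [qq_succ hz]
  have := qq_nonneg n z
  have h : 0 ≤ qq n z * (4 ^ n * ‖1 - z‖ ^ 2) / 4 := by positivity
  nlinarith

lemma qq_le_one (n : ℕ) : qq n z ≤ 1 := by
  induction n with
  | zero => rw [qq_zero]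
  | succ n ih => exact (qq_le_succ hz n).trans ih

lemma qq_low (n : ℕ) : 1 - qq n z ≤ 4 ^ n * ‖1 - z‖ ^ 2 := by
  have : 1 - qq n z ≤ (4 ^ n - 1) * ‖1 - z‖ ^ 2 := by
    induction n with
    | zero => simp [qq_zero]
    | succ n ih =>
      rw [qq_succ hz]
      have h0 := qq_nonneg n z
      have h1 := qq_le_one hz n
      have h2 : qq n z * qq n z ≤ 1 := by nlinarith
      have h3 : 0 ≤ 4 ^ n * ‖1 - z‖ ^ 2 := by positivity
      rw [pow_succ (4:ℝ)]
      nlinarith [mul_le_mul_of_nonneg_right h2 h3]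
  nlinarith [sq_nonneg ‖1 - z‖]

lemma qq_high' (n : ℕ) : qq n z * (1 + (4 ^ n - 1) * ‖1 - z‖ ^ 2 / 12) ≤ 1 := by
  induction n with
  | zero => simp [qq_zero]
  | succ n ih =>
    rw [qq_succ hz]
    set q := qq n z with hq
    set b := ‖1 - z‖ ^ 2 with hb
    have h0 : 0 ≤ q := qq_nonneg n z
    have hb0 : 0 ≤ b := by positivity
    set X : ℝ := 4 ^ n with hX
    have hX1 : 1 ≤ X := one_le_pow₀ (by norm_num)
    rw [pow_succ, ← hX]
    have hs : 0 ≤ 1 - q * (X * b) / 4 := by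
      have h5 := qq_nonneg (n + 1) z
      rw [qq_succ hz] at h5
      rcases h0.eq_or_lt with h | h
      · rw [← h]; norm_num
      · exact nonneg_of_mul_nonneg_right (by simpa only [← hq, ← hb, ← hX] using h5) h
    have e : q * (1 + (X * 4 - 1) * b / 12) ≤ 1 + q * (X * b) / 4 := by nlinarith
    calc q * (1 - q * (X * b) / 4) * (1 + (X * 4 - 1) * b / 12)
        = (1 - q * (X * b) / 4) * (q * (1 + (X * 4 - 1) * b / 12)) := by ring
      _ ≤ (1 - q * (X * b) / 4) * (1 + q * (X * b) / 4) := mul_le_mul_of_nonneg_left e hs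
      _ ≤ 1 := by nlinarith [sq_nonneg (q * (X * b) / 4)]

lemma qq_high {n : ℕ} (hn : 1 ≤ n) : qq n z * (1 + 4 ^ n * ‖1 - z‖ ^ 2 / 16) ≤ 1 := by
  refine le_trans (mul_le_mul_of_nonneg_left ?_ (qq_nonneg n z)) (qq_high' hz n)
  have : (4:ℝ) ≤ 4 ^ n := by
    calc (4:ℝ) = 4 ^ 1 := by norm_num
      _ ≤ 4 ^ n := pow_le_pow_right₀ (by norm_num) hn
  nlinarith [sq_nonneg ‖1 - z‖]

lemma abs_sR_le (N : ℕ) : |sR N z| ≤ 1 + 2 * ‖Dn N z‖ := by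
  have : sR N z = 1 + 2 * (z * Dn N z).re := by
    rw [sR, Dn, Finset.mul_sum (f := fun k => z ^ k), Complex.re_sum]
    congr 2
    exact Finset.sum_congr rfl fun k _ => by rw [pow_succ']
  rw [this]
  have h1 := Complex.abs_re_le_norm (z * Dn N z)
  rw [norm_mul, hz, one_mul] at h1
  calc _ ≤ |(1:ℝ)| + |2 * (z * Dn N z).re| := abs_add_le _ _
    _ ≤ _ := by rw [abs_mul, abs_one]; norm_num; exact h1

lemma sum_zpow (N : ℕ) : ∑ k ∈ Finset.Icc (-(N:ℤ)) N, z ^ k = (sR N z : ℂ) := by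
  have hz0 : z ≠ 0 := by rintro rfl; simp at hz
  induction N with
  | zero => simp [sR]
  | succ N ih =>
    have e : Finset.Icc (-((N + 1 : ℕ) : ℤ)) ((N + 1 : ℕ) : ℤ) =
        insert (-((N:ℤ) + 1)) (insert ((N:ℤ) + 1) (Finset.Icc (-(N:ℤ)) N)) := by
      ext k; simp only [Finset.mem_insert, Finset.mem_Icc]; push_cast; omega
    rw [e, Finset.sum_insert (by simp only [Finset.mem_insert, Finset.mem_Icc]; omega),
      Finset.sum_insert (by simp only [Finset.mem_Icc]; omega), ih]
    have h1 : z ^ (-((N:ℤ) + 1)) = (starRingEnd ℂ) (z ^ (N + 1)) := by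
      rw [zpow_neg, show ((N:ℤ) + 1) = ((N + 1 : ℕ) : ℤ) by push_cast; ring, zpow_natCast, Complex.inv_def,
        Complex.normSq_eq_norm_sq, norm_pow, hz]
      simp
    have h2 : z ^ ((N:ℤ) + 1) = z ^ (N + 1) := by
      rw [show ((N:ℤ) + 1) = ((N + 1 : ℕ) : ℤ) by push_cast; ring, zpow_natCast]
    rw [h1, h2, ← add_assoc, add_comm ((starRingEnd ℂ) _), Complex.add_conj]
    unfold sR
    rw [Finset.sum_range_succ]
    push_cast
    ring

lemma sum_zpow_neg (N : ℕ) : ∑ k ∈ Finset.Icc (-(N:ℤ)) N, z ^ (-k) = (sR N z : ℂ) := by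
  rw [← sum_zpow hz]
  refine Finset.sum_nbij' (fun k => -k) (fun k => -k) ?_ ?_ ?_ ?_ ?_ <;> simp <;> intros <;> omega

lemma beta_sR (N : ℕ) : ‖1 - z‖ * |sR N z| ≤ 2 := by
  have hz0 : z ≠ 0 := by rintro rfl; simp at hz
  have key : (1 - z) * (sR N z : ℂ) = z ^ (-(N:ℤ)) - z ^ (N + 1) := by
    have h1 : ∀ k : ℕ, ((z ^ (k + 1)).re : ℂ) * 2 = z ^ (k + 1) + (z⁻¹) ^ (k + 1) := by
      intro k
      have : (z⁻¹) ^ (k + 1) = (starRingEnd ℂ) (z ^ (k + 1)) := by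
        rw [inv_pow, Complex.inv_def, Complex.normSq_eq_norm_sq, norm_pow, hz]
        simp
      rw [this, Complex.add_conj]; push_cast; ring
    rw [zpow_neg, zpow_natCast, ← inv_pow]
    induction N with
    | zero => simp [sR]
    | succ N ih =>
      have : (sR (N + 1) z : ℂ) = sR N z + (z ^ (N + 1) + (z⁻¹) ^ (N + 1)) := by
        rw [← h1]
        unfold sR
        rw [Finset.sum_range_succ]
        push_cast
        ring
      rw [this, mul_add, ih]
      have hzz : z * z⁻¹ = 1 := mul_inv_cancel₀ hz0
      rw [pow_succ (z⁻¹) N]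
      linear_combination (-(z⁻¹) ^ N) * hzz
  have h2 : ‖(1 - z) * (sR N z : ℂ)‖ = ‖1 - z‖ * |sR N z| := by
    rw [norm_mul, Complex.norm_real, Real.norm_eq_abs]
  rw [← h2, key]
  refine (norm_sub_le _ _).trans ?_
  simp [hz]
  norm_num

lemma mm_low (n : ℕ) : |1 - mm n z| ≤ 4 ^ n * ‖1 - z‖ ^ 2 := by
  have h1 : 1 - mm n z = (2 * ∑ k ∈ Finset.range (2 ^ n), (1 - (z ^ (k + 1)).re)) / (2 * 2 ^ n + 1) := by
    rw [mm, sR, Finset.sum_sub_distrib]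
    field_simp
    simp
    ring
  have h2 : ∀ k ∈ Finset.range (2 ^ n), 0 ≤ 1 - (z ^ (k + 1)).re ∧
      1 - (z ^ (k + 1)).re ≤ 4 ^ n * ‖1 - z‖ ^ 2 := by
    intro k hk
    have h3 := norm_one_sub_sq (w := z ^ (k + 1)) (by simp [hz])
    have h4 := norm_one_sub_pow hz (k + 1)
    have h5 : ((k + 1 : ℕ) : ℝ) ≤ 2 ^ n := by
      rw [Finset.mem_range] at hk
      exact_mod_cast hk
    have h6 : ‖1 - z ^ (k + 1)‖ ^ 2 ≤ (2 ^ n * ‖1 - z‖) ^ 2 := by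
      gcongr
      exact h4.trans (by gcongr)
    rw [mul_pow, ← pow_mul, mul_comm n, pow_mul] at h6
    norm_num at h6
    have h7 : 0 ≤ ‖1 - z ^ (k + 1)‖ ^ 2 := by positivity
    constructor <;> nlinarith
  have h3 := Finset.sum_nonneg fun k hk => (h2 k hk).1
  have h4 := Finset.sum_le_sum fun k hk => (h2 k hk).2
  rw [h1, abs_of_nonneg (by positivity), div_le_iff₀ (by positivity)]
  simp only [Finset.sum_const, Finset.card_range, nsmul_eq_mul] at h4
  push_cast at h4
  have : 0 ≤ 4 ^ n * ‖1 - z‖ ^ 2 := by positivity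
  nlinarith

lemma mm_high {n : ℕ} (hn : 1 ≤ n) : mm n z ^ 2 * (1 + 4 ^ n * ‖1 - z‖ ^ 2 / 27) ≤ 1 := by
  set N : ℝ := 2 ^ n with hN
  have hN2 : 2 ≤ N := by
    calc (2:ℝ) = 2 ^ 1 := by norm_num
      _ ≤ 2 ^ n := pow_le_pow_right₀ (by norm_num) hn
  have h4 : (4:ℝ) ^ n = N ^ 2 := by rw [hN, ← pow_mul, mul_comm n, pow_mul]; norm_num
  set β := ‖1 - z‖ with hβ
  have hβ0 : 0 ≤ β := norm_nonneg _
  have e : mm n z * (2 * N + 1) = sR (2 ^ n) z := by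
    rw [mm, ← hN]; field_simp
  have e2 : mm n z ^ 2 * (2 * N + 1) ^ 2 = |sR (2 ^ n) z| ^ 2 := by rw [sq_abs, ← e]; ring
  set x : ℝ := 4 ^ n * β ^ 2 with hx
  have hx0 : 0 ≤ x := by positivity
  rcases le_total 2 x with h2 | h2
  · have h3 := beta_sR hz (2 ^ n)
    have h5 : (β * |sR (2 ^ n) z|) ^ 2 ≤ 2 ^ 2 := by gcongr
    have h6 : mm n z ^ 2 * x ≤ 1 := by
      rw [mul_pow, ← e2] at h5
      have : mm n z ^ 2 * x * 4 ≤ 4 := by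
        rw [hx, h4]
        calc mm n z ^ 2 * (N ^ 2 * β ^ 2) * 4 = β ^ 2 * (mm n z ^ 2 * (2 * N) ^ 2) := by ring
          _ ≤ β ^ 2 * (mm n z ^ 2 * (2 * N + 1) ^ 2) := by gcongr; linarith
          _ ≤ 4 := by linarith
      linarith
    nlinarith [sq_nonneg (mm n z)]
  · have h3 := abs_sR_le hz (2 ^ n)
    have h5 := qq_high hz hn
    rw [← hβ, ← hx] at h5
    set q := qq n z with hq
    have q0 : 0 ≤ q := qq_nonneg n z
    have hD : ‖Dn (2 ^ n) z‖ ^ 2 = q * N ^ 2 := by rw [hq, qq, h4]; field_simp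
    set D := ‖Dn (2 ^ n) z‖ with hDd
    have hD0 : 0 ≤ D := norm_nonneg _
    have h6 : |sR (2 ^ n) z| ^ 2 ≤ (1 + 2 * D) ^ 2 := by gcongr
    have h7 : (1 + 2 * D) ^ 2 ≤ (2 * N + 1) * (2 * N * q + 1) := by
      have : 2 * D * N ≤ D ^ 2 + N ^ 2 := by nlinarith [sq_nonneg (D - N)]
      have h8 : (2 * N + 1) * (2 * N * q + 1) = 4 * D ^ 2 + 2 * N * q + 2 * N + 1 := by rw [hD]; ring
      rw [h8]
      have h9 : 4 * D ≤ 2 * N * q + 2 * N := by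
        have : 4 * D * N ≤ (2 * N * q + 2 * N) * N := by nlinarith
        exact le_of_mul_le_mul_right this (by linarith)
      nlinarith
    have h8 : mm n z ^ 2 * (2 * N + 1) ≤ 2 * N * q + 1 := by
      have : mm n z ^ 2 * (2 * N + 1) * (2 * N + 1) ≤ (2 * N * q + 1) * (2 * N + 1) := by nlinarith
      exact le_of_mul_le_mul_right this (by linarith)
    have h9 : q ≤ 1 - x / 18 := by
      by_contra hc
      push Not at hc
      nlinarith
    have h10 : mm n z ^ 2 ≤ 1 - x / 27 := by
      have : mm n z ^ 2 * (2 * N + 1) ≤ (1 - x / 27) * (2 * N + 1) := by nlinarith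
      exact le_of_mul_le_mul_right this (by linarith)
    nlinarith

lemma abs_mm_le (n : ℕ) : |mm n z| ≤ 1 := by
  have h := abs_sR_le hz (2 ^ n)
  have h1 : ‖Dn (2 ^ n) z‖ ≤ 2 ^ n := by
    refine (norm_sum_le _ _).trans ?_
    simp [hz]
  rw [mm, abs_div, abs_of_pos (show (0:ℝ) < 2 * 2 ^ n + 1 by positivity), div_le_one (by positivity)]
  linarith

end
end DF

namespace DF
noncomputable section

section grp
variable {G : Type} [AddCommGroup G] [Fintype G]

lemma parseval (a : AddChar G ℂ → ℂ) :
    ∑ x, ‖∑ ψ : AddChar G ℂ, a ψ * ψ x‖ ^ 2 = Fintype.card G * ∑ ψ, ‖a ψ‖ ^ 2 := by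
  classical
  have key : ((∑ x, ‖∑ ψ : AddChar G ℂ, a ψ * ψ x‖ ^ 2 : ℝ) : ℂ) =
      ((Fintype.card G * ∑ ψ, ‖a ψ‖ ^ 2 : ℝ) : ℂ) := by
    push_cast
    simp only [← Complex.mul_conj']
    simp only [map_sum, map_mul, Finset.sum_mul_sum]
    rw [Finset.sum_comm]
    rw [Finset.mul_sum]
    refine Finset.sum_congr rfl fun ψ _ => ?_
    rw [Finset.sum_comm]
    have h1 : ∀ φ : AddChar G ℂ, ∑ x, a ψ * ψ x * ((starRingEnd ℂ) (a φ) * (starRingEnd ℂ) (φ x)) =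
        a ψ * (starRingEnd ℂ) (a φ) * if ψ - φ = 0 then (Fintype.card G : ℂ) else 0 := by
      intro φ
      rw [← AddChar.sum_eq_ite, Finset.mul_sum]
      refine Finset.sum_congr rfl fun x _ => ?_
      rw [AddChar.sub_apply, AddChar.map_neg_eq_conj]
      ring
    simp only [h1, sub_eq_zero]
    simp
    ring
  exact_mod_cast key

/-- T has real Fourier multiplier m -/
def IsMult (T : (G → ℝ) →ₗ[ℝ] (G → ℝ)) (m : AddChar G ℂ → ℝ) : Prop :=
  ∀ (ψ : AddChar G ℂ) (x : G), cx T ψ x = m ψ * ψ x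

lemma cx_smul (T : (G → ℝ) →ₗ[ℝ] (G → ℝ)) (c : ℂ) (h : G → ℂ) (x : G) :
    cx T (fun y => c * h y) x = c * cx T h x := by
  classical
  rw [cx_expand, cx_expand, Finset.mul_sum]
  exact Finset.sum_congr rfl fun y _ => by ring

lemma cx_real (T : (G → ℝ) →ₗ[ℝ] (G → ℝ)) (f : G → ℝ) (x : G) : cx T (fun y => (f y : ℂ)) x = T f x := by
  apply Complex.ext <;> simp [cx]
  have : (fun _ : G => (0:ℝ)) = 0 := rfl
  rw [this, map_zero]; rfl

lemma IsMult.comp {T S : (G → ℝ) →ₗ[ℝ] (G → ℝ)} {m n : AddChar G ℂ → ℝ} (hT : IsMult T m) (hS : IsMult S n) :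
    IsMult (T ∘ₗ S) (fun ψ => m ψ * n ψ) := by
  intro ψ x
  have h1 : cx (T ∘ₗ S) ψ x = cx T (fun y => cx S ψ y) x := rfl
  rw [h1]
  have h2 : (fun y => cx S ψ y) = fun y => (n ψ : ℂ) * ψ y := funext fun y => hS ψ y
  rw [h2, cx_smul, hT ψ x]
  push_cast; ring

lemma IsMult.sub {T S : (G → ℝ) →ₗ[ℝ] (G → ℝ)} {m n : AddChar G ℂ → ℝ} (hT : IsMult T m) (hS : IsMult S n) :
    IsMult (T - S) (fun ψ => m ψ - n ψ) := by
  intro ψ x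
  have h1 : cx (T - S) ψ x = cx T ψ x - cx S ψ x := by apply Complex.ext <;> simp [cx]
  rw [h1, hT, hS]; push_cast; ring

lemma IsMult.smul {T : (G → ℝ) →ₗ[ℝ] (G → ℝ)} {m : AddChar G ℂ → ℝ} (hT : IsMult T m) (c : ℝ) :
    IsMult (c • T) (fun ψ => c * m ψ) := by
  intro ψ x
  have h1 : cx (c • T) ψ x = c * cx T ψ x := by apply Complex.ext <;> simp [cx]
  rw [h1, hT]; push_cast; ring

lemma isMult_zero : IsMult (0 : (G → ℝ) →ₗ[ℝ] (G → ℝ)) (fun _ => 0) := by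
  intro ψ x
  apply Complex.ext <;> simp [cx]

lemma IsMult.sum {ι : Type*} (s : Finset ι) {T : ι → (G → ℝ) →ₗ[ℝ] (G → ℝ)} {m : ι → AddChar G ℂ → ℝ}
    (hT : ∀ i ∈ s, IsMult (T i) (m i)) : IsMult (∑ i ∈ s, T i) (fun ψ => ∑ i ∈ s, m i ψ) := by
  intro ψ x
  have h1 : cx (∑ i ∈ s, T i) ψ x = ∑ i ∈ s, cx (T i) ψ x := by
    apply Complex.ext <;> simp [cx, LinearMap.sum_apply]
  rw [h1]; push_cast
  rw [Finset.sum_mul]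
  exact Finset.sum_congr rfl fun i hi => hT i hi ψ x

lemma card_pos' : (0:ℝ) < Fintype.card G := by exact_mod_cast Fintype.card_pos

theorem plancherel {T : (G → ℝ) →ₗ[ℝ] (G → ℝ)} {m : AddChar G ℂ → ℝ} (hT : IsMult T m) {A : ℝ} (hA : 0 ≤ A)
    (hm : ∀ ψ, |m ψ| ≤ A) (f : G → ℝ) : nm 2 (T f) ≤ A * nm 2 f := by
  classical
  set a : AddChar G ℂ → ℂ := fun ψ => (AddChar.complexBasis G).repr (fun y => (f y : ℂ)) ψ with ha
  have hf : ∀ x, (f x : ℂ) = ∑ ψ, a ψ * ψ x := by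
    intro x
    have := congrFun ((AddChar.complexBasis G).sum_repr (fun y => (f y : ℂ))) x
    rw [← this]
    simp [ha, Finset.sum_apply]
  have hTf : ∀ x, (T f x : ℂ) = ∑ ψ, (m ψ * a ψ) * ψ x := by
    intro x
    rw [← cx_real, cx_expand]
    simp only [hf, Finset.sum_mul]
    rw [Finset.sum_comm]
    refine Finset.sum_congr rfl fun ψ _ => ?_
    have := hT ψ x
    rw [cx_expand] at this
    rw [mul_comm (m ψ : ℂ), mul_assoc, ← this, Finset.mul_sum]
    exact Finset.sum_congr rfl fun y _ => by ring
  have e1 : ∑ x, f x ^ 2 = Fintype.card G * ∑ ψ, ‖a ψ‖ ^ 2 := by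
    rw [← parseval]
    refine Finset.sum_congr rfl fun x _ => ?_
    rw [← hf, Complex.norm_real, Real.norm_eq_abs, sq_abs]
  have e2 : ∑ x, T f x ^ 2 = Fintype.card G * ∑ ψ, ‖m ψ * a ψ‖ ^ 2 := by
    rw [← parseval]
    refine Finset.sum_congr rfl fun x _ => ?_
    rw [← hTf, Complex.norm_real, Real.norm_eq_abs, sq_abs]
  rw [nm_two, nm_two, e1, e2]
  conv_rhs => rw [← Real.sqrt_sq hA]
  rw [← Real.sqrt_mul (sq_nonneg A)]
  apply Real.sqrt_le_sqrt
  rw [mul_left_comm]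
  refine mul_le_mul_of_nonneg_left ?_ (Nat.cast_nonneg _)
  rw [Finset.mul_sum]
  refine Finset.sum_le_sum fun ψ _ => ?_
  rw [norm_mul, mul_pow, Complex.norm_real, Real.norm_eq_abs]
  exact mul_le_mul_of_nonneg_right (pow_le_pow_left₀ (abs_nonneg _) (hm ψ) 2) (sq_nonneg _)

/-- Averaging an operator over translations. -/
def Av (T : (G → ℝ) →ₗ[ℝ] (G → ℝ)) : (G → ℝ) →ₗ[ℝ] (G → ℝ) where
  toFun f x := (Fintype.card G : ℝ)⁻¹ * ∑ ω, T (fun y => f (y + ω)) (x - ω)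
  map_add' f g := by
    ext x
    have : ∀ ω, T (fun y => f (y + ω) + g (y + ω)) = T (fun y => f (y + ω)) + T (fun y => g (y + ω)) := by
      intro ω; rw [← map_add]; rfl
    simp only [this, Pi.add_apply, Finset.sum_add_distrib, mul_add]
  map_smul' c f := by
    ext x
    have : ∀ ω, T (fun y => c * f (y + ω)) = c • T (fun y => f (y + ω)) := by
      intro ω; rw [← map_smul]; rfl
    simp only [this, Pi.smul_apply, smul_eq_mul, ← Finset.mul_sum, RingHom.id_apply]
    ring

lemma Av_apply (T : (G → ℝ) →ₗ[ℝ] (G → ℝ)) (f : G → ℝ) (x : G) :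
    Av T f x = (Fintype.card G : ℝ)⁻¹ * ∑ ω, T (fun y => f (y + ω)) (x - ω) := rfl

lemma avg_const (c : ℝ) : (Fintype.card G : ℝ)⁻¹ * ∑ _ω : G, c = c := by
  rw [Finset.sum_const, nsmul_eq_mul, Finset.card_univ, ← mul_assoc, inv_mul_cancel₀ card_pos'.ne', one_mul]

/-- Minkowski for averages -/
lemma nm_avg {p : ℝ} (hp : 1 ≤ p) (h : G → G → ℝ) {A : ℝ} (hA : ∀ ω, nm p (h ω) ≤ A) :
    nm p (fun x => (Fintype.card G : ℝ)⁻¹ * ∑ ω, h ω (x - ω)) ≤ A := by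
  have e : (fun x => (Fintype.card G : ℝ)⁻¹ * ∑ ω, h ω (x - ω)) =
      (Fintype.card G : ℝ)⁻¹ • ∑ ω, fun x => h ω (x - ω) := by
    ext x; simp
  rw [e, nm_smul (by linarith), abs_of_pos (inv_pos.mpr card_pos')]
  have : ∀ ω, nm p (fun x => h ω (x - ω)) = nm p (h ω) := fun ω => nm_equiv p (Equiv.subRight ω) (h ω)
  calc _ ≤ (Fintype.card G : ℝ)⁻¹ * ∑ ω : G, A := by
        refine mul_le_mul_of_nonneg_left ?_ (inv_nonneg.mpr card_pos'.le)
        refine (nm_sum_le hp _ _).trans (Finset.sum_le_sum fun ω _ => ?_)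
        rw [this]; exact hA ω
    _ = A := avg_const A

lemma nm_shift (p : ℝ) (f : G → ℝ) (ω : G) : nm p (fun y => f (y + ω)) = nm p f :=
  nm_equiv p (Equiv.addRight ω) f

lemma nm_Av {p : ℝ} (hp : 1 ≤ p) (T : (G → ℝ) →ₗ[ℝ] (G → ℝ)) {A : ℝ} (h : ∀ f, nm p (T f) ≤ A * nm p f)
    (f : G → ℝ) : nm p (Av T f) ≤ A * nm p f :=
  nm_avg hp (fun ω => T (fun y => f (y + ω))) fun ω => by
    have := h (fun y => f (y + ω))
    rwa [nm_shift] at this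

/-- symmetric Markov operators -/
structure Mk (T : (G → ℝ) →ₗ[ℝ] (G → ℝ)) : Prop where
  sym : ∀ f g, ∑ x, T f x * g x = ∑ x, f x * T g x
  pos : ∀ f, (∀ x, 0 ≤ f x) → ∀ x, 0 ≤ T f x
  one : T 1 = 1

lemma Mk.sq_le {T : (G → ℝ) →ₗ[ℝ] (G → ℝ)} (h : Mk T) (f : G → ℝ) (x : G) :
    T f x ^ 2 ≤ T (fun y => f y ^ 2) x := by
  have h1 := h.pos (fun y => (f y - T f x) ^ 2) (fun _ => sq_nonneg _) x
  have h2 : (fun y => (f y - T f x) ^ 2) = (fun y => f y ^ 2) - (2 * T f x) • f + (T f x ^ 2) • (1 : G → ℝ) := by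
    ext y; simp; ring
  rw [h2, map_add, map_sub, map_smul, map_smul, h.one] at h1
  simp at h1
  nlinarith

lemma Mk.mono {T : (G → ℝ) →ₗ[ℝ] (G → ℝ)} (h : Mk T) {f g : G → ℝ} (hfg : ∀ x, f x ≤ g x) (x : G) :
    T f x ≤ T g x := by
  have := h.pos (g - f) (fun x => by simpa using hfg x) x
  rw [map_sub] at this
  simpa using this

lemma Mk.av {T : (G → ℝ) →ₗ[ℝ] (G → ℝ)} (h : Mk T) : Mk (Av T) where
  sym f g := by
    simp only [Av_apply, mul_assoc, Finset.sum_mul, Finset.mul_sum]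
    rw [Finset.sum_comm]
    conv_rhs => rw [Finset.sum_comm]
    refine Finset.sum_congr rfl fun ω _ => ?_
    have := h.sym (fun y => f (y + ω)) (fun y => g (y + ω))
    rw [← Equiv.sum_comp (Equiv.addRight ω), ← Equiv.sum_comp (Equiv.addRight ω)
      (fun x => f x * ((Fintype.card G : ℝ)⁻¹ * T (fun y => g (y + ω)) (x - ω)))]
    simp only [Equiv.coe_addRight, add_sub_cancel_right]
    rw [← Finset.mul_sum, this, Finset.mul_sum]
    exact Finset.sum_congr rfl fun x _ => by ring
  pos f hf x := mul_nonneg (inv_nonneg.mpr card_pos'.le)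
    (Finset.sum_nonneg fun ω _ => h.pos _ (fun y => hf _) _)
  one := by
    ext x
    rw [Av_apply]
    have : ∀ ω : G, T (fun y => (1 : G → ℝ) (y + ω)) (x - ω) = 1 := fun ω => congrFun h.one (x - ω)
    simp only [this]
    rw [avg_const]; rfl

lemma Mk.filt (F : Filt G) (t : ℕ) : Mk (F.E t) := ⟨F.E_sym t, fun _ hf => F.E_nonneg t hf, F.E_one t⟩

lemma isMult_Av (F : Filt G) (t : ℕ) (m : AddChar G ℂ → ℝ)
    (hm : ∀ (ψ : AddChar G ℂ) y, ‖cx (F.E t) ψ y‖ ^ 2 = m ψ) : IsMult (Av (F.E t)) m := by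
  intro ψ x
  have h1 : cx (Av (F.E t)) ψ x = (Fintype.card G : ℂ)⁻¹ * ∑ ω, cx (F.E t) (fun y => ψ (y + ω)) (x - ω) := by
    have hc : (Fintype.card G : ℂ)⁻¹ = (((Fintype.card G : ℝ)⁻¹ : ℝ) : ℂ) := by push_cast; rfl
    rw [hc]
    apply Complex.ext
    · rw [Complex.re_ofReal_mul, Complex.re_sum]; rfl
    · rw [Complex.im_ofReal_mul, Complex.im_sum]; rfl
  have h2 : ∀ ω, cx (F.E t) (fun y => ψ (y + ω)) (x - ω) = ψ ω * cx (F.E t) ψ (x - ω) := by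
    intro ω
    rw [← cx_smul]
    congr 1
    ext y
    rw [AddChar.map_add_eq_mul, mul_comm]
  have h3 : ∑ ω, ψ ω * cx (F.E t) ψ (x - ω) = ψ x * ∑ y, (starRingEnd ℂ) (ψ y) * cx (F.E t) ψ y := by
    rw [← Equiv.sum_comp (Equiv.subLeft x), Finset.mul_sum]
    refine Finset.sum_congr rfl fun y _ => ?_
    have e1 : x - (x - y) = y := by abel
    simp only [Equiv.subLeft_apply, e1]
    rw [sub_eq_add_neg, AddChar.map_add_eq_mul, AddChar.map_neg_eq_conj, mul_assoc]
  have h4 : ∑ y, (starRingEnd ℂ) (ψ y) * cx (F.E t) ψ y = ((∑ y, ‖cx (F.E t) ψ y‖ ^ 2 : ℝ) : ℂ) := by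
    set u : G → ℝ := fun y => (ψ y).re with hu
    set v : G → ℝ := fun y => (ψ y).im with hv
    have hE : ∀ g : G → ℝ, ∑ y, F.E t g y ^ 2 = ∑ y, g y * F.E t g y := by
      intro g
      have := F.E_sym t g (F.E t g)
      rw [F.E_tower1 le_rfl] at this
      rw [← this]
      exact Finset.sum_congr rfl fun y _ => by ring
    have hn : ∀ y, ‖cx (F.E t) ψ y‖ ^ 2 = F.E t u y ^ 2 + F.E t v y ^ 2 := by
      intro y
      rw [Complex.sq_norm, Complex.normSq_apply]
      simp only [cx, hu, hv]
      ring
    simp only [hn, Finset.sum_add_distrib, hE]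
    apply Complex.ext
    · rw [Complex.re_sum, Complex.ofReal_re, ← Finset.sum_add_distrib]
      refine Finset.sum_congr rfl fun y _ => ?_
      simp [cx, hu, hv]
    · rw [Complex.im_sum, Complex.ofReal_im]
      have := F.E_sym t u v
      have e : ∀ y, ((starRingEnd ℂ) (ψ y) * cx (F.E t) ψ y).im = u y * F.E t v y - F.E t u y * v y := by
        intro y
        simp [cx, hu, hv]
        ring
      simp only [e, Finset.sum_sub_distrib, this, sub_self]
  rw [h1]
  simp only [h2]
  rw [h3, h4]
  simp only [hm]
  have hc : (Fintype.card G : ℂ) ≠ 0 := by exact_mod_cast card_pos'.ne'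
  simp
  field_simp

end grp

end
end DF

namespace DF
noncomputable section

section grp
variable {G : Type} [AddCommGroup G] [Fintype G]

/-- the abstract situation: averages M, martingale averages F -/
structure Sys (A : ℝ → ℝ) (B : ℝ → ℝ → ℝ) (G : Type) [AddCommGroup G] [Fintype G] where
  L : ℕ
  F : ℕ → (G → ℝ) →ₗ[ℝ] (G → ℝ)
  M : ℕ → (G → ℝ) →ₗ[ℝ] (G → ℝ)
  q : ℕ → AddChar G ℂ → ℝ
  m : ℕ → AddChar G ℂ → ℝ
  b : AddChar G ℂ → ℝ
  b0 : ∀ ψ, 0 ≤ b ψ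
  mkF : ∀ n, Mk (F n)
  mkM : ∀ n, Mk (M n)
  mulF : ∀ n, n ≤ L → IsMult (F n) (q n)
  mulM : ∀ n, IsMult (M n) (m n)
  F0 : ∀ f, F 0 f = f
  M0 : ∀ f, M 0 f = f
  q00 : ∀ ψ, q 0 ψ = 1
  m00 : ∀ ψ, m 0 ψ = 1
  FL : ∀ f x y, F L f x = F L f y
  q0 : ∀ n ψ, 0 ≤ q n ψ
  q1 : ∀ n ψ, q n ψ ≤ 1
  qs : ∀ n ψ, q (n + 1) ψ ≤ q n ψ
  ql : ∀ n ψ, 1 - q n ψ ≤ 4 ^ n * b ψ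
  qh : ∀ n ψ, 1 ≤ n → q n ψ * (1 + 4 ^ n * b ψ / 27) ≤ 1
  m1 : ∀ n ψ, |m n ψ| ≤ 1
  ml : ∀ n ψ, |1 - m n ψ| ≤ 4 ^ n * b ψ
  mh : ∀ n ψ, 1 ≤ n → m n ψ ^ 2 * (1 + 4 ^ n * b ψ / 27) ≤ 1
  mx : ∀ p, 1 < p → ∀ f, ∃ W : G → ℝ, (∀ n ≤ L, ∀ x, |F n f x| ≤ W x) ∧ nm p W ≤ A p * nm p f
  sg : ∀ p, 1 < p → ∀ ε : ℕ → ℝ, (∀ n, |ε n| ≤ 1) → ∀ f,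
    nm p (fun x => ∑ k ∈ Finset.range L, ε k * (F k f x - F (k + 1) f x)) ≤ A p * nm p f
  lp : ∀ p r, 1 < p → 2 < r → ∀ f, ∃ W : G → ℝ, (∀ x, 0 ≤ W x) ∧ nm p W ≤ B p r * nm p f ∧
    ∀ x (u : ℕ → ℕ), Monotone u → (∀ j, u j ≤ L) → ∀ J, vsum r (fun n => F n f x) u J ^ (1 / r) ≤ W x

lemma filt_max {p q : ℝ} (h : p.HolderConjugate q) (F : Filt G) (L : ℕ) (f : G → ℝ) :
    ∃ W : G → ℝ, (∀ n, ∀ x, |Av (F.E (L - n)) f x| ≤ W x) ∧ nm p W ≤ q * nm p f := by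
  obtain ⟨R, hR⟩ : ∃ R : G → G → ℝ, R = fun ω y => rmax (fun t => F.E t (fun y => f (y + ω)) y) L := ⟨_, rfl⟩
  refine ⟨fun x => (Fintype.card G : ℝ)⁻¹ * ∑ ω, R ω (x - ω), fun n x => ?_, nm_avg h.lt.le R fun ω => ?_⟩
  · rw [Av_apply, abs_mul, abs_of_nonneg (inv_nonneg.mpr card_pos'.le)]
    refine mul_le_mul_of_nonneg_left ?_ (inv_nonneg.mpr card_pos'.le)
    refine (Finset.abs_sum_le_sum_abs _ _).trans (Finset.sum_le_sum fun ω _ => ?_)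
    rw [hR]
    exact abs_le_rmax (fun t => F.E t (fun y => f (y + ω)) (x - ω)) (Nat.sub_le L n)
  · have := doob h F (fun y => f (y + ω)) L
    rw [nm_shift] at this
    rw [hR]
    exact this

lemma tr_rev (F : Filt G) (L : ℕ) (ε : ℕ → ℝ) (g : G → ℝ) (y : G) :
    F.tr (fun t _ => if t = 0 then 0 else ε (L - t)) L g y =
      ∑ k ∈ Finset.range L, ε k * (F.E (L - k) g y - F.E (L - (k + 1)) g y) := by
  rw [F.tr_apply]
  rw [Finset.sum_apply, Finset.sum_range_succ', ← Finset.sum_range_reflect]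
  simp only [Pi.mul_apply]
  rw [if_pos trivial, zero_mul, add_zero]
  refine Finset.sum_congr rfl fun k hk => ?_
  have hk := Finset.mem_range.mp hk
  rw [if_neg (by omega)]
  have e1 : L - (L - 1 - k + 1) = k := by omega
  have e2 : L - k = (L - 1 - k) + 1 := by omega
  have e3 : L - (k + 1) = L - 1 - k := by omega
  rw [e1, e2, e3]
  rfl

lemma filt_sign {p C : ℝ} (hp : 1 < p) (F : Filt G) (L : ℕ)
    (H : ∀ v, F.Pred v → (∀ t x, |v t x| ≤ 1) → ∀ f, nm p (F.tr v L f) ≤ C * nm p f)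
    (ε : ℕ → ℝ) (hε : ∀ n, |ε n| ≤ 1) (f : G → ℝ) :
    nm p (fun x => ∑ k ∈ Finset.range L, ε k * (Av (F.E (L - k)) f x - Av (F.E (L - (k + 1))) f x)) ≤ C * nm p f := by
  have h1 := nm_Av hp.le (F.tr (fun t _ => if t = 0 then 0 else ε (L - t)) L) (H _ ⟨fun _ _ _ => rfl, fun t _ _ _ => rfl⟩
    (fun t x => by
      split_ifs
      · simp
      · exact hε _)) f
  convert h1 using 2
  ext x
  rw [Av_apply]
  simp only [tr_rev, Av_apply]
  rw [Finset.sum_comm, Finset.mul_sum]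
  refine Finset.sum_congr rfl fun k _ => ?_
  rw [← Finset.mul_sum, Finset.sum_sub_distrib]
  ring

lemma vsum_nm (r : ℝ) (a : ℕ → ℝ) (u : ℕ → ℕ) (J : ℕ) :
    vsum r a u J ^ (1 / r) = nm r (fun j : Fin J => a (u (j + 1)) - a (u j)) := by
  rw [vsum, nm, Finset.sum_range]

lemma vsum_add {r : ℝ} (hr : 1 ≤ r) (a b : ℕ → ℝ) (u : ℕ → ℕ) (J : ℕ) :
    vsum r (fun n => a n + b n) u J ^ (1 / r) ≤ vsum r a u J ^ (1 / r) + vsum r b u J ^ (1 / r) := by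
  rw [vsum_nm, vsum_nm, vsum_nm]
  refine le_trans (le_of_eq ?_) (nm_add_le hr _ _)
  congr 1
  ext j
  simp only [Pi.add_apply]
  ring

lemma vsum_avg {r : ℝ} (hr : 1 ≤ r) (a : G → ℕ → ℝ) (u : ℕ → ℕ) (J : ℕ) :
    vsum r (fun n => (Fintype.card G : ℝ)⁻¹ * ∑ ω, a ω n) u J ^ (1 / r) ≤
      (Fintype.card G : ℝ)⁻¹ * ∑ ω, vsum r (a ω) u J ^ (1 / r) := by
  simp only [vsum_nm]
  have e : (fun j : Fin J => (Fintype.card G : ℝ)⁻¹ * ∑ ω, a ω (u (j + 1)) - (Fintype.card G : ℝ)⁻¹ * ∑ ω, a ω (u j))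
      = (Fintype.card G : ℝ)⁻¹ • ∑ ω, fun j : Fin J => a ω (u (j + 1)) - a ω (u j) := by
    ext j
    simp only [Pi.smul_apply, Finset.sum_apply, smul_eq_mul, Finset.sum_sub_distrib]
    ring
  rw [e, nm_smul (by linarith), abs_of_nonneg (inv_nonneg.mpr card_pos'.le)]
  exact mul_le_mul_of_nonneg_left (nm_sum_le hr _ _) (inv_nonneg.mpr card_pos'.le)

lemma vsum_rev (r : ℝ) (a : ℕ → ℝ) (u : ℕ → ℕ) (L J : ℕ) :
    vsum r (fun n => a (L - n)) u J = vsum r a (fun j => L - u (J - j)) J := by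
  unfold vsum
  rw [← Finset.sum_range_reflect]
  refine Finset.sum_congr rfl fun k hk => ?_
  have hk := Finset.mem_range.mp hk
  have e1 : J - 1 - k + 1 = J - k := by omega
  have e2 : J - 1 - k = J - (k + 1) := by omega
  rw [e1, e2, abs_sub_comm]

lemma filt_lep {p r C : ℝ} (hp : 1 < p) (hr : 2 < r) (F : Filt G) (L : ℕ)
    (H : ∀ f : G → ℝ, ∃ W : G → ℝ, (∀ x, 0 ≤ W x) ∧ nm p W ≤ C * nm p f ∧
      ∀ x (u : ℕ → ℕ), Monotone u → (∀ j, u j ≤ L) → ∀ J, vsum r (fun t => F.E t f x) u J ^ (1 / r) ≤ W x)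
    (f : G → ℝ) : ∃ W : G → ℝ, (∀ x, 0 ≤ W x) ∧ nm p W ≤ C * nm p f ∧
      ∀ x (u : ℕ → ℕ), Monotone u → (∀ j, u j ≤ L) → ∀ J, vsum r (fun n => Av (F.E (L - n)) f x) u J ^ (1 / r) ≤ W x := by
  choose W h1 h2 h3 using fun ω : G => H (fun y => f (y + ω))
  refine ⟨fun x => (Fintype.card G : ℝ)⁻¹ * ∑ ω, W ω (x - ω), fun x => ?_, nm_avg hp.le W fun ω => ?_, ?_⟩
  · exact mul_nonneg (inv_nonneg.mpr card_pos'.le) (Finset.sum_nonneg fun ω _ => h1 _ _)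
  · have := h2 ω
    rwa [nm_shift] at this
  · intro x u hu hL J
    simp only [Av_apply]
    refine (vsum_avg (by linarith) (fun ω n => F.E (L - n) (fun y => f (y + ω)) (x - ω)) u J).trans ?_
    refine mul_le_mul_of_nonneg_left (Finset.sum_le_sum fun ω _ => ?_) (inv_nonneg.mpr card_pos'.le)
    rw [vsum_rev r (fun t => F.E t (fun y => f (y + ω)) (x - ω)) u L J]
    refine h3 ω (x - ω) _ (fun i j hij => ?_) (fun j => Nat.sub_le _ _) J
    exact Nat.sub_le_sub_left (hu (Nat.sub_le_sub_left hij J)) L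

end grp

section torus

variable {d L : ℕ}

/-- the discrete torus -/
abbrev Tor (d L : ℕ) : Type := Fin d → ZMod (2 ^ L)

/-- dyadic filtration -/
def dy (d L : ℕ) : Filt (Tor d L) where
  r t x y := ∀ j, (x j).val / 2 ^ (L - t) = (y j).val / 2 ^ (L - t)
  eqv t := ⟨fun _ _ => rfl, fun h j => (h j).symm, fun h h' j => (h j).trans (h' j)⟩
  mono t x y h j := by
    have := h j
    have e : (2:ℕ) ^ (L - t) = 2 ^ (L - (t + 1)) * 2 ^ (L - t - (L - (t + 1))) := by
      rw [← pow_add]; congr 1; omega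
    rw [e, ← Nat.div_div_eq_div_mul, ← Nat.div_div_eq_div_mul, this]

/-- the basic frequency -/
def zz (ψ : AddChar (Tor d L) ℂ) (j : Fin d) : ℂ := ψ (Pi.single j 1)

lemma norm_zz (ψ : AddChar (Tor d L) ℂ) (j : Fin d) : ‖zz ψ j‖ = 1 := AddChar.norm_apply ψ _

lemma char_pi (ψ : AddChar (Tor d L) ℂ) (k : Fin d → ℤ) :
    ψ (fun j => (k j : ZMod (2 ^ L))) = ∏ j, zz ψ j ^ (k j) := by
  have e : (fun j => (k j : ZMod (2 ^ L))) = ∑ j, k j • (Pi.single j 1 : Tor d L) := by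
    ext i
    simp [Finset.sum_apply, Pi.single_apply]
  have e2 : ∀ s : Finset (Fin d), ψ (∑ j ∈ s, k j • (Pi.single j 1 : Tor d L)) = ∏ j ∈ s, ψ (k j • Pi.single j 1) := by
    intro s
    induction s using Finset.induction_on with
    | empty => simp
    | insert a s ha ih => rw [Finset.sum_insert ha, Finset.prod_insert ha, AddChar.map_add_eq_mul, ih]
  rw [e, e2]
  exact Finset.prod_congr rfl fun j _ => AddChar.map_zsmul_eq_zpow ψ _ _

open Classical in
lemma class_sum {n : ℕ} (hn : n ≤ L) (x : Tor d L) (g : Tor d L → ℂ) :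
    (∑ y : Tor d L, if ∀ j, (x j).val / 2 ^ n = (y j).val / 2 ^ n then g y else 0) =
    ∑ k ∈ Fintype.piFinset (fun _ : Fin d => Finset.range (2 ^ n)),
      g (fun j => (((x j).val / 2 ^ n * 2 ^ n + k j : ℕ) : ZMod (2 ^ L))) := by
  have hlt : ∀ (k : ℕ) (j : Fin d), k < 2 ^ n → (x j).val / 2 ^ n * 2 ^ n + k < 2 ^ L := by
    intro k j hk
    have h1 := ZMod.val_lt (x j)
    have h2 : (x j).val / 2 ^ n < 2 ^ (L - n) := by
      rw [Nat.div_lt_iff_lt_mul (by positivity), ← pow_add]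
      rwa [Nat.sub_add_cancel hn]
    have h3 : (2:ℕ) ^ L = 2 ^ (L - n) * 2 ^ n := by rw [← pow_add, Nat.sub_add_cancel hn]
    refine lt_of_lt_of_eq ?_ h3.symm
    calc (x j).val / 2 ^ n * 2 ^ n + k < ((x j).val / 2 ^ n + 1) * 2 ^ n := by rw [add_mul]; omega
      _ ≤ _ := Nat.mul_le_mul_right _ h2
  rw [← Finset.sum_filter]
  refine Finset.sum_nbij' (fun y j => (y j).val % 2 ^ n)
    (fun k j => (((x j).val / 2 ^ n * 2 ^ n + k j : ℕ) : ZMod (2 ^ L))) ?_ ?_ ?_ ?_ ?_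
  · intro y _
    rw [Fintype.mem_piFinset]
    exact fun j => Finset.mem_range.mpr (Nat.mod_lt _ (by positivity))
  · intro k hk
    rw [Fintype.mem_piFinset] at hk
    rw [Finset.mem_filter]
    refine ⟨Finset.mem_univ _, fun j => ?_⟩
    have hk := Finset.mem_range.mp (hk j)
    rw [ZMod.val_cast_of_lt (hlt _ j hk), Nat.mul_comm, Nat.mul_add_div (by positivity), Nat.div_eq_of_lt hk, add_zero]
  · intro y hy
    have hy := (Finset.mem_filter.mp hy).2
    ext j
    simp only [hy j]
    rw [Nat.div_add_mod', ZMod.natCast_zmod_val]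
  · intro k hk
    rw [Fintype.mem_piFinset] at hk
    ext j
    have hk := Finset.mem_range.mp (hk j)
    simp only
    rw [ZMod.val_cast_of_lt (hlt _ j hk), Nat.mul_comm, Nat.mul_add_mod, Nat.mod_eq_of_lt hk]
  · intro y hy
    have hy := (Finset.mem_filter.mp hy).2
    congr 1
    ext j
    simp only [hy j]
    rw [Nat.div_add_mod', ZMod.natCast_zmod_val]

lemma norm_cxE {n : ℕ} (hn : n ≤ L) (ψ : AddChar (Tor d L) ℂ) (x : Tor d L) :
    ‖cx ((dy d L).E (L - n)) ψ x‖ ^ 2 = ∏ j, qq n (zz ψ j) := by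
  classical
  have hLn : L - (L - n) = n := by omega
  have hc : ((dy d L).c (L - n) x : ℂ) = ((2:ℂ) ^ n) ^ d := by
    have := class_sum hn x (fun _ => 1)
    rw [Filt.c]
    simp only [dy, hLn]
    simp only [Complex.ofReal_sum, apply_ite Complex.ofReal, Complex.ofReal_one, Complex.ofReal_zero]
    rw [this]
    simp
  have h1 : cx ((dy d L).E (L - n)) ψ x =
      (∑ y : Tor d L, if ∀ j, (x j).val / 2 ^ n = (y j).val / 2 ^ n then ψ y else 0) / ((dy d L).c (L - n) x : ℂ) := by
    have hr : ∀ y, (dy d L).r (L - n) x y ↔ ∀ j, (x j).val / 2 ^ n = (y j).val / 2 ^ n := by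
      intro y; simp only [dy, hLn]
    apply Complex.ext
    · simp only [cx, Filt.E_apply, Complex.div_ofReal_re, Complex.re_sum, hr]
      congr 1
      exact Finset.sum_congr rfl fun y _ => by split_ifs <;> simp
    · simp only [cx, Filt.E_apply, Complex.div_ofReal_im, Complex.im_sum, hr]
      congr 1
      exact Finset.sum_congr rfl fun y _ => by split_ifs <;> simp
  rw [h1, hc, class_sum hn]
  have h2 : ∀ k : Fin d → ℕ, ψ (fun j => (((x j).val / 2 ^ n * 2 ^ n + k j : ℕ) : ZMod (2 ^ L))) =
      ψ (fun j => (((x j).val / 2 ^ n * 2 ^ n : ℕ) : ZMod (2 ^ L))) * ∏ j, zz ψ j ^ k j := by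
    intro k
    have := char_pi ψ (fun j => (k j : ℤ))
    simp only [zpow_natCast] at this
    rw [← this, ← AddChar.map_add_eq_mul]
    congr 1
    ext j
    simp
  simp only [h2]
  rw [← Finset.mul_sum, ← Finset.prod_univ_sum (fun _ : Fin d => Finset.range (2 ^ n)) (fun j k => zz ψ j ^ k)]
  rw [norm_div, norm_mul, AddChar.norm_apply, one_mul, norm_prod, div_pow, ← Finset.prod_pow]
  simp only [qq, Dn]
  rw [Finset.prod_div_distrib]
  congr 1
  simp only [Finset.prod_const, Finset.card_univ, Fintype.card_fin, norm_pow, Complex.norm_ofNat]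
  rw [← pow_mul, ← pow_mul, ← pow_mul, show (4:ℝ) = 2 ^ 2 by norm_num, ← pow_mul]
  congr 1; ring

/-- cube averages on the torus -/
def Mt (d L n : ℕ) : (Tor d L → ℝ) →ₗ[ℝ] (Tor d L → ℝ) where
  toFun f x := ((2 * 2 ^ n + 1 : ℝ) ^ d)⁻¹ * ∑ y ∈ Finset.Icc (fun _ => -2 ^ n : Fin d → ℤ) (fun _ => 2 ^ n),
    f (x - fun j => (y j : ZMod (2 ^ L)))
  map_add' f g := by
    ext x
    simp only [Pi.add_apply, Finset.sum_add_distrib, mul_add]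
  map_smul' c f := by
    ext x
    simp only [Pi.smul_apply, smul_eq_mul, ← Finset.mul_sum, RingHom.id_apply]
    ring

lemma Mt_apply (n : ℕ) (f : Tor d L → ℝ) (x : Tor d L) : Mt d L n f x = ((2 * 2 ^ n + 1 : ℝ) ^ d)⁻¹ *
    ∑ y ∈ Finset.Icc (fun _ => -2 ^ n : Fin d → ℤ) (fun _ => 2 ^ n), f (x - fun j => (y j : ZMod (2 ^ L))) := rfl

lemma mk_Mt (n : ℕ) : Mk (Mt d L n) where
  sym f g := by
    simp only [Mt_apply, Finset.mul_sum, Finset.sum_mul]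
    rw [Finset.sum_comm]
    conv_rhs => rw [Finset.sum_comm]
    refine Finset.sum_nbij' (fun y => -y) (fun y => -y) ?_ ?_ ?_ ?_ ?_
    · intro y hy
      rw [Finset.mem_Icc] at hy ⊢
      exact ⟨fun j => neg_le_neg (hy.2 j), fun j => by have := hy.1 j; simp only [Pi.neg_apply]; linarith⟩
    · intro y hy
      rw [Finset.mem_Icc] at hy ⊢
      exact ⟨fun j => neg_le_neg (hy.2 j), fun j => by have := hy.1 j; simp only [Pi.neg_apply]; linarith⟩
    · intro y _; simp
    · intro y _; simp
    · intro y _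
      rw [← Equiv.sum_comp (Equiv.addRight (fun j => (y j : ZMod (2 ^ L))))]
      refine Finset.sum_congr rfl fun x _ => ?_
      have e1 : (x + fun j => (y j : ZMod (2 ^ L))) - (fun j => (y j : ZMod (2 ^ L))) = x := add_sub_cancel_right _ _
      have e2 : x - (fun j => ((-y) j : ZMod (2 ^ L))) = x + fun j => (y j : ZMod (2 ^ L)) := by
        ext j; simp
      simp only [Equiv.coe_addRight, e1, e2]
      ring
  pos f hf x := mul_nonneg (by positivity) (Finset.sum_nonneg fun y _ => hf _)
  one := by
    ext x
    rw [Mt_apply]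
    simp only [Pi.one_apply, Finset.sum_const, nsmul_eq_mul, mul_one, Pi.card_Icc, Int.card_Icc,
      Finset.prod_const, Finset.card_univ, Fintype.card_fin]
    have : ((2:ℤ) ^ n + 1 - -2 ^ n).toNat = 2 * 2 ^ n + 1 := by
      have : ((2:ℤ) ^ n + 1 - -2 ^ n) = ((2 * 2 ^ n + 1 : ℕ) : ℤ) := by push_cast; ring
      rw [this, Int.toNat_natCast]
    rw [this]
    push_cast
    exact inv_mul_cancel₀ (by positivity)

lemma mul_Mt (n : ℕ) : IsMult (Mt d L n) (fun ψ => ∏ j, mm n (zz ψ j)) := by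
  intro ψ x
  have h1 : cx (Mt d L n) ψ x = (((2 * 2 ^ n + 1 : ℝ) ^ d : ℝ) : ℂ)⁻¹ *
      ∑ y ∈ Finset.Icc (fun _ => -2 ^ n : Fin d → ℤ) (fun _ => 2 ^ n), ψ (x - fun j => (y j : ZMod (2 ^ L))) := by
    rw [← Complex.ofReal_inv]
    apply Complex.ext
    · rw [Complex.re_ofReal_mul, Complex.re_sum]; rfl
    · rw [Complex.im_ofReal_mul, Complex.im_sum]; rfl
  have h2 : ∀ y : Fin d → ℤ, ψ (x - fun j => (y j : ZMod (2 ^ L))) = ψ x * ∏ j, zz ψ j ^ (-(y j)) := by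
    intro y
    rw [← char_pi ψ (fun j => -(y j)), ← AddChar.map_add_eq_mul]
    congr 1
    ext j
    simp [sub_eq_add_neg]
  rw [h1]
  simp only [h2]
  rw [← Finset.mul_sum, Pi.Icc_eq,
    ← Finset.prod_univ_sum (fun _ : Fin d => Finset.Icc (-2 ^ n : ℤ) (2 ^ n)) (fun j k => zz ψ j ^ (-k))]
  have h3 : ∀ j, ∑ k ∈ Finset.Icc (-2 ^ n : ℤ) (2 ^ n), zz ψ j ^ (-k) = (sR (2 ^ n) (zz ψ j) : ℂ) := by
    intro j
    have := sum_zpow_neg (norm_zz ψ j) (2 ^ n)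
    push_cast at this
    exact this
  simp only [h3, mm]
  push_cast
  rw [Finset.prod_div_distrib]
  simp
  ring

end torus
end
end DF

namespace DF
noncomputable section

lemma prod_low {ι : Type*} (s : Finset ι) (a : ι → ℝ) (h : ∀ i, |a i| ≤ 1) :
    |1 - ∏ i ∈ s, a i| ≤ ∑ i ∈ s, |1 - a i| ∧ |∏ i ∈ s, a i| ≤ 1 := by
  classical
  induction s using Finset.induction_on with
  | empty => simp
  | insert i s hi ih =>
    rw [Finset.prod_insert hi, Finset.sum_insert hi]
    refine ⟨?_, by rw [abs_mul]; exact mul_le_one₀ (h i) (abs_nonneg _) ih.2⟩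
    have e : 1 - a i * ∏ j ∈ s, a j = (1 - a i) + a i * (1 - ∏ j ∈ s, a j) := by ring
    rw [e]
    refine (abs_add_le _ _).trans ?_
    rw [abs_mul]
    have := mul_le_mul_of_nonneg_right (h i) (abs_nonneg (1 - ∏ j ∈ s, a j))
    linarith [ih.1]

lemma prod_high {ι : Type*} (s : Finset ι) (a c : ι → ℝ) (h : ∀ i, 0 ≤ a i) (hc : ∀ i, 0 ≤ c i)
    (h1 : ∀ i, a i * (1 + c i) ≤ 1) : (∏ i ∈ s, a i) * (1 + ∑ i ∈ s, c i) ≤ 1 := by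
  classical
  induction s using Finset.induction_on with
  | empty => simp
  | insert i s hi ih =>
    rw [Finset.prod_insert hi, Finset.sum_insert hi]
    have hP : 0 ≤ ∏ i ∈ s, a i := Finset.prod_nonneg fun i _ => h i
    have hS : 0 ≤ ∑ i ∈ s, c i := Finset.sum_nonneg fun i _ => hc i
    have h2 : a i * (1 + c i) * ((∏ i ∈ s, a i) * (1 + ∑ i ∈ s, c i)) ≤ 1 :=
      mul_le_one₀ (h1 i) (by positivity) ih
    have h3 : 0 ≤ a i * (∏ i ∈ s, a i) * (c i * ∑ i ∈ s, c i) :=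
      mul_nonneg (mul_nonneg (h i) hP) (mul_nonneg (hc i) hS)
    nlinarith

theorem tor_sys : ∃ (A : ℝ → ℝ) (B : ℝ → ℝ → ℝ), (∀ p, 0 ≤ A p) ∧ ∀ d L : ℕ, ∃ S : Sys A B (Tor d L),
    S.L = L ∧ ∀ n, 1 ≤ n → S.M n = Mt d L n := by
  choose C1 h1 h1' using fun p (hp : 1 < p) => tr_bound hp
  choose C2 h2 h2' using fun p r (hp : 1 < p) (hr : 2 < r) => lepingle hp hr
  refine ⟨fun p => if hp : 1 < p then max (p.conjExponent) (C1 p hp) else 0,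
    fun p r => if h : 1 < p ∧ 2 < r then C2 p r h.1 h.2 else 0, fun p => ?_, fun d L => ?_⟩
  · dsimp only
    split_ifs with hp
    · exact le_max_of_le_right (h1 p hp).le
    · exact le_rfl
  have hz := fun (ψ : AddChar (Tor d L) ℂ) j => norm_zz ψ j
  have hqa : ∀ n (ψ : AddChar (Tor d L) ℂ) j, |qq n (zz ψ j)| ≤ 1 := fun n ψ j => by
    rw [abs_of_nonneg (qq_nonneg n _)]; exact qq_le_one (hz ψ j) n
  have hEL : ∀ f : Tor d L → ℝ, ∀ x y, (dy d L).E 0 f x = (dy d L).E 0 f y := by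
    intro f x y
    refine (dy d L).E_meas 0 f x y fun j => ?_
    rw [Nat.sub_zero, Nat.div_eq_of_lt (ZMod.val_lt _), Nat.div_eq_of_lt (ZMod.val_lt _)]
  refine ⟨{ L := L, F := fun n => Av ((dy d L).E (L - n)), M := fun n => if n = 0 then LinearMap.id else Mt d L n,
            q := fun n ψ => ∏ j, qq n (zz ψ j), m := fun n ψ => if n = 0 then 1 else ∏ j, mm n (zz ψ j),
            b := fun ψ => ∑ j, ‖1 - zz ψ j‖ ^ 2, b0 := ?_, mkF := ?_, mkM := ?_, mulF := ?_, mulM := ?_,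
            F0 := ?_, M0 := ?_, q00 := ?_, m00 := ?_, FL := ?_, q0 := ?_, q1 := ?_, qs := ?_, ql := ?_, qh := ?_, m1 := ?_, ml := ?_, mh := ?_,
            mx := ?_, sg := ?_, lp := ?_ }, rfl, fun n hn => if_neg (by omega)⟩
  · exact fun ψ => Finset.sum_nonneg fun j _ => sq_nonneg _
  · exact fun n => (Mk.filt _ _).av
  · intro n
    split_ifs
    · exact ⟨fun f g => rfl, fun f hf => hf, rfl⟩
    · exact mk_Mt n
  · exact fun n hn => isMult_Av _ _ _ fun ψ x => norm_cxE hn ψ x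
  · intro n
    split_ifs with h
    · intro ψ x
      simp [h, cx]
    · intro ψ x
      simp only [h, if_false]
      exact mul_Mt n ψ x
  · intro f
    have hid : ∀ g : Tor d L → ℝ, (dy d L).E L g = g := by
      intro g
      refine (dy d L).E_of_meas fun x y hxy => ?_
      congr 1
      ext j
      have := hxy j
      rw [Nat.sub_self, pow_zero, Nat.div_one, Nat.div_one] at this
      exact ZMod.val_injective _ this
    ext x
    rw [Av_apply, Nat.sub_zero]
    simp only [hid, sub_add_cancel]
    exact avg_const _
  · exact fun f => by simp
  · exact fun ψ => Finset.prod_eq_one fun j _ => qq_zero _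
  · exact fun ψ => if_pos rfl
  · intro f x y
    rw [Av_apply, Av_apply, Nat.sub_self]
    congr 1
    exact Finset.sum_congr rfl fun ω _ => hEL _ _ _
  · exact fun n ψ => Finset.prod_nonneg fun j _ => qq_nonneg _ _
  · exact fun n ψ => Finset.prod_le_one (fun j _ => qq_nonneg _ _) fun j _ => qq_le_one (hz ψ j) n
  · exact fun n ψ => Finset.prod_le_prod (fun j _ => qq_nonneg _ _) fun j _ => qq_le_succ (hz ψ j) n
  · intro n ψ
    refine (le_abs_self _).trans (((prod_low _ _ (hqa n ψ)).1).trans ?_)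
    rw [Finset.mul_sum]
    refine Finset.sum_le_sum fun j _ => ?_
    rw [abs_of_nonneg (by linarith [qq_le_one (hz ψ j) n])]
    exact qq_low (hz ψ j) n
  · intro n ψ hn
    rw [Finset.mul_sum, Finset.sum_div]
    refine prod_high _ _ _ (fun j => qq_nonneg _ _) (fun j => by positivity) fun j => ?_
    refine le_trans ?_ (qq_high (hz ψ j) hn)
    refine mul_le_mul_of_nonneg_left ?_ (qq_nonneg _ _)
    have : 0 ≤ (4:ℝ) ^ n * ‖1 - zz ψ j‖ ^ 2 := by positivity
    linarith
  · intro n ψ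
    split_ifs
    · simp
    · exact (prod_low _ _ fun j => abs_mm_le (hz ψ j) n).2
  · intro n ψ
    split_ifs
    · rw [sub_self, abs_zero]; positivity
    refine ((prod_low _ _ fun j => abs_mm_le (hz ψ j) n).1).trans ?_
    rw [Finset.mul_sum]
    exact Finset.sum_le_sum fun j _ => mm_low (hz ψ j) n
  · intro n ψ hn
    rw [if_neg (by omega), Finset.mul_sum, Finset.sum_div, ← Finset.prod_pow]
    exact prod_high _ _ _ (fun j => sq_nonneg _) (fun j => by positivity) fun j => mm_high (hz ψ j) hn
  · intro p hp f
    obtain ⟨W, hW, hW'⟩ := filt_max (Real.HolderConjugate.conjExponent hp) (dy d L) L f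
    refine ⟨W, fun n _ => hW n, hW'.trans ?_⟩
    rw [dif_pos hp]
    exact mul_le_mul_of_nonneg_right (le_max_left _ _) (nm_nonneg _ _)
  · intro p hp ε hε f
    rw [dif_pos hp]
    refine (filt_sign hp (dy d L) L (fun v hv hv' f => h1' p hp _ _ L v hv hv' f) ε hε f).trans ?_
    exact mul_le_mul_of_nonneg_right (le_max_right _ _) (nm_nonneg _ _)
  · intro p r hp hr f
    rw [dif_pos ⟨hp, hr⟩]
    exact filt_lep hp hr (dy d L) L (fun f => h2' p r hp hr _ _ L f) f

end
end DF

namespace DF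
noncomputable section

lemma shift_le {L : ℕ} (g : ℤ → ℝ) (h0 : ∀ k, 0 ≤ g k) (h1 : ∀ k : ℤ, ¬ (0 ≤ k ∧ k < L) → g k = 0) (i : ℤ) :
    ∑ n ∈ Finset.range L, g (n + i) ≤ ∑ k ∈ Finset.range L, g k := by
  classical
  have e1 : ∑ n ∈ Finset.range L, g (n + i) = ∑ z ∈ (Finset.range L).image (fun n : ℕ => (n : ℤ) + i), g z := by
    rw [Finset.sum_image]
    intro a _ b _ h
    simpa using h
  have e2 : ∑ k ∈ Finset.range L, g k = ∑ z ∈ (Finset.range L).image (fun n : ℕ => (n : ℤ)), g z := by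
    rw [Finset.sum_image]
    intro a _ b _ h
    simpa using h
  rw [e1, e2]
  set U := (Finset.range L).image (fun n : ℕ => (n : ℤ) + i)
  set V := (Finset.range L).image (fun n : ℕ => (n : ℤ)) with hV
  have : ∑ z ∈ V, g z = ∑ z ∈ U ∪ V, g z := by
    refine Finset.sum_subset Finset.subset_union_right fun z _ hz => h1 z fun h => hz ?_
    rw [hV, Finset.mem_image]
    exact ⟨z.toNat, Finset.mem_range.mpr (by omega), by omega⟩
  rw [this]
  exact Finset.sum_le_sum_of_subset_of_nonneg Finset.subset_union_left fun z _ _ => h0 z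

lemma shift_eq {V : Type*} [AddCommMonoid V] {L n : ℕ} (hn : n < L) (g : ℤ → V)
    (h1 : ∀ k : ℤ, ¬ (0 ≤ k ∧ k < L) → g k = 0) :
    ∑ i ∈ Finset.Icc (-(L:ℤ)) L, g (n + i) = ∑ k ∈ Finset.range L, g k := by
  classical
  have e1 : ∑ i ∈ Finset.Icc (-(L:ℤ)) L, g (n + i) = ∑ z ∈ (Finset.Icc (-(L:ℤ)) L).image (fun i => (n : ℤ) + i), g z := by
    rw [Finset.sum_image]
    intro a _ b _ h
    simpa using h
  have e2 : ∑ k ∈ Finset.range L, g k = ∑ z ∈ (Finset.range L).image (fun n : ℕ => (n : ℤ)), g z := by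
    rw [Finset.sum_image]
    intro a _ b _ h
    simpa using h
  rw [e1, e2]
  symm
  refine Finset.sum_subset ?_ fun z _ hz => h1 z fun h => hz ?_
  · intro z hz
    rw [Finset.mem_image] at hz ⊢
    obtain ⟨k, hk, rfl⟩ := hz
    have := Finset.mem_range.mp hk
    exact ⟨k - n, by rw [Finset.mem_Icc]; constructor <;> omega, by ring⟩
  · rw [Finset.mem_image]
    exact ⟨z.toNat, Finset.mem_range.mpr (by omega), by omega⟩

lemma le_of_sq_bd {x y : ℝ} (hx : 0 ≤ x) (hx1 : x ≤ 1) (hy : 0 ≤ y) (h : x ≤ y ^ 2) : x ≤ y := by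
  by_contra hc
  push Not at hc
  nlinarith

lemma geo_sum {s : ℝ} (h0 : 0 < s) (h1 : s < 1) (L : ℕ) :
    ∑ i ∈ Finset.Icc (-(L:ℤ)) L, s ^ i.natAbs ≤ 2 / (1 - s) := by
  classical
  have h2 : ∀ N, ∑ n ∈ Finset.range N, s ^ n ≤ 1 / (1 - s) := by
    intro N
    rw [geom_sum_eq h1.ne, one_div, ← neg_div_neg_eq, neg_sub, neg_sub, div_eq_mul_inv]
    have : 0 < (1 - s)⁻¹ := inv_pos.mpr (by linarith)
    have hp : 0 < s ^ N := by positivity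
    nlinarith
  have hsub : Finset.Icc (-(L:ℤ)) L ⊆ (Finset.range (L + 1)).image (fun n : ℕ => (n : ℤ)) ∪
      (Finset.range (L + 1)).image (fun n : ℕ => -(n : ℤ)) := by
    intro z hz
    rw [Finset.mem_Icc] at hz
    rw [Finset.mem_union, Finset.mem_image, Finset.mem_image]
    rcases le_total 0 z with h | h
    · exact Or.inl ⟨z.toNat, Finset.mem_range.mpr (by omega), by omega⟩
    · exact Or.inr ⟨(-z).toNat, Finset.mem_range.mpr (by omega), by omega⟩
  refine (Finset.sum_le_sum_of_subset_of_nonneg hsub fun _ _ _ => by positivity).trans ?_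
  have hu := Finset.sum_union_inter (s₁ := (Finset.range (L + 1)).image (fun n : ℕ => (n : ℤ)))
    (s₂ := (Finset.range (L + 1)).image (fun n : ℕ => -(n : ℤ))) (f := fun i : ℤ => s ^ i.natAbs)
  have hi : 0 ≤ ∑ i ∈ (Finset.range (L + 1)).image (fun n : ℕ => (n : ℤ)) ∩
    (Finset.range (L + 1)).image (fun n : ℕ => -(n : ℤ)), s ^ i.natAbs := Finset.sum_nonneg fun _ _ => by positivity
  rw [Finset.sum_image (by intro a _ b _ h; simpa using h), Finset.sum_image (by intro a _ b _ h; simpa using h)] at hu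
  simp only [Int.natAbs_natCast, Int.natAbs_neg] at hu
  have := h2 (L + 1)
  have e : 2 / (1 - s) = 1 / (1 - s) + 1 / (1 - s) := by ring
  linarith

section sys
variable {A : ℝ → ℝ} {B : ℝ → ℝ → ℝ} {G : Type} [AddCommGroup G] [Fintype G] (S : Sys A B G)
namespace Sys

/-- difference to martingale -/
def T (n : ℕ) : (G → ℝ) →ₗ[ℝ] (G → ℝ) := S.M n - S.F n

/-- Littlewood-Paley pieces -/
def D (k : ℤ) : (G → ℝ) →ₗ[ℝ] (G → ℝ) :=
  if 0 ≤ k ∧ k < S.L then S.F k.toNat - S.F (k.toNat + 1) else 0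

/-- multipliers -/
def t (n : ℕ) (ψ : AddChar G ℂ) : ℝ := S.m n ψ - S.q n ψ

/-- multipliers -/
def dl (k : ℤ) (ψ : AddChar G ℂ) : ℝ :=
  if 0 ≤ k ∧ k < S.L then S.q k.toNat ψ - S.q (k.toNat + 1) ψ else 0

/-- pieces -/
def O (ε : ℕ → ℝ) (i j : ℤ) : (G → ℝ) →ₗ[ℝ] (G → ℝ) :=
  ∑ n ∈ Finset.range S.L, ε n • (S.D (n + i) ∘ₗ S.T n ∘ₗ S.D (n + j))

/-- full operator -/
def R (ε : ℕ → ℝ) : (G → ℝ) →ₗ[ℝ] (G → ℝ) := ∑ n ∈ Finset.range S.L, ε n • S.T n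

lemma D_nat {k : ℕ} (h : k < S.L) : S.D k = S.F k - S.F (k + 1) := by
  rw [D, if_pos ⟨by omega, by omega⟩, Int.toNat_natCast]

lemma dl_nonneg (k : ℤ) (ψ : AddChar G ℂ) : 0 ≤ S.dl k ψ := by
  unfold dl; split_ifs
  · linarith [S.qs k.toNat ψ]
  · rfl

lemma sum_dl (ψ : AddChar G ℂ) (i : ℤ) : ∑ n ∈ Finset.range S.L, S.dl (n + i) ψ ≤ 1 := by
  refine (shift_le (fun k => S.dl k ψ) (fun k => S.dl_nonneg k ψ) (fun k hk => if_neg hk) i).trans ?_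
  have : ∑ k ∈ Finset.range S.L, S.dl k ψ = ∑ k ∈ Finset.range S.L, (S.q k ψ - S.q (k + 1) ψ) := by
    refine Finset.sum_congr rfl fun k hk => ?_
    have := Finset.mem_range.mp hk
    rw [dl, if_pos ⟨by omega, by omega⟩, Int.toNat_natCast]
  rw [this, Finset.sum_range_sub']
  linarith [S.q0 S.L ψ, S.q1 0 ψ]

lemma dl_t_nat (k n : ℕ) (hn : 1 ≤ n) (hk : k < S.L) (ψ : AddChar G ℂ) :
    S.dl k ψ * |S.t n ψ| * 2 ^ ((k : ℤ) - n).natAbs ≤ 18 := by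
  set s := Real.sqrt (S.b ψ) with hs
  have s0 : 0 ≤ s := Real.sqrt_nonneg _
  have hb : S.b ψ = s ^ 2 := (Real.sq_sqrt (S.b0 ψ)).symm
  have h4 : ∀ l : ℕ, (4:ℝ) ^ l * S.b ψ = (2 ^ l * s) ^ 2 := by
    intro l; rw [hb, mul_pow, ← pow_mul, mul_comm l 2, pow_mul]; norm_num
  have hd : S.dl k ψ = S.q k ψ - S.q (k + 1) ψ := by
    rw [dl, if_pos ⟨by omega, by omega⟩, Int.toNat_natCast]
  have hd0 := S.dl_nonneg k ψ
  have hd1 : S.dl k ψ ≤ 2 * (2 ^ k * s) := by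
    have h1 := S.ql (k + 1) ψ
    rw [h4, pow_succ (2:ℝ) k] at h1
    have h2 := S.q1 k ψ
    have h3 := S.q0 (k + 1) ψ
    refine le_of_sq_bd hd0 (by rw [hd]; linarith) (by positivity) ?_
    rw [hd]; nlinarith
  have ht1 : |S.t n ψ| ≤ 2 * (2 ^ n * s) := by
    have h1 := S.ql n ψ
    have h2 := S.ml n ψ
    rw [h4] at h1 h2
    have h3 := S.q0 n ψ
    have h4 := S.q1 n ψ
    have h5 := S.m1 n ψ
    have : |S.t n ψ| / 2 ≤ 2 ^ n * s := by
      refine le_of_sq_bd (by positivity) ?_ (by positivity) ?_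
      · have : |S.t n ψ| ≤ |S.m n ψ| + |S.q n ψ| := abs_sub _ _
        rw [abs_of_nonneg h3] at this
        linarith
      · have : |S.t n ψ| ≤ |1 - S.m n ψ| + |1 - S.q n ψ| := by
          rw [t, show S.m n ψ - S.q n ψ = -(1 - S.m n ψ) + (1 - S.q n ψ) by ring]
          refine (abs_add_le _ _).trans ?_
          rw [abs_neg]
        rw [abs_of_nonneg (show 0 ≤ 1 - S.q n ψ by linarith)] at this
        linarith
    linarith
  have hqh : ∀ l, 1 ≤ l → S.q l ψ * (2 ^ l * s) ≤ 3 := by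
    intro l hl
    have h1 := S.qh l ψ hl
    rw [h4] at h1
    have h2 := S.q0 l ψ
    have h3 : 2 ^ l * s / 3 ≤ 1 + (2 ^ l * s) ^ 2 / 27 := by nlinarith [sq_nonneg (2 ^ l * s - 9 / 2)]
    have := mul_le_mul_of_nonneg_left h3 h2
    linarith
  have ht2 : |S.t n ψ| * (2 ^ n * s) ≤ 9 := by
    have h1 := S.mh n ψ hn
    rw [h4] at h1
    have h2 : |S.m n ψ| * (2 ^ n * s) ≤ 6 := by
      refine abs_le_of_sq_le_sq' ?_ (by norm_num) |>.2
      rw [mul_pow, sq_abs]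
      nlinarith [sq_nonneg (S.m n ψ)]
    have h3 : |S.t n ψ| ≤ |S.m n ψ| + |S.q n ψ| := abs_sub _ _
    rw [abs_of_nonneg (S.q0 n ψ)] at h3
    have := mul_le_mul_of_nonneg_right h3 (show 0 ≤ 2 ^ n * s by positivity)
    have := hqh n hn
    linarith
  rcases le_or_gt n k with h | h
  · have e : ((k : ℤ) - n).natAbs = k - n := by omega
    have e2 : (2:ℝ) ^ n * 2 ^ (k - n) = 2 ^ k := by rw [← pow_add, Nat.add_sub_cancel' h]
    have h1 : S.dl k ψ * (2 ^ k * s) ≤ 3 := by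
      refine le_trans (mul_le_mul_of_nonneg_right ?_ (by positivity)) (hqh k (by omega))
      rw [hd]; linarith [S.q0 (k + 1) ψ]
    rw [e]
    calc _ ≤ S.dl k ψ * (2 * (2 ^ n * s)) * 2 ^ (k - n) := by
          refine mul_le_mul_of_nonneg_right (mul_le_mul_of_nonneg_left ht1 hd0) (by positivity)
      _ = 2 * (S.dl k ψ * ((2 ^ n * 2 ^ (k - n)) * s)) := by ring
      _ ≤ _ := by rw [e2]; linarith
  · have e : ((k : ℤ) - n).natAbs = n - k := by omega
    have e2 : (2:ℝ) ^ k * 2 ^ (n - k) = 2 ^ n := by rw [← pow_add, Nat.add_sub_cancel' h.le]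
    rw [e]
    calc _ ≤ 2 * (2 ^ k * s) * |S.t n ψ| * 2 ^ (n - k) := by
          refine mul_le_mul_of_nonneg_right (mul_le_mul_of_nonneg_right hd1 (abs_nonneg _)) (by positivity)
      _ = 2 * (|S.t n ψ| * ((2 ^ k * 2 ^ (n - k)) * s)) := by ring
      _ ≤ _ := by rw [e2]; linarith

lemma dl_t (i : ℤ) (n : ℕ) (ψ : AddChar G ℂ) :
    S.dl (n + i) ψ * |S.t n ψ| * 2 ^ i.natAbs ≤ 18 := by
  rcases Nat.eq_zero_or_pos n with h | h
  · rw [h, t, S.m00, S.q00]; simp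
  by_cases hk : 0 ≤ n + i ∧ n + i < S.L
  · have := S.dl_t_nat (n + i).toNat n h (by omega) ψ
    rw [Int.toNat_of_nonneg hk.1] at this
    simpa using this
  · rw [dl, if_neg hk]; simp

lemma triple {a c u i j : ℝ} (ha : 0 ≤ a) (hc : 0 ≤ c) (hu : 0 ≤ u) (hi : 0 ≤ i) (hj : 0 ≤ j)
    (h1 : a * u ≤ 18 * i ^ 2) (h2 : c * u ≤ 18 * j ^ 2) :
    a * u * c ≤ 18 * (i * j) * ((a + c) / 2) := by
  refine abs_le_of_sq_le_sq' ?_ (by positivity) |>.2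
  have h3 := mul_le_mul h1 h2 (by positivity) (by positivity)
  have h4 : a * c ≤ ((a + c) / 2) ^ 2 := by nlinarith [sq_nonneg (a - c)]
  have h5 := mul_le_mul h3 h4 (by positivity) (by positivity)
  nlinarith

/-- decay ratio -/
def rho : ℝ := Real.sqrt (1 / 2)

lemma rho_pos : 0 < rho := Real.sqrt_pos.mpr (by norm_num)
lemma rho_lt : rho < 1 := by
  rw [rho, Real.sqrt_lt' (by norm_num)]; norm_num

lemma rho_sq (n : ℕ) : (rho ^ n) ^ 2 * 2 ^ n = 1 := by
  rw [← pow_mul, mul_comm n 2, pow_mul, rho, Real.sq_sqrt (by norm_num), ← mul_pow]; norm_num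

lemma mult_O (ε : ℕ → ℝ) (hε : ∀ n, |ε n| ≤ 1) (i j : ℤ) (ψ : AddChar G ℂ) :
    |∑ n ∈ Finset.range S.L, ε n * (S.dl (n + i) ψ * (S.t n ψ * S.dl (n + j) ψ))| ≤
      18 * (rho ^ i.natAbs * rho ^ j.natAbs) := by
  have r0 := rho_pos
  have key : ∀ (l : ℤ) (n : ℕ), S.dl (n + l) ψ * |S.t n ψ| ≤ 18 * (rho ^ l.natAbs) ^ 2 := by
    intro l n
    have h1 := S.dl_t l n ψ
    have h2 := rho_sq l.natAbs
    have h3 : 0 ≤ (rho ^ l.natAbs) ^ 2 := sq_nonneg _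
    calc S.dl (n + l) ψ * |S.t n ψ| = (S.dl (n + l) ψ * |S.t n ψ| * 2 ^ l.natAbs) * (rho ^ l.natAbs) ^ 2 := by
          rw [mul_assoc _ _ ((rho ^ l.natAbs) ^ 2), mul_comm (2 ^ l.natAbs), h2, mul_one]
      _ ≤ _ := mul_le_mul_of_nonneg_right h1 h3
  refine (Finset.abs_sum_le_sum_abs _ _).trans ?_
  have h1 : ∀ n, |ε n * (S.dl (n + i) ψ * (S.t n ψ * S.dl (n + j) ψ))| ≤
      18 * (rho ^ i.natAbs * rho ^ j.natAbs) * ((S.dl (n + i) ψ + S.dl (n + j) ψ) / 2) := by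
    intro n
    have h0 := S.dl_nonneg (n + i) ψ
    have h0' := S.dl_nonneg (n + j) ψ
    rw [abs_mul, abs_mul, abs_mul, abs_of_nonneg h0, abs_of_nonneg h0', ← mul_assoc (S.dl (n + i) ψ)]
    have := triple h0 h0' (abs_nonneg (S.t n ψ)) (pow_pos r0 i.natAbs).le (pow_pos r0 j.natAbs).le
      (key i n) (key j n)
    refine le_trans ?_ this
    have h2 : 0 ≤ S.dl (n + i) ψ * |S.t n ψ| * S.dl (n + j) ψ := by positivity
    have := mul_le_mul_of_nonneg_right (hε n) h2
    linarith
  refine (Finset.sum_le_sum fun n _ => h1 n).trans ?_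
  rw [← Finset.mul_sum, ← Finset.sum_div, Finset.sum_add_distrib]
  have h2 := S.sum_dl ψ i
  have h3 := S.sum_dl ψ j
  have h4 : 0 ≤ 18 * (rho ^ i.natAbs * rho ^ j.natAbs) := by positivity
  have := mul_le_mul_of_nonneg_left (show (∑ n ∈ Finset.range S.L, S.dl (n + i) ψ + ∑ n ∈ Finset.range S.L, S.dl (n + j) ψ) / 2 ≤ 1 by linarith) h4
  linarith

lemma isMult_D (k : ℤ) : IsMult (S.D k) (S.dl k) := by
  by_cases h : 0 ≤ k ∧ k < S.L
  · have := (S.mulF k.toNat (by omega)).sub (S.mulF (k.toNat + 1) (by omega))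
    intro ψ x
    simp only [D, dl, if_pos h]
    exact this ψ x
  · intro ψ x
    simp only [D, dl, if_neg h]
    exact isMult_zero ψ x

lemma O_two (ε : ℕ → ℝ) (hε : ∀ n, |ε n| ≤ 1) (i j : ℤ) (f : G → ℝ) :
    nm 2 (S.O ε i j f) ≤ 18 * (rho ^ i.natAbs * rho ^ j.natAbs) * nm 2 f := by
  have r0 := rho_pos
  refine plancherel (m := fun ψ => ∑ n ∈ Finset.range S.L, ε n * (S.dl (n + i) ψ * (S.t n ψ * S.dl (n + j) ψ)))
    ?_ (by positivity) (fun ψ => S.mult_O ε hε i j ψ) f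
  exact IsMult.sum _ fun n hn => ((S.isMult_D (n + i)).comp
    (((S.mulM n).sub (S.mulF n (Finset.mem_range.mp hn).le)).comp (S.isMult_D (n + j)))).smul (ε n)

lemma T_sym (n : ℕ) (f g : G → ℝ) : ∑ x, S.T n f x * g x = ∑ x, f x * S.T n g x := by
  simp only [T, LinearMap.sub_apply, Pi.sub_apply, sub_mul, mul_sub, Finset.sum_sub_distrib, (S.mkM n).sym, (S.mkF n).sym]

lemma D_sym (k : ℤ) (f g : G → ℝ) : ∑ x, S.D k f x * g x = ∑ x, f x * S.D k g x := by
  unfold D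
  split_ifs
  · simp only [LinearMap.sub_apply, Pi.sub_apply, sub_mul, mul_sub, Finset.sum_sub_distrib, (S.mkF _).sym]
  · simp

lemma T_FL (n : ℕ) (f : G → ℝ) : S.T n (S.F S.L f) = 0 := by
  have : S.F S.L f = (S.F S.L f 0) • (1 : G → ℝ) := by
    ext x; simp [S.FL f x 0]
  rw [this, map_smul, T, LinearMap.sub_apply, (S.mkM n).one, (S.mkF n).one, sub_self, smul_zero]

lemma FL_T (n : ℕ) (f : G → ℝ) : S.F S.L (S.T n f) = 0 := by
  set h := S.F S.L (S.T n f) with hh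
  have h1 : ∑ x, h x * h x = 0 := by
    rw [hh, (S.mkF S.L).sym, S.T_sym, S.T_FL]; simp
  ext x
  have := (Finset.sum_eq_zero_iff_of_nonneg fun x _ => mul_self_nonneg (h x)).mp h1 x (Finset.mem_univ x)
  simpa using this

lemma sum_D (f : G → ℝ) : ∑ k ∈ Finset.range S.L, S.D k f = f - S.F S.L f := by
  rw [← S.F0 f]
  have : ∀ k ∈ Finset.range S.L, S.D k (S.F 0 f) = S.F k f - S.F (k + 1) f := by
    intro k hk
    rw [S.D_nat (Finset.mem_range.mp hk), S.F0]; rfl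
  rw [Finset.sum_congr rfl this, Finset.sum_range_sub', S.F0]

lemma decomp (n : ℕ) (hn : n < S.L) (f : G → ℝ) : S.T n f =
    ∑ i ∈ Finset.Icc (-(S.L:ℤ)) S.L, ∑ j ∈ Finset.Icc (-(S.L:ℤ)) S.L, S.D (n + i) (S.T n (S.D (n + j) f)) := by
  have h0 : ∀ k, ¬ (0 ≤ k ∧ k < (S.L : ℤ)) → S.D k = 0 := fun k hk => if_neg hk
  have h1 : ∀ g, ∑ i ∈ Finset.Icc (-(S.L:ℤ)) S.L, S.D (n + i) g = g - S.F S.L g := by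
    intro g
    rw [shift_eq hn (fun k => S.D k g) (fun k hk => by rw [h0 k hk]; rfl), S.sum_D]
  simp only [← map_sum, h1]
  rw [map_sub, S.T_FL, sub_zero, S.FL_T, sub_zero]

lemma R_decomp (ε : ℕ → ℝ) (f : G → ℝ) : S.R ε f =
    ∑ i ∈ Finset.Icc (-(S.L:ℤ)) S.L, ∑ j ∈ Finset.Icc (-(S.L:ℤ)) S.L, S.O ε i j f := by
  have : S.R ε f = ∑ n ∈ Finset.range S.L, ε n •
      ∑ i ∈ Finset.Icc (-(S.L:ℤ)) S.L, ∑ j ∈ Finset.Icc (-(S.L:ℤ)) S.L, S.D (n + i) (S.T n (S.D (n + j) f)) := by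
    rw [R, LinearMap.sum_apply]
    refine Finset.sum_congr rfl fun n hn => ?_
    rw [← S.decomp n (Finset.mem_range.mp hn)]; rfl
  rw [this]
  simp only [Finset.smul_sum]
  rw [Finset.sum_comm]
  refine Finset.sum_congr rfl fun i _ => ?_
  rw [Finset.sum_comm]
  refine Finset.sum_congr rfl fun j _ => ?_
  rw [O, LinearMap.sum_apply]; rfl

lemma R_of_O {P K s : ℝ} (hP : 1 ≤ P) (hK : 0 ≤ K) (h0 : 0 < s) (h1 : s < 1) (ε : ℕ → ℝ) (f : G → ℝ)
    (H : ∀ i j, nm P (S.O ε i j f) ≤ K * (s ^ i.natAbs * s ^ j.natAbs) * nm P f) :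
    nm P (S.R ε f) ≤ K * (2 / (1 - s)) ^ 2 * nm P f := by
  rw [R_decomp]
  have hg := geo_sum h0 h1 S.L
  have hg0 : 0 ≤ ∑ i ∈ Finset.Icc (-(S.L:ℤ)) S.L, s ^ i.natAbs := Finset.sum_nonneg fun _ _ => by positivity
  calc _ ≤ ∑ i ∈ Finset.Icc (-(S.L:ℤ)) S.L, ∑ j ∈ Finset.Icc (-(S.L:ℤ)) S.L, K * (s ^ i.natAbs * s ^ j.natAbs) * nm P f := by
        refine (nm_sum_le hP _ _).trans (Finset.sum_le_sum fun i _ => ?_)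
        exact (nm_sum_le hP _ _).trans (Finset.sum_le_sum fun j _ => H i j)
    _ = K * (∑ i ∈ Finset.Icc (-(S.L:ℤ)) S.L, s ^ i.natAbs) ^ 2 * nm P f := by
        rw [sq, Finset.sum_mul_sum]
        simp only [Finset.mul_sum, Finset.sum_mul]
    _ ≤ _ := by
        refine mul_le_mul_of_nonneg_right (mul_le_mul_of_nonneg_left ?_ hK) (nm_nonneg _ _)
        exact pow_le_pow_left₀ hg0 hg 2

end Sys
end sys
end
end DF

namespace DF
noncomputable section

lemma sq_sqf {X : Type} (N : ℕ) (h : ℕ → X → ℝ) (x : X) : sqf N h x ^ 2 = ∑ n ∈ Finset.range N, h n x ^ 2 :=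
  Real.sq_sqrt (Finset.sum_nonneg fun _ _ => sq_nonneg _)

lemma abs_le_sqf {X : Type} {N n : ℕ} (hn : n < N) (h : ℕ → X → ℝ) (x : X) : |h n x| ≤ sqf N h x := by
  rw [← Real.sqrt_sq_eq_abs]
  exact Real.sqrt_le_sqrt (Finset.single_le_sum (f := fun n => h n x ^ 2) (fun _ _ => sq_nonneg _) (Finset.mem_range.mpr hn))

section vv
variable {G : Type} [AddCommGroup G] [Fintype G]

lemma vv {Q Q' : ℝ} (h : Q.HolderConjugate Q') (N : ℕ) (T : ℕ → (G → ℝ) →ₗ[ℝ] (G → ℝ)) (hT : ∀ n, Mk (T n))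
    {C : ℝ} (hC : 0 ≤ C)
    (hmax : ∀ f, ∃ W : G → ℝ, (∀ n < N, ∀ x, |T n f x| ≤ W x) ∧ nm Q' W ≤ C * nm Q' f) (g : ℕ → G → ℝ) :
    nm (2 * Q) (sqf N (fun n => T n (g n))) ≤ Real.sqrt C * nm (2 * Q) (sqf N g) := by
  have Q0 := h.pos
  refine (abs_le_of_sq_le_sq' ?_ (mul_nonneg (Real.sqrt_nonneg _) (nm_nonneg _ _))).2
  rw [mul_pow, Real.sq_sqrt hC, ← nm_sq Q0, ← nm_sq Q0]
  have h1 : nm Q (fun x => sqf N (fun n => T n (g n)) x ^ 2) ≤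
      nm Q (fun x => ∑ n ∈ Finset.range N, T n (fun y => g n y ^ 2) x) := by
    refine nm_mono' Q0 fun x => ?_
    rw [abs_of_nonneg (sq_nonneg _), sq_sqf]
    exact Finset.sum_le_sum fun n _ => (hT n).sq_le _ _
  refine h1.trans ?_
  refine nm_le_of_dual_nonneg h _ (fun x => Finset.sum_nonneg fun n _ => (hT n).pos _ (fun _ => sq_nonneg _) _)
    (mul_nonneg hC (nm_nonneg _ _)) fun f _ => ?_
  obtain ⟨W, hW, hW'⟩ := hmax f
  calc ∑ x, (∑ n ∈ Finset.range N, T n (fun y => g n y ^ 2) x) * f x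
      = ∑ x, ∑ n ∈ Finset.range N, g n x ^ 2 * T n f x := by
        simp only [Finset.sum_mul]
        rw [Finset.sum_comm]
        conv_rhs => rw [Finset.sum_comm]
        exact Finset.sum_congr rfl fun n _ => (hT n).sym _ _
    _ ≤ ∑ x, sqf N g x ^ 2 * W x := by
        refine Finset.sum_le_sum fun x _ => ?_
        rw [sq_sqf, Finset.sum_mul]
        refine Finset.sum_le_sum fun n hn => mul_le_mul_of_nonneg_left ?_ (sq_nonneg _)
        exact (le_abs_self _).trans (hW n (Finset.mem_range.mp hn) x)
    _ ≤ nm Q (fun x => sqf N g x ^ 2) * nm Q' W := holder h _ _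
    _ ≤ nm Q (fun x => sqf N g x ^ 2) * (C * nm Q' f) := mul_le_mul_of_nonneg_left hW' (nm_nonneg _ _)
    _ = _ := by ring

lemma sqf_sub_le (N : ℕ) (a b : ℕ → G → ℝ) {P : ℝ} (hP : 1 ≤ P) :
    nm P (sqf N (fun n => a n - b n)) ≤ 2 * (nm P (sqf N a) + nm P (sqf N b)) := by
  have P0 : 0 < P := by linarith
  have h1 : nm P (sqf N (fun n => a n - b n)) ≤ nm P ((2:ℝ) • (sqf N a + sqf N b)) := by
    refine nm_mono' P0 fun x => ?_
    rw [abs_of_nonneg (sqf_nonneg _ _ _)]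
    have ha := sqf_nonneg N a x
    have hb := sqf_nonneg N b x
    have h0 : 0 ≤ ((2:ℝ) • (sqf N a + sqf N b)) x := by simp; positivity
    refine (abs_le_of_sq_le_sq' ?_ h0).2
    simp only [Pi.smul_apply, Pi.add_apply, smul_eq_mul]
    have : sqf N (fun n => a n - b n) x ^ 2 ≤ 2 * sqf N a x ^ 2 + 2 * sqf N b x ^ 2 := by
      rw [sq_sqf, sq_sqf, sq_sqf, Finset.mul_sum, Finset.mul_sum, ← Finset.sum_add_distrib]
      refine Finset.sum_le_sum fun n _ => ?_
      simp only [Pi.sub_apply]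
      nlinarith [sq_nonneg (a n x + b n x)]
    nlinarith
  refine h1.trans ?_
  rw [nm_smul P0, abs_of_pos (by norm_num : (0:ℝ) < 2)]
  linarith [nm_add_le hP (sqf N a) (sqf N b)]

lemma pairing {P P' : ℝ} (h : P.HolderConjugate P') (N : ℕ) (a b : ℕ → G → ℝ) :
    ∑ x, ∑ n ∈ Finset.range N, |a n x| * |b n x| ≤ nm P (sqf N a) * nm P' (sqf N b) := by
  refine le_trans (Finset.sum_le_sum fun x _ => ?_) (holder h _ _)
  refine (Real.sum_mul_le_sqrt_mul_sqrt _ _ _).trans (le_of_eq ?_)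
  simp only [sq_abs]; rfl

end vv

/-- uniform boundedness of signed sums -/
def HB (A : ℝ → ℝ) (B : ℝ → ℝ → ℝ) (P C : ℝ) : Prop :=
  ∀ (G : Type) [AddCommGroup G] [Fintype G] (S : Sys A B G) (ε : ℕ → ℝ), (∀ n, |ε n| ≤ 1) →
    ∀ f, nm P (S.R ε f) ≤ C * nm P f

section boot
variable {A : ℝ → ℝ} {B : ℝ → ℝ → ℝ}

lemma hb_two : HB A B 2 (18 * (2 / (1 - Sys.rho)) ^ 2) := by
  intro G _ _ S ε hε f
  exact S.R_of_O (by norm_num) (by norm_num) Sys.rho_pos Sys.rho_lt ε f (fun i j => S.O_two ε hε i j f)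

lemma hb_dual {P Q C : ℝ} (h : P.HolderConjugate Q) (hC : 0 ≤ C) (H : HB A B P C) : HB A B Q C := by
  intro G _ _ S ε hε f
  refine nm_dual_op h.symm (S.R ε) (S.R ε) (fun f g => ?_) hC (fun g => H G S ε hε g) f
  simp only [Sys.R, LinearMap.sum_apply, Finset.sum_apply, LinearMap.smul_apply, Pi.smul_apply, smul_eq_mul,
    Finset.sum_mul, Finset.mul_sum]
  rw [Finset.sum_comm]
  conv_rhs => rw [Finset.sum_comm]
  refine Finset.sum_congr rfl fun n _ => ?_
  have := S.T_sym n f g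
  calc _ = ε n * ∑ x, S.T n f x * g x := by rw [Finset.mul_sum]; exact Finset.sum_congr rfl fun x _ => by ring
    _ = _ := by rw [this, Finset.mul_sum]; exact Finset.sum_congr rfl fun x _ => by ring

lemma sign_abs {ε : ℕ → ℝ} (h : ∀ n, ε n = 1 ∨ ε n = -1) (n : ℕ) : |ε n| ≤ 1 := by
  rcases h n with h | h <;> rw [h] <;> simp

lemma lp_D (hA : ∀ p, 0 ≤ A p) {p : ℝ} (hp : 1 < p) : ∃ K, 0 < K ∧ ∀ (G : Type) [AddCommGroup G] [Fintype G] (S : Sys A B G)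
    (j : ℤ) (f : G → ℝ), nm p (sqf S.L (fun n => S.D (n + j) f)) ≤ K * nm p f := by
  obtain ⟨K, hK, H⟩ := khinchine (p := p) (by linarith)
  refine ⟨K * (A p + 1), mul_pos hK (by linarith [hA p]), fun G _ _ S j f => ?_⟩
  have h1 : nm p (sqf S.L (fun n => S.D (n + j) f)) ≤ nm p (sqf S.L (fun n => S.D n f)) := by
    refine nm_mono' (by linarith) fun x => ?_
    rw [abs_of_nonneg (sqf_nonneg _ _ _)]
    refine Real.sqrt_le_sqrt ?_
    exact shift_le (fun k => S.D k f x ^ 2) (fun _ => sq_nonneg _) (fun k hk => by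
      show S.D k f x ^ 2 = 0
      have : S.D k f x = 0 := by rw [Sys.D, if_neg hk]; rfl
      rw [this]; norm_num) j
  refine h1.trans ?_
  rw [mul_assoc]
  refine H G S.L _ _ (mul_nonneg (by linarith [hA p]) (nm_nonneg _ _)) fun ε hε => ?_
  have h2 := S.sg p hp ε (sign_abs hε) f
  have e : ∑ n ∈ Finset.range S.L, ε n • S.D n f = fun x => ∑ k ∈ Finset.range S.L, ε k * (S.F k f x - S.F (k + 1) f x) := by
    ext x
    rw [Finset.sum_apply]
    refine Finset.sum_congr rfl fun k hk => ?_
    rw [S.D_nat (Finset.mem_range.mp hk)]; rfl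
  rw [e]
  have := nm_nonneg p f
  linarith

lemma sq_T {p C : ℝ} (hp : 1 < p) (hC : 0 ≤ C) (H : HB A B p C) : ∃ K, 0 < K ∧
    ∀ (G : Type) [AddCommGroup G] [Fintype G] (S : Sys A B G) (f : G → ℝ),
      nm p (sqf S.L (fun n => S.T n f)) ≤ K * nm p f := by
  obtain ⟨K, hK, H'⟩ := khinchine (p := p) (by linarith)
  refine ⟨K * (C + 1), by positivity, fun G _ _ S f => ?_⟩
  rw [mul_assoc]
  refine H' G S.L _ _ (mul_nonneg (by linarith) (nm_nonneg _ _)) fun ε hε => ?_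
  have h2 := H G S ε (sign_abs hε) f
  have e : ∑ n ∈ Finset.range S.L, ε n • S.T n f = S.R ε f := by
    rw [Sys.R, LinearMap.sum_apply]; rfl
  rw [e]
  have := nm_nonneg p f
  linarith

lemma max_M (hA : ∀ p, 0 ≤ A p) {p C : ℝ} (hp : 1 < p) (hC : 0 ≤ C) (H : HB A B p C) : ∃ K, 0 < K ∧
    ∀ (G : Type) [AddCommGroup G] [Fintype G] (S : Sys A B G) (f : G → ℝ),
      ∃ W : G → ℝ, (∀ n < S.L, ∀ x, |S.M n f x| ≤ W x) ∧ nm p W ≤ K * nm p f := by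
  obtain ⟨K, hK, H'⟩ := sq_T hp hC H
  refine ⟨K + A p, by linarith [hA p], fun G _ _ S f => ?_⟩
  obtain ⟨W, hW, hW'⟩ := S.mx p hp f
  refine ⟨sqf S.L (fun n => S.T n f) + W, fun n hn x => ?_, ?_⟩
  · have h1 : S.M n f x = S.T n f x + S.F n f x := by simp [Sys.T]
    rw [h1]
    exact (abs_add_le _ _).trans (add_le_add (abs_le_sqf hn (fun n => S.T n f) x) (hW n hn.le x))
  · refine (nm_add_le hp.le _ _).trans ?_
    linarith [H' G S f]

lemma vv_T (hA : ∀ p, 0 ≤ A p) {Q C : ℝ} (hQ : 1 < Q) (hC : 0 ≤ C) (H : HB A B Q C) : ∃ K, 0 < K ∧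
    ∀ (G : Type) [AddCommGroup G] [Fintype G] (S : Sys A B G) (g : ℕ → G → ℝ),
      nm (2 * Q) (sqf S.L (fun n => S.T n (g n))) ≤ K * nm (2 * Q) (sqf S.L g) := by
  obtain ⟨Q', hQ'⟩ : ∃ q, Q.HolderConjugate q := ⟨_, Real.HolderConjugate.conjExponent hQ⟩
  obtain ⟨K, hK, H'⟩ := max_M hA hQ'.symm.lt hC (hb_dual hQ' hC H)
  refine ⟨2 * (Real.sqrt K + Real.sqrt (A Q')), by positivity, fun G _ _ S g => ?_⟩
  have h1 := vv hQ' S.L S.M S.mkM hK.le (fun f => H' G S f) g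
  have h2 := vv hQ' S.L S.F S.mkF (hA Q') (fun f => by
    obtain ⟨W, hW, hW'⟩ := S.mx Q' hQ'.symm.lt f
    exact ⟨W, fun n hn => hW n hn.le, hW'⟩) g
  have h3 := sqf_sub_le S.L (fun n => S.M n (g n)) (fun n => S.F n (g n)) (P := 2 * Q) (by linarith)
  have e : (fun n => S.T n (g n)) = fun n => S.M n (g n) - S.F n (g n) := rfl
  rw [e]
  linarith

lemma O_bound (hA : ∀ p, 0 ≤ A p) {Q C : ℝ} (hQ : 1 < Q) (hC : 0 ≤ C) (H : HB A B Q C) : ∃ K, 0 < K ∧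
    ∀ (G : Type) [AddCommGroup G] [Fintype G] (S : Sys A B G) (ε : ℕ → ℝ), (∀ n, |ε n| ≤ 1) → ∀ i j f,
      nm (2 * Q) (S.O ε i j f) ≤ K * nm (2 * Q) f := by
  have h2Q : 1 < 2 * Q := by linarith
  obtain ⟨P', hP'⟩ : ∃ q, (2 * Q).HolderConjugate q := ⟨_, Real.HolderConjugate.conjExponent h2Q⟩
  obtain ⟨K1, hK1, H1⟩ := vv_T hA hQ hC H
  obtain ⟨K2, hK2, H2⟩ := lp_D (B := B) hA h2Q
  obtain ⟨K3, hK3, H3⟩ := lp_D (B := B) hA hP'.symm.lt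
  refine ⟨K1 * K2 * K3, by positivity, fun G _ _ S ε hε i j f => ?_⟩
  refine nm_le_of_dual hP' _ (mul_nonneg (by positivity) (nm_nonneg _ _)) fun g => ?_
  calc ∑ x, S.O ε i j f x * g x = ∑ x, ∑ n ∈ Finset.range S.L, ε n * (S.T n (S.D (n + j) f) x * S.D (n + i) g x) := by
        simp only [Sys.O, LinearMap.sum_apply, Finset.sum_apply, LinearMap.smul_apply, Pi.smul_apply, smul_eq_mul,
          LinearMap.comp_apply, Finset.sum_mul]
        rw [Finset.sum_comm]
        conv_rhs => rw [Finset.sum_comm]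
        refine Finset.sum_congr rfl fun n _ => ?_
        rw [← Finset.mul_sum, ← S.D_sym (n + i) (S.T n (S.D (n + j) f)) g, Finset.mul_sum]
        exact Finset.sum_congr rfl fun x _ => by ring
    _ ≤ ∑ x, ∑ n ∈ Finset.range S.L, |S.T n (S.D (n + j) f) x| * |S.D (n + i) g x| := by
        refine Finset.sum_le_sum fun x _ => Finset.sum_le_sum fun n _ => (le_abs_self _).trans ?_
        rw [abs_mul, abs_mul]
        exact mul_le_of_le_one_left (by positivity) (hε n)
    _ ≤ nm (2 * Q) (sqf S.L (fun n => S.T n (S.D (n + j) f))) * nm P' (sqf S.L (fun n => S.D (n + i) g)) :=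
        pairing hP' S.L (fun n => S.T n (S.D (n + j) f)) (fun n => S.D (n + i) g)
    _ ≤ (K1 * (K2 * nm (2 * Q) f)) * (K3 * nm P' g) := by
        refine mul_le_mul ?_ (H3 G S i g) (nm_nonneg _ _) (mul_nonneg hK1.le (mul_nonneg hK2.le (nm_nonneg _ _)))
        exact (H1 G S (fun n => S.D (n + j) f)).trans (mul_le_mul_of_nonneg_left (H2 G S j f) hK1.le)
    _ = _ := by ring

lemma hb_step (hA : ∀ p, 0 ≤ A p) {Q C P : ℝ} (hQ : 2 ≤ Q) (hC : 0 ≤ C) (H : HB A B Q C) (h2 : 2 ≤ P) (hP : P < 2 * Q) :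
    ∃ C', 0 ≤ C' ∧ HB A B P C' := by
  obtain ⟨K, hK, HK⟩ := O_bound hA (by linarith) hC H
  have r0 := Sys.rho_pos
  have r1 := Sys.rho_lt
  set θ : ℝ := (1 / P - 1 / (2 * Q)) / (1 / 2 - 1 / (2 * Q)) with hθ
  have hP0 : 0 < P := by linarith
  have hQ0 : 0 < Q := by linarith
  have a1 : 0 < 1 / 2 - 1 / (2 * Q) := by
    have := one_div_lt_one_div_of_lt (show (0:ℝ) < 2 by norm_num) (show 2 < 2 * Q by linarith)
    linarith
  have a2 : 0 < 1 / P - 1 / (2 * Q) := by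
    have := one_div_lt_one_div_of_lt hP0 hP
    linarith
  have a3 : 1 / P ≤ 1 / 2 := one_div_le_one_div_of_le (by norm_num) h2
  have t0 : 0 < θ := div_pos a2 a1
  have t1 : θ ≤ 1 := (div_le_one a1).mpr (by linarith)
  have te : θ * (1 / 2 - 1 / (2 * Q)) = 1 / P - 1 / (2 * Q) := div_mul_cancel₀ _ a1.ne'
  have hpe : 1 / P = (1 - θ) / (2 * Q) + θ / 2 := by
    have : (1 - θ) / (2 * Q) + θ / 2 = θ * (1 / 2 - 1 / (2 * Q)) + 1 / (2 * Q) := by ring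
    rw [this, te]; ring
  have s0 : 0 < Sys.rho ^ θ := Real.rpow_pos_of_pos r0 _
  have s1 : Sys.rho ^ θ < 1 := Real.rpow_lt_one r0.le r1 t0
  refine ⟨2 * (K ^ (1 - θ) * 18 ^ θ) * (2 / (1 - Sys.rho ^ θ)) ^ 2, by positivity, fun G _ _ S ε hε f => ?_⟩
  refine S.R_of_O (by linarith) (by positivity) s0 s1 ε f fun i j => ?_
  refine (riesz_thorin (p0 := 2 * Q) (p1 := 2) (by linarith) (by norm_num) (by linarith) t0 t1 hK
    (B := 18 * (Sys.rho ^ i.natAbs * Sys.rho ^ j.natAbs)) (by positivity) hpe (S.O ε i j) (HK G S ε hε i j)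
    (S.O_two ε hε i j) f).trans (le_of_eq ?_)
  have e : ∀ n : ℕ, (Sys.rho ^ n) ^ θ = (Sys.rho ^ θ) ^ n := by
    intro n
    rw [← Real.rpow_natCast, ← Real.rpow_natCast, ← Real.rpow_mul r0.le, ← Real.rpow_mul r0.le, mul_comm]
  rw [Real.mul_rpow (by norm_num) (by positivity), Real.mul_rpow (by positivity) (by positivity), e, e]
  ring

lemma hb_iter (hA : ∀ p, 0 ≤ A p) (k : ℕ) : ∀ P, 2 ≤ P → P ≤ 2 * (3 / 2) ^ k → ∃ C, 0 ≤ C ∧ HB A B P C := by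
  induction k with
  | zero =>
    intro P h1 h2
    have : P = 2 := by simp at h2; linarith
    rw [this]
    exact ⟨_, by positivity, hb_two⟩
  | succ k ih =>
    intro P h1 h2
    have h3 : (1:ℝ) ≤ (3 / 2) ^ k := one_le_pow₀ (by norm_num)
    obtain ⟨C, hC, H⟩ := ih (2 * (3 / 2) ^ k) (by linarith) le_rfl
    refine hb_step hA (by linarith) hC H h1 ?_
    rw [pow_succ] at h2
    linarith

theorem hb_all (hA : ∀ p, 0 ≤ A p) {p : ℝ} (hp : 1 < p) : ∃ C, 0 ≤ C ∧ HB A B p C := by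
  have main : ∀ P : ℝ, 2 ≤ P → ∃ C, 0 ≤ C ∧ HB A B P C := by
    intro P hP
    obtain ⟨k, hk⟩ := pow_unbounded_of_one_lt P (show (1:ℝ) < 3 / 2 by norm_num)
    exact hb_iter hA k P hP (by linarith)
  rcases le_or_gt 2 p with h | h
  · exact main p h
  · have hc := Real.HolderConjugate.conjExponent hp
    obtain ⟨C, hC, H⟩ := main p.conjExponent (by
      rw [Real.conjExponent, le_div_iff₀ (by linarith)]; linarith)
    exact ⟨C, hC, hb_dual hc.symm hC H⟩

end boot
end
end DF

namespace DF
noncomputable section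

lemma vsum_le_two {r : ℝ} (hr : 2 < r) (a : ℕ → ℝ) (u : ℕ → ℕ) (J : ℕ) :
    vsum r a u J ^ (1 / r) ≤ Real.sqrt (∑ j ∈ Finset.range J, (a (u (j + 1)) - a (u j)) ^ 2) := by
  obtain ⟨S, hS⟩ : ∃ S, S = Real.sqrt (∑ j ∈ Finset.range J, (a (u (j + 1)) - a (u j)) ^ 2) := ⟨_, rfl⟩
  have hnn : 0 ≤ ∑ j ∈ Finset.range J, (a (u (j + 1)) - a (u j)) ^ 2 := Finset.sum_nonneg fun _ _ => sq_nonneg _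
  have hS0 : 0 ≤ S := hS ▸ Real.sqrt_nonneg _
  have hS2 : S ^ 2 = ∑ j ∈ Finset.range J, (a (u (j + 1)) - a (u j)) ^ 2 := by rw [hS, Real.sq_sqrt hnn]
  rw [← hS]
  have h : vsum r a u J ≤ S ^ r := by
    calc vsum r a u J ≤ ∑ j ∈ Finset.range J, S ^ (r - 2) * (a (u (j + 1)) - a (u j)) ^ 2 := by
          refine Finset.sum_le_sum fun j hj => ?_
          have h1 : |a (u (j + 1)) - a (u j)| ≤ S := by
            refine abs_le_of_sq_le_sq ?_ hS0
            rw [hS2]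
            exact Finset.single_le_sum (f := fun j => (a (u (j + 1)) - a (u j)) ^ 2) (fun _ _ => sq_nonneg _) hj
          have h2 : |a (u (j + 1)) - a (u j)| ^ r = |a (u (j + 1)) - a (u j)| ^ (r - 2) * (a (u (j + 1)) - a (u j)) ^ 2 := by
            rw [← sq_abs (a (u (j + 1)) - a (u j)), ← Real.rpow_natCast, ← Real.rpow_add' (abs_nonneg _) (by push_cast; linarith)]
            congr 1; push_cast; ring
          rw [h2]
          exact mul_le_mul_of_nonneg_right (Real.rpow_le_rpow (abs_nonneg _) h1 (by linarith)) (sq_nonneg _)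
      _ = S ^ r := by
          rw [← Finset.mul_sum, ← hS2, ← Real.rpow_natCast, ← Real.rpow_add' hS0 (by push_cast; linarith)]
          congr 1; push_cast; ring
  calc vsum r a u J ^ (1 / r) ≤ (S ^ r) ^ (1 / r) :=
        Real.rpow_le_rpow (Finset.sum_nonneg fun _ _ => Real.rpow_nonneg (abs_nonneg _) _) h (by positivity)
    _ = S := by rw [← Real.rpow_mul hS0, mul_one_div_cancel (by linarith), Real.rpow_one]

lemma vsum_le_sq {r : ℝ} (hr : 2 < r) (a : ℕ → ℝ) (u : ℕ → ℕ) (hu : Monotone u) {N : ℕ} (hN : ∀ j, u j < N)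
    (J : ℕ) : vsum r a u J ^ (1 / r) ≤ 2 * Real.sqrt (∑ n ∈ Finset.range N, a n ^ 2) := by
  refine (vsum_le_two hr a u J).trans ?_
  have hnn : 0 ≤ ∑ n ∈ Finset.range N, a n ^ 2 := Finset.sum_nonneg fun _ _ => sq_nonneg _
  rw [show (2 : ℝ) = Real.sqrt (2 ^ 2) by rw [Real.sqrt_sq (by norm_num)], ← Real.sqrt_mul (by norm_num)]
  refine Real.sqrt_le_sqrt ?_
  obtain ⟨M, rfl⟩ : ∃ M, N = M + 1 := ⟨N - 1, by have := hN 0; omega⟩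
  have h1 := sum_chain (fun t => a t ^ 2) (fun _ => sq_nonneg _) u hu (N := M) (fun j => by have := hN j; omega) J
  have h2 := sum_chain (fun t => a (t + 1) ^ 2) (fun _ => sq_nonneg _) u hu (N := M) (fun j => by have := hN j; omega) J
  have h3 : ∑ τ ∈ Finset.range M, a τ ^ 2 ≤ ∑ n ∈ Finset.range (M + 1), a n ^ 2 := by
    rw [Finset.sum_range_succ]; linarith [sq_nonneg (a M)]
  have h4 : ∑ τ ∈ Finset.range M, a (τ + 1) ^ 2 ≤ ∑ n ∈ Finset.range (M + 1), a n ^ 2 := by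
    rw [Finset.sum_range_succ']; linarith [sq_nonneg (a 0)]
  have h5 : ∑ j ∈ Finset.range J, (a (u (j + 1)) - a (u j)) ^ 2 ≤
      ∑ j ∈ Finset.range J, (2 * ∑ τ ∈ Finset.Ico (u j) (u (j + 1)), a τ ^ 2 +
        2 * ∑ τ ∈ Finset.Ico (u j) (u (j + 1)), a (τ + 1) ^ 2) := by
    refine Finset.sum_le_sum fun j _ => ?_
    rcases (hu (Nat.le_succ j)).eq_or_lt with h | h
    · have h : u (j + 1) = u j := h.symm
      rw [h]; simp
    · have h : u j < u (j + 1) := h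
      have e1 := Finset.single_le_sum (f := fun t => a t ^ 2) (fun _ _ => sq_nonneg _)
        (Finset.mem_Ico.mpr ⟨le_rfl, h⟩ : u j ∈ Finset.Ico (u j) (u (j + 1)))
      have e2 := Finset.single_le_sum (f := fun t => a (t + 1) ^ 2) (fun _ _ => sq_nonneg _)
        (Finset.mem_Ico.mpr ⟨by omega, by omega⟩ : u (j + 1) - 1 ∈ Finset.Ico (u j) (u (j + 1)))
      simp only [Nat.sub_add_cancel (show 1 ≤ u (j + 1) by omega)] at e1 e2
      nlinarith [sq_nonneg (a (u (j + 1)) + a (u j))]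
  rw [Finset.sum_add_distrib, ← Finset.mul_sum, ← Finset.mul_sum] at h5
  linarith

lemma nm_Mt {p : ℝ} (hp : 1 ≤ p) (d L n : ℕ) (f : Tor d L → ℝ) : nm p (Mt d L n f) ≤ nm p f := by
  have e : Mt d L n f = ((2 * 2 ^ n + 1 : ℝ) ^ d)⁻¹ • ∑ y ∈ Finset.Icc (fun _ => -2 ^ n : Fin d → ℤ) (fun _ => 2 ^ n),
      (fun x : Tor d L => f (x + -(fun j => (y j : ZMod (2 ^ L))))) := by
    ext x
    rw [Mt_apply, Pi.smul_apply, Finset.sum_apply, smul_eq_mul]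
    simp only [sub_eq_add_neg]
  have hc : ((Finset.Icc (fun _ => -2 ^ n : Fin d → ℤ) (fun _ => 2 ^ n)).card : ℝ) = (2 * 2 ^ n + 1 : ℝ) ^ d := by
    rw [Pi.card_Icc]
    simp only [Int.card_Icc, Finset.prod_const, Finset.card_univ, Fintype.card_fin]
    push_cast
    congr 1
    have : ((2 ^ n + 1 - -2 ^ n : ℤ).toNat : ℤ) = 2 * 2 ^ n + 1 := by
      have h0 : (0 : ℤ) < 2 ^ n := by positivity
      rw [Int.toNat_of_nonneg (by linarith)]; ring
    exact_mod_cast this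
  have hpos : (0 : ℝ) < (2 * 2 ^ n + 1 : ℝ) ^ d := by positivity
  rw [e, nm_smul (by linarith), abs_of_pos (inv_pos.mpr hpos)]
  rw [inv_mul_le_iff₀ hpos]
  refine (nm_sum_le hp _ _).trans ?_
  simp only [nm_shift]
  rw [Finset.sum_const, nsmul_eq_mul, hc]

theorem torus_thm {p r : ℝ} (hp : 1 < p) (hr : 2 < r) : ∃ C, 0 < C ∧ ∀ (d L : ℕ) (f : Tor d L → ℝ),
    ∃ W : Tor d L → ℝ, (∀ x, 0 ≤ W x) ∧ nm p W ≤ C * nm p f ∧ ∀ x (u : ℕ → ℕ), Monotone u → (∀ j, u j < L) →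
      ∀ J, vsum r (fun n => Mt d L n f x) u J ^ (1 / r) ≤ W x := by
  obtain ⟨A, B, hA, H⟩ := tor_sys
  obtain ⟨C, hC, hB⟩ := hb_all (B := B) hA hp
  obtain ⟨K, hK, hT⟩ := sq_T hp hC hB
  refine ⟨|B p r| + 2 * (K + 2), by positivity, fun d L f => ?_⟩
  obtain ⟨S, hSL, hM⟩ := H d L
  obtain ⟨W, hW0, hW1, hW2⟩ := S.lp p r hp hr f
  have hp1 := hp.le
  refine ⟨W + (2 : ℝ) • (sqf S.L (fun n => S.T n f) + fun x => |(Mt d L 0 f - f) x|), fun x => ?_, ?_, fun x u hu huL J => ?_⟩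
  · have := sqf_nonneg S.L (fun n => S.T n f) x
    simp only [Pi.add_apply, Pi.smul_apply, smul_eq_mul]
    have := hW0 x; positivity
  · refine (nm_add_le hp1 _ _).trans ?_
    rw [nm_smul (by linarith), abs_of_pos (by norm_num : (0 : ℝ) < 2)]
    have h1 := nm_add_le hp1 (sqf S.L (fun n => S.T n f)) (fun x => |(Mt d L 0 f - f) x|)
    rw [nm_abs] at h1
    have h2 := nm_sub_le hp1 (Mt d L 0 f) f
    have h3 := nm_Mt hp1 d L 0 f
    have h4 := hT _ S f
    have h5 : B p r * nm p f ≤ |B p r| * nm p f := mul_le_mul_of_nonneg_right (le_abs_self _) (nm_nonneg _ _)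
    linarith
  · rw [← hSL] at huL
    obtain ⟨e, he⟩ : ∃ e : ℕ → ℝ, e = fun n => Mt d L n f x - S.F n f x := ⟨_, rfl⟩
    have e1 : (fun n => Mt d L n f x) = fun n => S.F n f x + e n := by
      rw [he]; ext n; ring
    rw [e1]
    refine (vsum_add (by linarith) _ _ u J).trans ?_
    refine add_le_add (hW2 x u hu (fun j => (huL j).le) J) ?_
    refine (vsum_le_sq hr e u hu huL J).trans ?_
    simp only [Pi.smul_apply, smul_eq_mul]
    refine mul_le_mul_of_nonneg_left ?_ (by norm_num)
    rw [Pi.add_apply]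
    have hL : 0 < S.L := (Nat.zero_le _).trans_lt (huL 0)
    have e2 : ∑ n ∈ Finset.range S.L, e n ^ 2 ≤ ∑ n ∈ Finset.range S.L, S.T n f x ^ 2 + |(Mt d L 0 f - f) x| ^ 2 := by
      obtain ⟨M, hM'⟩ : ∃ M, S.L = M + 1 := ⟨S.L - 1, by omega⟩
      have e0 : |(Mt d L 0 f - f) x| ^ 2 = e 0 ^ 2 := by rw [sq_abs, he]; simp [S.F0]
      rw [e0]
      have e3 : ∀ n, e (n + 1) = S.T (n + 1) f x := fun n => by
        rw [he, Sys.T, hM (n + 1) (by omega)]; rfl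
      rw [hM', Finset.sum_range_succ', Finset.sum_range_succ']
      simp only [e3]
      linarith [sq_nonneg (S.T 0 f x)]
    have hn : 0 ≤ ∑ n ∈ Finset.range S.L, S.T n f x ^ 2 := Finset.sum_nonneg fun _ _ => sq_nonneg _
    refine (Real.sqrt_le_sqrt e2).trans ?_
    refine Real.sqrt_le_iff.mpr ⟨add_nonneg (sqf_nonneg _ _ _) (abs_nonneg _), ?_⟩
    have := sq_sqf S.L (fun n => S.T n f) x
    have h6 := mul_nonneg (sqf_nonneg S.L (fun n => S.T n f) x) (abs_nonneg ((Mt d L 0 f - f) x))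
    rw [← this]
    nlinarith

end
end DF

namespace DF
noncomputable section

/-- real averages over cubes -/
def ra (d n : ℕ) (f : (Fin d → ℤ) → ℝ) (x : Fin d → ℤ) : ℝ :=
  ((2 * 2 ^ n + 1 : ℝ) ^ d)⁻¹ * ∑ y ∈ Finset.Icc (fun _ => -2 ^ n : Fin d → ℤ) (fun _ => 2 ^ n), f (x - y)

/-- projection to the torus -/
def pr (d L : ℕ) (x : Fin d → ℤ) : Tor d L := fun j => (x j : ZMod (2 ^ L))

/-- lift from the torus -/
def lf (d L : ℕ) (z : Tor d L) : Fin d → ℤ := fun j => (z j).valMinAbs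

lemma lf_inj (d L : ℕ) : Function.Injective (lf d L) := by
  intro a b h
  ext j
  exact ZMod.injective_valMinAbs (congrFun h j)

lemma lf_pr {d L : ℕ} (x : Fin d → ℤ) (h : ∀ j, 2 * |x j| < 2 ^ L) : lf d L (pr d L x) = x := by
  ext j
  have := h j
  show ((x j : ZMod (2 ^ L))).valMinAbs = x j
  rw [ZMod.valMinAbs_spec]
  refine ⟨rfl, ?_, ?_⟩
  · push_cast; have := neg_abs_le (x j); linarith
  · push_cast; have := le_abs_self (x j); linarith

lemma transfer {p r : ℝ} (hp : 1 < p) (hr : 2 < r) : ∃ C, 0 < C ∧ ∀ (d : ℕ) (f : (Fin d → ℤ) → ℝ) (E : ℝ), 0 ≤ E →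
    (∀ s : Finset (Fin d → ℤ), ∑ x ∈ s, |f x| ^ p ≤ E ^ p) → ∀ (N : ℕ) (s : Finset (Fin d → ℤ)),
    ∃ W : (Fin d → ℤ) → ℝ, (∀ x, 0 ≤ W x) ∧ ∑ x ∈ s, |W x| ^ p ≤ (C * E) ^ p ∧
      ∀ x ∈ s, ∀ (u : ℕ → ℕ), Monotone u → (∀ j, u j ≤ N) →
        ∀ J, vsum r (fun n => ra d n f x) u J ^ (1 / r) ≤ W x := by
  obtain ⟨C, hC, H⟩ := torus_thm hp hr
  refine ⟨C, hC, fun d f E hE hf N s => ?_⟩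
  have hp0 : 0 < p := by linarith
  obtain ⟨R, hR⟩ : ∃ R : ℕ, ∀ x ∈ s, ∀ j, |x j| ≤ R := by
    refine ⟨∑ x ∈ s, ∑ j, (x j).natAbs, fun x hx j => ?_⟩
    rw [Int.abs_eq_natAbs]
    exact_mod_cast (Finset.single_le_sum (f := fun j => (x j).natAbs) (fun _ _ => Nat.zero_le _) (Finset.mem_univ j)).trans
      (Finset.single_le_sum (f := fun x : Fin d → ℤ => ∑ j, (x j).natAbs) (fun _ _ => Nat.zero_le _) hx)
  obtain ⟨L, hL⟩ : ∃ L, L = 2 * (R + 2 ^ N) := ⟨_, rfl⟩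
  have hL2 : L < 2 ^ L := Nat.lt_two_pow_self
  have hNL : N < L := by have := @Nat.lt_two_pow_self N; omega
  have hZ : (2 * (R + 2 ^ N) : ℤ) < 2 ^ L := by
    have : 2 * (R + 2 ^ N) < 2 ^ L := by rw [← hL]; exact hL2
    exact_mod_cast this
  obtain ⟨W, hW0, hW1, hW2⟩ := H d L (fun z => f (lf d L z))
  have hg : nm p (fun z => f (lf d L z)) ≤ E := by
    rw [nm_le_iff hp0 _ hE]
    have := hf (Finset.univ.map ⟨lf d L, lf_inj d L⟩)
    rwa [Finset.sum_map] at this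
  have hsmall : ∀ x ∈ s, ∀ j, 2 * |x j| < 2 ^ L := fun x hx j => by
    have := hR x hx j
    have h0 : (0 : ℤ) < 2 ^ N := by positivity
    linarith
  refine ⟨fun x => W (pr d L x), fun x => hW0 _, ?_, fun x hx u hu huN J => ?_⟩
  · have hinj : ∀ x ∈ s, ∀ y ∈ s, pr d L x = pr d L y → x = y := fun x hx y hy h => by
      rw [← lf_pr x (hsmall x hx), h, lf_pr y (hsmall y hy)]
    have h1 : ∑ x ∈ s, |W (pr d L x)| ^ p = ∑ z ∈ s.image (pr d L), |W z| ^ p := by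
      rw [Finset.sum_image hinj]
    rw [h1]
    refine (Finset.sum_le_sum_of_subset_of_nonneg (Finset.subset_univ _) fun _ _ _ => Real.rpow_nonneg (abs_nonneg _) _).trans ?_
    rw [← nm_rpow hp0]
    exact Real.rpow_le_rpow (nm_nonneg _ _) (hW1.trans (mul_le_mul_of_nonneg_left hg hC.le)) hp0.le
  · have key : ∀ n ≤ N, ra d n f x = Mt d L n (fun z => f (lf d L z)) (pr d L x) := fun n hn => by
      rw [Mt_apply, ra]
      congr 1
      refine Finset.sum_congr rfl fun y hy => ?_
      have e : (pr d L x - fun j => (y j : ZMod (2 ^ L))) = pr d L (x - y) := by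
        ext j; simp [pr]
      rw [e, lf_pr]
      intro j
      rw [Finset.mem_Icc] at hy
      have h1 := hy.1 j
      have h2 := hy.2 j
      have h3 : (2 : ℤ) ^ n ≤ 2 ^ N := pow_le_pow_right₀ (by norm_num) hn
      have h4 : |y j| ≤ 2 ^ N := abs_le.mpr ⟨by simp only at h1; linarith, by simp only at h2; linarith⟩
      have h5 := abs_sub (x j) (y j)
      have h6 := hR x hx j
      rw [Pi.sub_apply]
      linarith
    have := hW2 (pr d L x) u hu (fun j => (huN j).trans_lt hNL) J
    refine le_trans (le_of_eq ?_) this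
    unfold vsum
    congr 1
    refine Finset.sum_congr rfl fun j _ => ?_
    beta_reduce
    rw [key _ (huN _), key _ (huN _)]

lemma transferC {p r : ℝ} (hp : 1 < p) (hr : 2 < r) : ∃ C, 0 < C ∧ ∀ (d : ℕ) (f : (Fin d → ℤ) → ℂ) (E : ℝ), 0 ≤ E →
    (∀ s : Finset (Fin d → ℤ), ∑ x ∈ s, ‖f x‖ ^ p ≤ E ^ p) → ∀ (N : ℕ) (s : Finset (Fin d → ℤ)),
    ∃ W : (Fin d → ℤ) → ℝ, (∀ x, 0 ≤ W x) ∧ ∑ x ∈ s, W x ^ p ≤ (C * E) ^ p ∧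
      ∀ x ∈ s, ∀ (u : ℕ → ℕ), Monotone u → (∀ j, u j ≤ N) →
        ∀ J, (∑ j ∈ Finset.range J, ‖cubeAvg d ((2 : ℝ) ^ (u (j + 1))) f x - cubeAvg d ((2 : ℝ) ^ u j) f x‖ ^ r) ^ (1 / r) ≤ W x := by
  obtain ⟨C, hC, H⟩ := transfer hp hr
  refine ⟨2 * C, by positivity, fun d f E hE hf N s => ?_⟩
  have hp0 : 0 < p := by linarith
  obtain ⟨W, hW0, hW1, hW2⟩ := H d (fun x => (f x).re) E hE (fun s => le_trans (Finset.sum_le_sum fun x _ =>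
    Real.rpow_le_rpow (abs_nonneg _) (Complex.abs_re_le_norm _) hp0.le) (hf s)) N s
  obtain ⟨V, hV0, hV1, hV2⟩ := H d (fun x => (f x).im) E hE (fun s => le_trans (Finset.sum_le_sum fun x _ =>
    Real.rpow_le_rpow (abs_nonneg _) (Complex.abs_im_le_norm _) hp0.le) (hf s)) N s
  have root : ∀ {q a c : ℝ}, 0 < q → 0 ≤ a → 0 ≤ c → a ≤ c ^ q → a ^ (1 / q) ≤ c := fun {q a c} hq ha hc h => by
    refine (Real.rpow_le_rpow ha h (by positivity)).trans (le_of_eq ?_)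
    rw [← Real.rpow_mul hc, mul_one_div_cancel hq.ne', Real.rpow_one]
  refine ⟨fun x => W x + V x, fun x => add_nonneg (hW0 x) (hV0 x), ?_, fun x hx u hu huN J => ?_⟩
  · have h1 := Real.Lp_add_le s W V hp.le
    have h2 := root hp0 (Finset.sum_nonneg fun _ _ => Real.rpow_nonneg (abs_nonneg _) _) (by positivity) hW1
    have h3 := root hp0 (Finset.sum_nonneg fun _ _ => Real.rpow_nonneg (abs_nonneg _) _) (by positivity) hV1
    have h4 : (∑ x ∈ s, |W x + V x| ^ p) ^ (1 / p) ≤ 2 * C * E := by linarith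
    have hn : 0 ≤ ∑ x ∈ s, |W x + V x| ^ p := Finset.sum_nonneg fun _ _ => Real.rpow_nonneg (abs_nonneg _) _
    have h5 := Real.rpow_le_rpow (by positivity) h4 hp0.le
    rw [← Real.rpow_mul hn, one_div_mul_cancel hp0.ne', Real.rpow_one] at h5
    refine le_trans (le_of_eq (Finset.sum_congr rfl fun x _ => ?_)) h5
    rw [abs_of_nonneg (add_nonneg (hW0 x) (hV0 x))]
  · have e : ∀ n : ℕ, cubeAvg d ((2 : ℝ) ^ n) f x = ⟨ra d n (fun x => (f x).re) x, ra d n (fun x => (f x).im) x⟩ := fun n => by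
      have hfl : ⌊(2 : ℝ) ^ n⌋ = 2 ^ n := by
        have : ((2 : ℝ) ^ n) = ((2 ^ n : ℤ) : ℝ) := by push_cast; rfl
        rw [this, Int.floor_intCast]
      have hc : ((((2 * 2 ^ n + 1) ^ d : ℤ) : ℂ)⁻¹) = ((((2 * 2 ^ n + 1 : ℝ) ^ d)⁻¹ : ℝ) : ℂ) := by push_cast; rfl
      rw [cubeAvg, hfl, hc]
      apply Complex.ext
      · rw [Complex.re_ofReal_mul, Complex.re_sum]; rfl
      · rw [Complex.im_ofReal_mul, Complex.im_sum]; rfl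
    have h1 := hW2 x hx u hu huN J
    have h2 := hV2 x hx u hu huN J
    have h3 := Real.Lp_add_le (p := r) (Finset.range J)
      (fun j => |ra d (u (j + 1)) (fun x => (f x).re) x - ra d (u j) (fun x => (f x).re) x|)
      (fun j => |ra d (u (j + 1)) (fun x => (f x).im) x - ra d (u j) (fun x => (f x).im) x|) (by linarith)
    simp only [abs_abs] at h3
    unfold vsum at h1 h2
    refine le_trans (Real.rpow_le_rpow (Finset.sum_nonneg fun _ _ => by positivity) (Finset.sum_le_sum fun j _ => ?_) (by positivity))
      (h3.trans (add_le_add h1 h2))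
    refine Real.rpow_le_rpow (norm_nonneg _) ?_ (by linarith)
    rw [abs_of_nonneg (add_nonneg (abs_nonneg _) (abs_nonneg _)), e, e]
    exact Complex.norm_le_abs_re_add_abs_im _

/-- truncated variation -/
def vN (r : ℝ) (N : ℕ) (a : ℕ → ℂ) : ℝ≥0∞ :=
  ⨆ (J : ℕ) (u : Fin (J + 1) → ℕ) (_ : StrictMono u) (_ : ∀ j, u j ≤ N),
    (∑ j : Fin J, (‖a (u j.succ) - a (u j.castSucc)‖₊ : ℝ≥0∞) ^ r) ^ (1 / r)

lemma vN_mono (r : ℝ) (a : ℕ → ℂ) : Monotone (fun N => vN r N a) := by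
  intro N M h
  refine iSup_le fun J => iSup_le fun u => iSup_le fun hu => iSup_le fun hN => ?_
  exact le_iSup_of_le J (le_iSup_of_le u (le_iSup_of_le hu (le_iSup_of_le (fun j => (hN j).trans h) le_rfl)))

lemma iSup_vN (r : ℝ) (a : ℕ → ℂ) : ⨆ N, vN r N a = varSeqSem r a := by
  apply le_antisymm
  · refine iSup_le fun N => iSup_le fun J => iSup_le fun u => iSup_le fun hu => iSup_le fun hN => ?_
    exact le_iSup_of_le J (le_iSup_of_le u (le_iSup_of_le hu le_rfl))
  · refine iSup_le fun J => iSup_le fun u => iSup_le fun hu => ?_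
    refine le_iSup_of_le (u (Fin.last J)) ?_
    exact le_iSup_of_le J (le_iSup_of_le u (le_iSup_of_le hu (le_iSup_of_le (fun j => hu.monotone (Fin.le_last j)) le_rfl)))

lemma vN_le {r : ℝ} (hr : 0 < r) (N : ℕ) (a : ℕ → ℂ) (w : ℝ) (h : ∀ (u : ℕ → ℕ), Monotone u → (∀ j, u j ≤ N) →
    ∀ J, (∑ j ∈ Finset.range J, ‖a (u (j + 1)) - a (u j)‖ ^ r) ^ (1 / r) ≤ w) : vN r N a ≤ ENNReal.ofReal w := by
  refine iSup_le fun J => iSup_le fun u => iSup_le fun hu => iSup_le fun hN => ?_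
  have := h (fun j => u ⟨min j J, by omega⟩) (fun i j hij => hu.monotone (by
    show min i J ≤ min j J
    omega)) (fun j => hN _) J
  refine le_trans (le_of_eq ?_) (ENNReal.ofReal_le_ofReal this)
  rw [← ENNReal.ofReal_rpow_of_nonneg (Finset.sum_nonneg fun _ _ => by positivity) (by positivity),
    ENNReal.ofReal_sum_of_nonneg (fun _ _ => by positivity), Finset.sum_range]
  congr 1
  refine Finset.sum_congr rfl fun j _ => ?_
  rw [← ENNReal.ofReal_rpow_of_nonneg (norm_nonneg _) hr.le, ofReal_norm]
  have h1 : (⟨min (j + 1) J, by omega⟩ : Fin (J + 1)) = j.succ := by ext; simp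
  have h2 : (⟨min j J, by omega⟩ : Fin (J + 1)) = j.castSucc := by ext; simp
  rw [h1, h2]
  rfl

lemma final {p r : ℝ} (hp : 1 < p) (hr : 2 < r) : ∃ C : ℝ, 0 < C ∧ ∀ (d : ℕ) (f : (Fin d → ℤ) → ℂ),
      lpZ d (ENNReal.ofReal p) (nnC f) ≠ ∞ →
      lpZ d (ENNReal.ofReal p)
          (fun x => varSeqSem r (fun n => cubeAvg d ((2 : ℝ) ^ n) f x))
        ≤ ENNReal.ofReal C * lpZ d (ENNReal.ofReal p) (nnC f) := by
  obtain ⟨C, hC, H⟩ := transferC hp hr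
  have hp0 : 0 < p := by linarith
  refine ⟨C, hC, fun d f hf => ?_⟩
  obtain ⟨E, hE⟩ : ∃ E, E = (lpZ d (ENNReal.ofReal p) (nnC f)).toReal := ⟨_, rfl⟩
  have hE0 : 0 ≤ E := hE ▸ ENNReal.toReal_nonneg
  have hE1 : lpZ d (ENNReal.ofReal p) (nnC f) = ENNReal.ofReal E := by rw [hE, ENNReal.ofReal_toReal hf]
  rw [hE1, ← ENNReal.ofReal_mul hC.le]
  rw [lpZ, if_neg ENNReal.ofReal_ne_top, ENNReal.toReal_ofReal hp0.le] at hE1 ⊢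
  have hE2 : ∑' x, nnC f x ^ p = ENNReal.ofReal (E ^ p) := by
    rw [← ENNReal.ofReal_rpow_of_nonneg hE0 hp0.le, ← hE1, ← ENNReal.rpow_mul, one_div_mul_cancel hp0.ne', ENNReal.rpow_one]
  have hfs : ∀ s : Finset (Fin d → ℤ), ∑ x ∈ s, ‖f x‖ ^ p ≤ E ^ p := fun s => by
    have h1 := ENNReal.sum_le_tsum (f := fun x => nnC f x ^ p) s
    rw [hE2] at h1
    have h2 : ∑ x ∈ s, nnC f x ^ p = ENNReal.ofReal (∑ x ∈ s, ‖f x‖ ^ p) := by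
      rw [ENNReal.ofReal_sum_of_nonneg (fun _ _ => by positivity)]
      refine Finset.sum_congr rfl fun x _ => ?_
      rw [← ENNReal.ofReal_rpow_of_nonneg (norm_nonneg _) hp0.le, ofReal_norm]
      rfl
    rw [h2] at h1
    exact (ENNReal.ofReal_le_ofReal_iff (by positivity)).mp h1
  have main : ∑' x, varSeqSem r (fun n => cubeAvg d ((2 : ℝ) ^ n) f x) ^ p ≤ ENNReal.ofReal ((C * E) ^ p) := by
    rw [ENNReal.tsum_eq_iSup_sum]
    refine iSup_le fun s => ?_
    have ht : Filter.Tendsto (fun N => ∑ x ∈ s, vN r N (fun n => cubeAvg d ((2 : ℝ) ^ n) f x) ^ p) Filter.atTop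
        (nhds (∑ x ∈ s, varSeqSem r (fun n => cubeAvg d ((2 : ℝ) ^ n) f x) ^ p)) := by
      refine tendsto_finsetSum s fun x _ => ?_
      have := tendsto_atTop_iSup (vN_mono r (fun n => cubeAvg d ((2 : ℝ) ^ n) f x))
      rw [iSup_vN] at this
      exact (ENNReal.continuous_rpow_const.tendsto _).comp this
    refine le_of_tendsto' ht fun N => ?_
    obtain ⟨W, hW0, hW1, hW2⟩ := H d f E hE0 hfs N s
    calc ∑ x ∈ s, vN r N (fun n => cubeAvg d ((2 : ℝ) ^ n) f x) ^ p
        ≤ ∑ x ∈ s, ENNReal.ofReal (W x ^ p) := by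
          refine Finset.sum_le_sum fun x hx => ?_
          rw [← ENNReal.ofReal_rpow_of_nonneg (hW0 x) hp0.le]
          exact ENNReal.rpow_le_rpow (vN_le (by linarith) N _ _ (hW2 x hx)) hp0.le
      _ = ENNReal.ofReal (∑ x ∈ s, W x ^ p) := by
          rw [ENNReal.ofReal_sum_of_nonneg (fun x _ => Real.rpow_nonneg (hW0 x) _)]
      _ ≤ _ := ENNReal.ofReal_le_ofReal hW1
  refine (ENNReal.rpow_le_rpow main (by positivity : 0 ≤ 1 / p)).trans (le_of_eq ?_)
  rw [ENNReal.ofReal_rpow_of_nonneg (by positivity) (by positivity), ← Real.rpow_mul (by positivity),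
    mul_one_div_cancel hp0.ne', Real.rpow_one]

end
end DF

/-- dimension-free long (dyadic) `r`-variational estimate over cubes for
`p ∈ (1,∞)`, `r ∈ (2,∞)` (Theorem 1.6). -/
theorem statement6 (p r : ℝ) (hp1 : 1 < p) (hr : 2 < r) :
    ∃ C : ℝ, 0 < C ∧ ∀ (d : ℕ) (f : (Fin d → ℤ) → ℂ),
      lpZ d (ENNReal.ofReal p) (nnC f) ≠ ∞ →
      lpZ d (ENNReal.ofReal p)
          (fun x => varSeqSem r (fun n => cubeAvg d ((2 : ℝ) ^ n) f x))
        ≤ ENNReal.ofReal C * lpZ d (ENNReal.ofReal p) (nnC f) := by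
  exact DF.final hp1 hr
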